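/- arXiv:2412.19783 — 2 statements merged into one kernel-verified Lean document; each statement's English description precedes it below -/
import Mathlib

section
/- The polynomial I_n(y) = Σ_{T ∈ LT_n} y^{inv(T)} has log-concave coefficients for all n ≥ 1. -/
/-- The number of inversions of a labeled tree on vertex set `{0, 1, ..., n}`:
pairs `(i, j)` with `0 < i < j` such that `j` lies on the (unique) path from `i` to `0`. -/
noncomputable def treeInv {n : ℕ} (T : SimpleGraph (Fin (n + 1))) : ℕ :=
  Nat.card {p : Fin (n + 1) × Fin (n + 1) //
    0 < p.1 ∧ p.1 < p.2 ∧ ∀ w : T.Walk p.1 0, w.IsPath → p.2 ∈ w.support}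

open scoped Classical in
/-- The inversion enumerator `I_{n+1}(y) = Σ_{T ∈ LT_{n+1}} y^{inv T}` of labeled trees
on the vertex set `{0, 1, ..., n}`. -/
noncomputable def invPoly (n : ℕ) : Polynomial ℤ :=
  ∑ᶠ T : {G : SimpleGraph (Fin (n + 1)) // G.IsTree}, (Polynomial.X : Polynomial ℤ) ^ treeInv T.1

/-- A polynomial has log-concave coefficients if `a_{i-1} * a_{i+1} ≤ a_i ^ 2` for all
interior indices (the inequality is trivial outside the support). -/
def PolyLogConcave (p : Polynomial ℤ) : Prop :=
  ∀ i : ℕ, p.coeff i * p.coeff (i + 2) ≤ p.coeff (i + 1) ^ 2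

namespace InvPoly

/-- The equivalence relation generated by identifying the two entries of a pair. -/
def pairSetoid {V : Type*} (P : V × V) : Setoid V := sInf {s | s P.1 P.2}

/-- One less than the number of equivalence classes. -/
noncomputable def rank {V : Type*} (s : Setoid V) : ℕ := Nat.card (Quotient s) - 1

section Setoid

variable {V : Type*} {s : Setoid V} {P Q : V × V}

theorem pairSetoid_le : pairSetoid P ≤ s ↔ s P.1 P.2 := by
  constructor
  · intro h
    exact h fun r hr => hr
  · intro h
    exact sInf_le h

theorem sup_pairSetoid_eq (h : s P.1 P.2) : s ⊔ pairSetoid P = s :=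
  sup_eq_left.2 (pairSetoid_le.2 h)

theorem sup_pairSetoid_rel_self : (s ⊔ pairSetoid P) P.1 P.2 :=
  pairSetoid_le.1 le_sup_right

theorem sup_pairSetoid_rel {x y : V} : (s ⊔ pairSetoid P) x y ↔
    s x y ∨ (s x P.1 ∧ s P.2 y) ∨ (s x P.2 ∧ s P.1 y) := by
  constructor
  · let q : Setoid V :=
      { r := fun x y => s x y ∨ (s x P.1 ∧ s P.2 y) ∨ (s x P.2 ∧ s P.1 y)
        iseqv :=
          { refl := fun x => Or.inl (s.refl' x)
            symm := by
              intro x y h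
              have := @s.symm'
              grind
            trans := by
              intro x y z h₁ h₂
              have hs := @s.symm'
              have ht := @s.trans'
              grind } }
    have hq : s ⊔ pairSetoid P ≤ q := by
      refine sup_le (fun _ _ h => Or.inl h) (pairSetoid_le.2 ?_)
      exact Or.inr (Or.inl ⟨s.refl' _, s.refl' _⟩)
    exact fun h => hq h
  · have h₁ : s ≤ s ⊔ pairSetoid P := le_sup_left
    have h₂ : (s ⊔ pairSetoid P) P.1 P.2 := sup_pairSetoid_rel_self
    rintro (h | ⟨h, h'⟩ | ⟨h, h'⟩)
    · exact h₁ h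
    · exact Setoid.trans' _ (h₁ h) (Setoid.trans' _ h₂ (h₁ h'))
    · exact Setoid.trans' _ (h₁ h) (Setoid.trans' _ (Setoid.symm' _ h₂) (h₁ h'))

variable [Finite V] [Nonempty V]

instance nonempty_quotient (s : Setoid V) : Nonempty (Quotient s) :=
  ‹Nonempty V›.map (Quotient.mk s)

theorem rank_add_one (s : Setoid V) : rank s + 1 = Nat.card (Quotient s) := by
  have : 0 < Nat.card (Quotient s) := Nat.card_pos
  unfold rank; omega

theorem rank_eq_zero : rank s = 0 ↔ s = ⊤ := by
  have h := rank_add_one s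
  have : rank s = 0 ↔ Nat.card (Quotient s) = 1 := by omega
  rw [this, Nat.card_eq_one_iff_unique, Setoid.eq_top_iff]
  constructor
  · rintro ⟨h, _⟩ x y
    exact Quotient.exact (h.elim (Quotient.mk s x) (Quotient.mk s y))
  · intro h
    refine ⟨⟨fun a b => ?_⟩, inferInstance⟩
    induction a using Quotient.ind
    induction b using Quotient.ind
    exact Quotient.sound (h _ _)

theorem rank_sup_pairSetoid (h : ¬ s P.1 P.2) : rank (s ⊔ pairSetoid P) + 1 = rank s := by
  classical
  have h₁ := rank_add_one s
  have h₂ := rank_add_one (s ⊔ pairSetoid P)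
  let f : {q : Quotient s // q ≠ Quotient.mk s P.1} → Quotient (s ⊔ pairSetoid P) :=
    fun q => Quotient.map' id (fun x y hxy => (le_sup_left : s ≤ s ⊔ pairSetoid P) hxy) q.1
  have hf : Function.Bijective f := by
    constructor
    · rintro ⟨a, ha⟩ ⟨b, hb⟩ hab
      induction a using Quotient.ind with | _ a
      induction b using Quotient.ind with | _ b
      have ha' : ¬ s a P.1 := fun h => ha (Quotient.sound h)
      have hb' : ¬ s b P.1 := fun h => hb (Quotient.sound h)
      have hab' : (s ⊔ pairSetoid P) a b := Quotient.exact hab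
      rw [sup_pairSetoid_rel] at hab'
      have hs := @s.symm'
      have : s a b := by tauto
      exact Subtype.ext (Quotient.sound this)
    · intro b
      induction b using Quotient.ind with | _ b
      by_cases hb : s b P.1
      · refine ⟨⟨Quotient.mk s P.2, fun h' => h (s.symm' (Quotient.exact h'))⟩, ?_⟩
        refine Quotient.sound ?_
        refine sup_pairSetoid_rel.2 (Or.inr (Or.inr ⟨s.refl' _, s.symm' hb⟩))
      · exact ⟨⟨Quotient.mk s b, fun h' => hb (Quotient.exact h')⟩, rfl⟩
  have h₃ := Nat.card_congr (Equiv.ofBijective f hf)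
  have h₄ : Nat.card {q : Quotient s // q ≠ Quotient.mk s P.1} + 1 = Nat.card (Quotient s) := by
    have := Fintype.ofFinite (Quotient s)
    simp only [Nat.card_eq_fintype_card]
    have := Fintype.card_subtype_compl (fun q : Quotient s => q = Quotient.mk s P.1)
    simp only [Fintype.card_subtype_eq] at this
    have h0 : 0 < Fintype.card (Quotient s) := Fintype.card_pos
    simp only [ne_eq]
    omega
  omega

theorem rank_le_rank_sup_pairSetoid_add_one (s : Setoid V) (P : V × V) :
    rank s ≤ rank (s ⊔ pairSetoid P) + 1 := by
  by_cases h : s P.1 P.2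
  · rw [sup_pairSetoid_eq h]; omega
  · exact (rank_sup_pairSetoid h).ge

end Setoid
end InvPoly

namespace InvPoly

open PowerSeries

/-- Division by the variable, discarding the constant term. -/
noncomputable def shift : ℝ⟦X⟧ →ₗ[ℝ] ℝ⟦X⟧ where
  toFun f := PowerSeries.mk fun k => coeff (k + 1) f
  map_add' f g := by ext; simp
  map_smul' c f := by ext; simp

/-- The functional `f ↦ ∑ k, N.choose k * ε ^ (N - k) * coeff k f`, a deformation of `coeff N`. -/
noncomputable def mixCoeff (ε : ℝ) : ℕ → ℝ⟦X⟧ →ₗ[ℝ] ℝ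
  | 0 => coeff 0
  | N + 1 => ε • mixCoeff ε N + mixCoeff ε N ∘ₗ shift

section mixCoeff

variable {ε : ℝ} {N : ℕ} {f : ℝ⟦X⟧}

theorem coeff_shift (k : ℕ) (f : ℝ⟦X⟧) : coeff k (shift f) = coeff (k + 1) f := by
  simp [shift]

theorem shift_X_mul (f : ℝ⟦X⟧) : shift (X * f) = f := by
  ext k
  simp [coeff_shift, coeff_succ_X_mul]

theorem mixCoeff_zero_X_mul (f : ℝ⟦X⟧) : mixCoeff ε 0 (X * f) = 0 := by
  simp [mixCoeff]

theorem mixCoeff_succ (f : ℝ⟦X⟧) :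
    mixCoeff ε (N + 1) f = ε * mixCoeff ε N f + mixCoeff ε N (shift f) := by
  simp [mixCoeff]

theorem mixCoeff_succ_X_mul (f : ℝ⟦X⟧) :
    mixCoeff ε (N + 1) (X * f) = ε * mixCoeff ε N (X * f) + mixCoeff ε N f := by
  rw [mixCoeff_succ, shift_X_mul]

theorem mixCoeff_C_mul (c : ℝ) (f : ℝ⟦X⟧) : mixCoeff ε N (C c * f) = c * mixCoeff ε N f := by
  rw [← smul_eq_C_mul, map_smul, smul_eq_mul]

theorem mixCoeff_succ_X_mul' (f : ℝ⟦X⟧) :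
    mixCoeff ε (N + 1) (X * f) = mixCoeff ε N ((C ε * X + 1) * f) := by
  rw [mixCoeff_succ_X_mul, add_mul, one_mul, map_add, mul_assoc, mixCoeff_C_mul]

theorem mixCoeff_nonneg (hε : 0 ≤ ε) (hf : ∀ k, 0 ≤ coeff k f) : 0 ≤ mixCoeff ε N f := by
  induction N generalizing f with
  | zero => exact hf 0
  | succ N ih =>
    rw [mixCoeff_succ]
    have h₁ := ih hf
    have h₂ : 0 ≤ mixCoeff ε N (shift f) := ih fun k => by rw [coeff_shift]; exact hf _
    positivity

theorem mixCoeff_pos (hε : 0 < ε) (hf : ∀ k, 0 ≤ coeff k f) {k : ℕ} (hk : k ≤ N)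
    (hfk : 0 < coeff k f) : 0 < mixCoeff ε N f := by
  induction N generalizing f k with
  | zero =>
    obtain rfl : k = 0 := by omega
    exact hfk
  | succ N ih =>
    rw [mixCoeff_succ]
    have h₁ : ∀ k, 0 ≤ coeff k (shift f) := fun k => by rw [coeff_shift]; exact hf _
    have h₂ : 0 ≤ mixCoeff ε N (shift f) := mixCoeff_nonneg hε.le h₁
    have h₃ : 0 ≤ mixCoeff ε N f := mixCoeff_nonneg hε.le hf
    rcases k with _ | k
    · have := ih hf (Nat.zero_le N) hfk
      positivity
    · have := ih h₁ (k := k) (by omega) (by rwa [coeff_shift])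
      positivity

theorem mixCoeff_X_pow_mul_eq_zero {k : ℕ} (hk : N < k) (f : ℝ⟦X⟧) :
    mixCoeff ε N (X ^ k * f) = 0 := by
  induction N generalizing k with
  | zero =>
    obtain ⟨k, rfl⟩ : ∃ l, k = l + 1 := ⟨k - 1, by omega⟩
    rw [pow_succ', mul_assoc, mixCoeff_zero_X_mul]
  | succ N ih =>
    obtain ⟨k, rfl⟩ : ∃ l, k = l + 1 := ⟨k - 1, by omega⟩
    rw [pow_succ', mul_assoc, mixCoeff_succ_X_mul, ih (by omega), ← mul_assoc, ← pow_succ',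
      ih (by omega)]
    simp

theorem mixCoeff_X_pow (hε : ε ≠ 0) (k : ℕ) :
    mixCoeff ε N (X ^ k) = N.choose k * ε ^ N * (ε⁻¹) ^ k := by
  induction N generalizing k with
  | zero =>
    rcases k with _ | k
    · simp [mixCoeff]
    · rw [pow_succ', mixCoeff_zero_X_mul]; simp
  | succ N ih =>
    rcases k with _ | k
    · have h : shift (X ^ 0) = 0 := by
        ext k
        simp [coeff_shift, coeff_one]
      rw [mixCoeff_succ, h, ih, map_zero]
      simp [pow_succ']
    · rw [pow_succ', mixCoeff_succ_X_mul, ← pow_succ', ih, ih, Nat.choose_succ_succ]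
      push_cast
      have h : ε * ε⁻¹ = 1 := mul_inv_cancel₀ hε
      linear_combination (-(N.choose k : ℝ) * ε ^ N * ε⁻¹ ^ k) * h

theorem choose_mul_choose_le_sq (N k : ℕ) :
    N.choose k * N.choose (k + 2) ≤ N.choose (k + 1) ^ 2 := by
  rcases Nat.lt_or_ge N (k + 2) with h | h
  · rw [Nat.choose_eq_zero_of_lt h]; simp
  · have h₁ := Nat.choose_succ_right_eq N k
    have h₂ := Nat.choose_succ_right_eq N (k + 1)
    obtain ⟨m, rfl⟩ : ∃ m, N = k + 2 + m := ⟨N - (k + 2), by omega⟩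
    rw [show k + 2 + m - k = m + 2 by omega] at h₁
    rw [show k + 2 + m - (k + 1) = m + 1 by omega] at h₂
    set a := (k + 2 + m).choose k
    set b := (k + 2 + m).choose (k + 1)
    set c := (k + 2 + m).choose (k + 1 + 1)
    change a * c ≤ b ^ 2
    refine Nat.le_of_mul_le_mul_left (c := (m + 2) * (k + 2)) ?_ (by positivity)
    calc (m + 2) * (k + 2) * (a * c) = (a * (m + 2)) * (c * (k + 1 + 1)) := by ring
      _ = (b * (k + 1)) * (b * (m + 1)) := by rw [← h₁, h₂]
      _ = ((k + 1) * (m + 1)) * b ^ 2 := by ring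
      _ ≤ ((m + 2) * (k + 2)) * b ^ 2 := by gcongr ?_ * _; nlinarith

theorem mixCoeff_X_pow_logConcave (hε : 0 < ε) (k : ℕ) :
    mixCoeff ε N (X ^ k) * mixCoeff ε N (X ^ (k + 2)) ≤ mixCoeff ε N (X ^ (k + 1)) ^ 2 := by
  simp only [mixCoeff_X_pow hε.ne']
  have h : (N.choose k * N.choose (k + 2) : ℝ) ≤ (N.choose (k + 1) : ℝ) ^ 2 := by
    exact_mod_cast choose_mul_choose_le_sq N k
  calc _ = (N.choose k * N.choose (k + 2) : ℝ) * ((ε ^ N) ^ 2 * (ε⁻¹ ^ (k + 1)) ^ 2) := by ring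
    _ ≤ (N.choose (k + 1) : ℝ) ^ 2 * ((ε ^ N) ^ 2 * (ε⁻¹ ^ (k + 1)) ^ 2) := by gcongr
    _ = _ := by ring

theorem mixCoeff_zero_left (f : ℝ⟦X⟧) : mixCoeff 0 N f = coeff N f := by
  induction N generalizing f with
  | zero => rfl
  | succ N ih => rw [mixCoeff_succ, ih (shift f), coeff_shift, zero_mul, zero_add]

theorem continuous_mixCoeff (f : ℝ⟦X⟧) : Continuous fun ε => mixCoeff ε N f := by
  induction N generalizing f with
  | zero => exact continuous_const
  | succ N ih =>
    simp only [mixCoeff_succ]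
    exact (continuous_id.mul (ih f)).add (ih _)

end mixCoeff

section Bochner

variable {M : Type*} [AddCommGroup M] [Module ℝ M]

/-- The Lorentzian (reversed Cauchy–Schwarz) inequality in direction `w`. -/
def IsLorentzianAt (T : LinearMap.BilinForm ℝ M) (w : M) : Prop :=
  ∀ x, T x x * T w w ≤ T x w ^ 2

theorem isLorentzianAt_of_orthogonal {T : LinearMap.BilinForm ℝ M} {w : M}
    (hT : ∀ x y, T x y = T y x) (hw : 0 < T w w) (h : ∀ x, T x w = 0 → T x x ≤ 0) :
    IsLorentzianAt T w := by
  intro x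
  have h₁ : T (T w w • x - T x w • w) w = 0 := by
    simp; ring
  have h₂ := h _ h₁
  have h₃ : T (T w w • x - T x w • w) (T w w • x - T x w • w) =
      T w w * (T x x * T w w - T x w ^ 2) := by
    simp [hT w x]; ring
  rw [h₃] at h₂
  have := nonpos_of_mul_nonpos_right h₂ hw
  linarith

/-- A weighted Laplacian on a connected network with three nodes can be inverted on
vectors of total mass zero. -/
theorem exists_laplacian_solution {c₀₁ c₀₂ c₁₂ f₀ f₁ f₂ : ℝ} (h₀₁ : 0 < c₀₁) (h₀₂ : 0 ≤ c₀₂)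
    (h₁₂ : 0 < c₁₂) (hf : f₀ + f₁ + f₂ = 0) :
    ∃ v₀ v₁ v₂ : ℝ, c₀₁ * (v₀ - v₁) + c₀₂ * (v₀ - v₂) = f₀ ∧
      c₀₁ * (v₁ - v₀) + c₁₂ * (v₁ - v₂) = f₁ ∧ c₀₂ * (v₂ - v₀) + c₁₂ * (v₂ - v₁) = f₂ := by
  have hd : 0 < c₀₁ * c₁₂ + c₀₂ * c₁₂ + c₀₁ * c₀₂ := by positivity
  set d := c₀₁ * c₁₂ + c₀₂ * c₁₂ + c₀₁ * c₀₂ with hd'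
  obtain rfl : f₁ = -f₀ - f₂ := by linarith
  refine ⟨(f₀ * (c₀₂ + c₁₂) + c₀₂ * f₂) / d, 0, (f₂ * (c₀₁ + c₀₂) + c₀₂ * f₀) / d, ?_, ?_, ?_⟩
  all_goals
    field_simp
    rw [hd']
    ring

theorem isLorentzianAt_of_decomposition {T T₀ T₁ T₂ : LinearMap.BilinForm ℝ M}
    {w D₀ D₁ D₂ : M} {ε : ℝ} (hε : 0 < ε) (hT : ∀ x y, T x y = T y x)
    (hdec : ∀ x, T x x = ε * T₀ x x + T₁ x x + T₂ x x) (hw : w = ε • D₀ + D₁ + D₂)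
    (hD₀ : ∀ x, T₀ x w = T x D₀) (hD₁ : ∀ x, T₁ x w = T x D₁) (hD₂ : ∀ x, T₂ x w = T x D₂)
    (h₀ : IsLorentzianAt T₀ w) (h₁ : IsLorentzianAt T₁ w) (h₂ : IsLorentzianAt T₂ w)
    (hp₀ : 0 < T₀ w w) (hp₁ : 0 < T₁ w w) (hp₂ : 0 < T₂ w w)
    (h₀₁ : 0 < T D₀ D₁) (h₁₂ : 0 < T D₁ D₂) (h₀₂ : 0 ≤ T D₀ D₂) : IsLorentzianAt T w := by
  have hww : 0 < T w w := by rw [hdec]; positivity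
  refine isLorentzianAt_of_orthogonal hT hww fun x hx => ?_
  have hx' : ε * T x D₀ + T x D₁ + T x D₂ = 0 := by
    rw [← hx, hw]; simp
  obtain ⟨v₀, v₁, v₂, e₀, e₁, e₂⟩ := exists_laplacian_solution (c₀₁ := ε * T D₀ D₁)
    (c₀₂ := ε * T D₀ D₂) (c₁₂ := T D₁ D₂) (by positivity) (by positivity) h₁₂ hx'
  have s₁₀ := hT D₁ D₀
  have s₂₀ := hT D₂ D₀
  have s₂₁ := hT D₂ D₁
  have p₀ : T₀ w w = ε * T D₀ D₀ + T D₀ D₁ + T D₀ D₂ := by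
    rw [hD₀, hT, hw]; simp
  have p₁ : T₁ w w = ε * T D₀ D₁ + T D₁ D₁ + T D₁ D₂ := by
    rw [hD₁, hT, hw]; simp [s₁₀]
  have p₂ : T₂ w w = ε * T D₀ D₂ + T D₁ D₂ + T D₂ D₂ := by
    rw [hD₂, hT, hw]; simp [s₂₀, s₂₁]
  set z := x + (v₀ * ε) • D₀ + v₁ • D₁ + v₂ • D₂ with hz
  have z₀ : T z D₀ = T₀ w w * v₀ := by
    have : ε * T z D₀ = ε * (T₀ w w * v₀) := by
      rw [p₀, hz]
      simp only [map_add, map_smul, LinearMap.add_apply, LinearMap.smul_apply, smul_eq_mul, s₁₀,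
        s₂₀]
      linear_combination -e₀
    exact mul_left_cancel₀ hε.ne' this
  have z₁ : T z D₁ = T₁ w w * v₁ := by
    rw [p₁, hz]; simp [s₂₁]; linear_combination -e₁
  have z₂ : T z D₂ = T₂ w w * v₂ := by
    rw [p₂, hz]; simp; linear_combination -e₂
  have b₀ : T₀ z z ≤ T₀ w w * v₀ ^ 2 := by
    have := h₀ z
    rw [hD₀ z, z₀] at this
    exact le_of_mul_le_mul_right (by linarith) hp₀
  have b₁ : T₁ z z ≤ T₁ w w * v₁ ^ 2 := by
    have := h₁ z
    rw [hD₁ z, z₁] at this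
    exact le_of_mul_le_mul_right (by linarith) hp₁
  have b₂ : T₂ z z ≤ T₂ w w * v₂ ^ 2 := by
    have := h₂ z
    rw [hD₂ z, z₂] at this
    exact le_of_mul_le_mul_right (by linarith) hp₂
  have hzz : T z z ≤ ε * (T₀ w w * v₀ ^ 2) + T₁ w w * v₁ ^ 2 + T₂ w w * v₂ ^ 2 := by
    rw [hdec]
    have := mul_le_mul_of_nonneg_left b₀ hε.le
    linarith
  have hzx : T z z = T z x + v₀ * ε * T z D₀ + v₁ * T z D₁ + v₂ * T z D₂ := by
    have h : ∀ u, T u z = T u x + v₀ * ε * T u D₀ + v₁ * T u D₁ + v₂ * T u D₂ := by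
      intro u
      rw [hz]; simp
    exact h z
  have hxz : T z x = T x x + v₀ * ε * T x D₀ + v₁ * T x D₁ + v₂ * T x D₂ := by
    rw [hT, hz]; simp
  have hq : v₀ * ε * T x D₀ + v₁ * T x D₁ + v₂ * T x D₂ =
      ε * T D₀ D₁ * (v₀ - v₁) ^ 2 + ε * T D₀ D₂ * (v₀ - v₂) ^ 2 + T D₁ D₂ * (v₁ - v₂) ^ 2 := by
    linear_combination -v₀ * e₀ - v₁ * e₁ - v₂ * e₂
  have : 0 ≤ ε * T D₀ D₁ * (v₀ - v₁) ^ 2 + ε * T D₀ D₂ * (v₀ - v₂) ^ 2 +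
      T D₁ D₂ * (v₁ - v₂) ^ 2 := by positivity
  rw [z₀, z₁, z₂] at hzx
  linarith

end Bochner
end InvPoly

namespace InvPoly

open PowerSeries Finset

variable {V : Type*}

section

open scoped Classical in
/-- The probability that `s` together with a random subset of `E` connects everything, where
every member of `E` is absent with probability `X`. -/
noncomputable def connProb (E : Finset (V × V)) (s : Setoid V) : ℝ⟦X⟧ :=
  ∑ A ∈ E.powerset, if s ⊔ A.sup pairSetoid = ⊤ then (1 - X) ^ #A * X ^ (#E - #A) else 0

theorem connProb_empty (s : Setoid V) [Decidable (s = ⊤)] :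
    connProb ∅ s = if s = ⊤ then 1 else 0 := by
  simp [connProb]

theorem connProb_insert [DecidableEq V] {E : Finset (V × V)} {e : V × V} (he : e ∉ E)
    (s : Setoid V) : connProb (insert e E) s =
      (1 - X) * connProb E (s ⊔ pairSetoid e) + X * connProb E s := by
  classical
  unfold connProb
  rw [sum_powerset_insert he, mul_sum, mul_sum, add_comm]
  congr 1
  · refine sum_congr rfl fun A hA => ?_
    rw [mem_powerset] at hA
    have heA : e ∉ A := fun h => he (hA h)
    rw [sup_insert, ← sup_assoc, card_insert_of_notMem heA, card_insert_of_notMem he,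
      Nat.add_sub_add_right, mul_ite, mul_zero]
    simp only [pow_succ', mul_assoc]
  · refine sum_congr rfl fun A hA => ?_
    have := card_le_card (mem_powerset.1 hA)
    rw [card_insert_of_notMem he, mul_ite, mul_zero, Nat.sub_add_comm this, pow_succ']
    congr 1
    ring

theorem connProb_insert_of_rel [DecidableEq V] {E : Finset (V × V)} {e : V × V} (he : e ∉ E)
    {s : Setoid V} (hs : s e.1 e.2) : connProb (insert e E) s = connProb E s := by
  rw [connProb_insert he, sup_pairSetoid_eq hs]
  ring

end

/-- The power series `X / (1 - X)`. -/
noncomputable def odds : ℝ⟦X⟧ := X * (1 - X)⁻¹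

theorem odds_mul : odds * (1 - X) = X := by
  rw [odds, mul_assoc, PowerSeries.inv_mul_cancel _ (by simp), mul_one]

/-- Normalised connection probability. -/
noncomputable def connSeries (E : Finset (V × V)) (s : Setoid V) : ℝ⟦X⟧ :=
  odds ^ rank s * connProb E s

section connSeries

variable {E : Finset (V × V)} {e : V × V} {s : Setoid V}

theorem connSeries_insert_of_rel [DecidableEq V] (he : e ∉ E) (hs : s e.1 e.2) :
    connSeries (insert e E) s = connSeries E s := by
  rw [connSeries, connSeries, connProb_insert_of_rel he hs]

variable [Finite V] [Nonempty V]

theorem odds_pow_rank (hs : ¬ s e.1 e.2) :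
    odds ^ rank s * (1 - X) = X * odds ^ rank (s ⊔ pairSetoid e) := by
  rw [← rank_sup_pairSetoid hs, pow_succ, mul_assoc, odds_mul, mul_comm]

variable [DecidableEq V]

theorem connSeries_insert (he : e ∉ E) (hs : ¬ s e.1 e.2) : connSeries (insert e E) s =
    X * (connSeries E (s ⊔ pairSetoid e) + connSeries E s) := by
  unfold connSeries
  rw [connProb_insert he]
  linear_combination connProb E (s ⊔ pairSetoid e) * odds_pow_rank hs

theorem coeff_connSeries_nonneg (E : Finset (V × V)) (s : Setoid V) (k : ℕ) :
    0 ≤ coeff k (connSeries E s) := by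
  classical
  induction E using Finset.induction_on generalizing s k with
  | empty =>
    rw [connSeries, connProb_empty]
    split_ifs with h
    · rw [rank_eq_zero.2 h, pow_zero, mul_one, coeff_one]
      split_ifs <;> norm_num
    · simp
  | insert e E he ih =>
    by_cases hs : s e.1 e.2
    · rw [connSeries_insert_of_rel he hs]; exact ih s k
    · rw [connSeries_insert he hs]
      rcases k with _ | k
      · simp
      · rw [coeff_succ_X_mul, map_add]
        exact add_nonneg (ih _ _) (ih _ _)

theorem coeff_rank_connSeries_pos (h : s ⊔ E.sup pairSetoid = ⊤) :
    0 < coeff (rank s) (connSeries E s) := by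
  classical
  induction E using Finset.induction_on generalizing s with
  | empty =>
    have hs : s = ⊤ := by simpa using h
    rw [connSeries, connProb_empty, if_pos hs, rank_eq_zero.2 hs]
    simp
  | insert e E he ih =>
    rw [sup_insert, ← sup_assoc] at h
    by_cases hs : s e.1 e.2
    · rw [connSeries_insert_of_rel he hs]
      rw [sup_pairSetoid_eq hs] at h
      exact ih h
    · rw [connSeries_insert he hs, ← rank_sup_pairSetoid hs, coeff_succ_X_mul, map_add]
      exact add_pos_of_pos_of_nonneg (ih h) (coeff_connSeries_nonneg _ _ _)

theorem mixCoeff_X_sq_mul_nonneg {ε : ℝ} (hε : 0 < ε) (N : ℕ) (E : Finset (V × V))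
    (s : Setoid V) : 0 ≤ mixCoeff ε N (X ^ 2 * connSeries E s) := by
  refine mixCoeff_nonneg hε.le fun k => ?_
  rw [coeff_X_pow_mul']
  split_ifs
  · exact coeff_connSeries_nonneg _ _ _
  · exact le_rfl

theorem mixCoeff_X_sq_mul_pos {ε : ℝ} (hε : 0 < ε) {N : ℕ} (h : s ⊔ E.sup pairSetoid = ⊤)
    (hN : rank s + 2 ≤ N) : 0 < mixCoeff ε N (X ^ 2 * connSeries E s) := by
  refine mixCoeff_pos hε (fun k => ?_) hN ?_
  · rw [coeff_X_pow_mul']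
    split_ifs
    · exact coeff_connSeries_nonneg _ _ _
    · exact le_rfl
  · rw [coeff_X_pow_mul]
    exact coeff_rank_connSeries_pos h

end connSeries

/-- Formal linear combinations of the scalars `X` and `1` and of the merging operators. -/
abbrev MergeVec (V : Type*) : Type _ := ℝ × ℝ × (V × V → ℝ)

section op

variable [Fintype V]

/-- The operator described by a vector of coefficients: `(a, b, c)` acts as
`a * X + b + ∑ P, c P * (1 - X) * (merge along P)`. -/
noncomputable def op (x : MergeVec V) (g : Setoid V → ℝ⟦X⟧) (s : Setoid V) : ℝ⟦X⟧ :=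
  (C x.1 * X + C x.2.1) * g s + ∑ P, C (x.2.2 P) * ((1 - X) * g (s ⊔ pairSetoid P))

theorem op_add_left (x y : MergeVec V) (g : Setoid V → ℝ⟦X⟧) (s : Setoid V) :
    op (x + y) g s = op x g s + op y g s := by
  simp only [op, Prod.fst_add, Prod.snd_add, Pi.add_apply, map_add, add_mul, sum_add_distrib]
  ring

theorem op_smul_left (c : ℝ) (x : MergeVec V) (g : Setoid V → ℝ⟦X⟧) (s : Setoid V) :
    op (c • x) g s = C c * op x g s := by
  simp only [op, Prod.smul_fst, Prod.smul_snd, Pi.smul_apply, smul_eq_mul, map_mul, mul_add,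
    mul_sum]
  congr 1
  · ring
  · exact sum_congr rfl fun P _ => by ring

/-- `op x` is linear over power series, and only depends on the values above `s`. -/
theorem op_linear (x : MergeVec V) {g g₁ g₂ : Setoid V → ℝ⟦X⟧} {c₁ c₂ : ℝ⟦X⟧} {s : Setoid V}
    (h : ∀ s', s ≤ s' → g s' = c₁ * g₁ s' + c₂ * g₂ s') :
    op x g s = c₁ * op x g₁ s + c₂ * op x g₂ s := by
  have : ∀ P, C (x.2.2 P) * ((1 - X) * g (s ⊔ pairSetoid P)) =
      c₁ * (C (x.2.2 P) * ((1 - X) * g₁ (s ⊔ pairSetoid P))) +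
      c₂ * (C (x.2.2 P) * ((1 - X) * g₂ (s ⊔ pairSetoid P))) := fun P => by
    rw [h _ le_sup_left]; ring
  simp only [op, this, h s le_rfl, sum_add_distrib, ← mul_sum]
  ring

theorem op_congr (x : MergeVec V) {g g' : Setoid V → ℝ⟦X⟧} {s : Setoid V}
    (h : ∀ s', s ≤ s' → g s' = g' s') : op x g s = op x g' s := by
  simpa using op_linear x (g₁ := g') (g₂ := g') (c₁ := 1) (c₂ := 0) (fun s' hs => by simp [h s' hs])

theorem op_shift (x : MergeVec V) (g : Setoid V → ℝ⟦X⟧) (P : V × V) (s : Setoid V) :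
    op x (fun s' => g (s' ⊔ pairSetoid P)) s = op x g (s ⊔ pairSetoid P) := by
  simp only [op, sup_right_comm s]

theorem op_comm (x y : MergeVec V) (g : Setoid V → ℝ⟦X⟧) (s : Setoid V) :
    op x (op y g) s = op y (op x g) s := by
  have h : ∀ x y : MergeVec V, op x (op y g) s =
      (C x.1 * X + C x.2.1) * (C y.1 * X + C y.2.1) * g s +
      (C x.1 * X + C x.2.1) * ∑ P, C (y.2.2 P) * ((1 - X) * g (s ⊔ pairSetoid P)) +
      (C y.1 * X + C y.2.1) * ∑ P, C (x.2.2 P) * ((1 - X) * g (s ⊔ pairSetoid P)) +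
      ∑ P, ∑ Q, C (x.2.2 P) * C (y.2.2 Q) * (1 - X) ^ 2 *
        g (s ⊔ pairSetoid P ⊔ pairSetoid Q) := by
    intro x y
    simp only [op, mul_add, mul_sum, sum_add_distrib]
    have : ∀ P, C (x.2.2 P) * ((1 - X) * ((C y.1 * X + C y.2.1) * g (s ⊔ pairSetoid P))) =
      (C y.1 * X + C y.2.1) * (C (x.2.2 P) * ((1 - X) * g (s ⊔ pairSetoid P))) :=
      fun P => by ring
    simp only [this]
    have : ∀ P Q, C (x.2.2 P) * ((1 - X) * (C (y.2.2 Q) *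
        ((1 - X) * g (s ⊔ pairSetoid P ⊔ pairSetoid Q)))) =
      C (x.2.2 P) * C (y.2.2 Q) * (1 - X) ^ 2 * g (s ⊔ pairSetoid P ⊔ pairSetoid Q) :=
      fun P Q => by ring
    simp only [this]
    ring
  rw [h, h, sum_comm]
  simp only [sup_right_comm s]
  have : ∀ P Q, C (x.2.2 P) * C (y.2.2 Q) * (1 - X) ^ 2 *
      g (s ⊔ pairSetoid Q ⊔ pairSetoid P) = C (y.2.2 Q) * C (x.2.2 P) * (1 - X) ^ 2 *
      g (s ⊔ pairSetoid Q ⊔ pairSetoid P) := fun P Q => by ring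
  simp only [this]
  ring

/-- The direction `ε * X + 1`. -/
def baseVec (V : Type*) (ε : ℝ) : MergeVec V := (ε, 1, 0)

/-- The operator merging along a pair. -/
def mergeVec [DecidableEq V] (P : V × V) : MergeVec V := (0, 0, Pi.single P 1)

theorem op_scalar (a b : ℝ) (g : Setoid V → ℝ⟦X⟧) (s : Setoid V) :
    op (a, b, 0) g s = (C a * X + C b) * g s := by
  simp [op]

theorem op_baseVec (ε : ℝ) (g : Setoid V → ℝ⟦X⟧) (s : Setoid V) :
    op (baseVec V ε) g s = (C ε * X + 1) * g s := by
  simp [baseVec, op_scalar]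

theorem op_mergeVec [DecidableEq V] (P : V × V) (g : Setoid V → ℝ⟦X⟧) (s : Setoid V) :
    op (mergeVec P) g s = (1 - X) * g (s ⊔ pairSetoid P) := by
  simp only [op, mergeVec, map_zero, zero_mul, zero_add]
  rw [sum_eq_single P]
  · simp
  · intro Q _ hQ
    simp [Pi.single_eq_of_ne hQ]
  · simp

/-- The bilinear form attached to a set of pairs and an equivalence relation. -/
noncomputable def mergeForm (ε : ℝ) (N : ℕ) (E : Finset (V × V)) (s : Setoid V) :
    LinearMap.BilinForm ℝ (MergeVec V) :=
  LinearMap.mk₂ ℝ (fun x y => mixCoeff ε N (odds ^ rank s * op x (op y (connProb E)) s))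
    (fun x y z => by rw [op_add_left, mul_add, map_add])
    (fun c x y => by rw [op_smul_left, mul_left_comm, mixCoeff_C_mul, smul_eq_mul])
    (fun x y z => by
      rw [op_linear x (c₁ := 1) (c₂ := 1) (g₁ := op y (connProb E)) (g₂ := op z (connProb E))
        (fun s' _ => by rw [op_add_left, one_mul, one_mul]), one_mul, one_mul, mul_add, map_add])
    (fun c x y => by
      rw [op_linear x (c₁ := C c) (c₂ := 0) (g₁ := op y (connProb E)) (g₂ := 0)
        (fun s' _ => by rw [op_smul_left, zero_mul, add_zero]), zero_mul, add_zero,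
        mul_left_comm, mixCoeff_C_mul, smul_eq_mul])

theorem mergeForm_apply (ε : ℝ) (N : ℕ) (E : Finset (V × V)) (s : Setoid V) (x y : MergeVec V) :
    mergeForm ε N E s x y = mixCoeff ε N (odds ^ rank s * op x (op y (connProb E)) s) := rfl

theorem mergeForm_comm (ε : ℝ) (N : ℕ) (E : Finset (V × V)) (s : Setoid V) (x y : MergeVec V) :
    mergeForm ε N E s x y = mergeForm ε N E s y x := by
  rw [mergeForm_apply, mergeForm_apply, op_comm]

theorem mergeForm_baseVec (ε : ℝ) (N : ℕ) (E : Finset (V × V)) (s : Setoid V)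
    (x : MergeVec V) : mergeForm ε N E s x (baseVec V ε) =
      mixCoeff ε (N + 1) (X * (odds ^ rank s * op x (connProb E) s)) := by
  rw [mergeForm_comm, mergeForm_apply, op_baseVec, mixCoeff_succ_X_mul', mul_left_comm]

theorem mergeForm_scalar (ε : ℝ) (N : ℕ) (E : Finset (V × V)) (s : Setoid V)
    (x : MergeVec V) (a b : ℝ) : mergeForm ε N E s x (a, b, 0) =
      mixCoeff ε N ((C a * X + C b) * (odds ^ rank s * op x (connProb E) s)) := by
  rw [mergeForm_comm, mergeForm_apply, op_scalar, mul_left_comm]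

theorem mergeForm_baseVec_baseVec (ε : ℝ) (N : ℕ) (E : Finset (V × V)) (s : Setoid V) :
    mergeForm ε N E s (baseVec V ε) (baseVec V ε) =
      mixCoeff ε (N + 2) (X ^ 2 * connSeries E s) := by
  rw [mergeForm_baseVec, op_baseVec, mul_left_comm (odds ^ rank s), mul_left_comm X,
    ← mixCoeff_succ_X_mul', connSeries]
  congr 1
  ring

theorem mergeForm_eq_zero {ε : ℝ} {N : ℕ} {E : Finset (V × V)} {s : Setoid V}
    (h : N < rank s) : mergeForm ε N E s = 0 := by
  refine LinearMap.ext₂ fun x y => ?_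
  rw [mergeForm_apply, odds, mul_pow, mul_assoc, mixCoeff_X_pow_mul_eq_zero h]
  rfl

variable {E : Finset (V × V)} {e : V × V} {s : Setoid V}

theorem mergeForm_zero [Nonempty V] {ε : ℝ} (E : Finset (V × V)) (hs : ¬ s e.1 e.2) :
    mergeForm ε 0 E s = 0 := by
  refine mergeForm_eq_zero ?_
  have := rank_sup_pairSetoid hs
  omega

variable [DecidableEq V]

theorem mergeForm_insert_of_rel {ε : ℝ} {N : ℕ} (he : e ∉ E) (hs : s e.1 e.2) :
    mergeForm ε N (insert e E) s = mergeForm ε N E s := by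
  refine LinearMap.ext₂ fun x y => ?_
  have h : op x (op y (connProb (insert e E))) s = op x (op y (connProb E)) s :=
    op_congr x fun s' h => op_congr y fun s'' h' => connProb_insert_of_rel he (h' (h hs))
  rw [mergeForm_apply, mergeForm_apply, h]

theorem op_connProb_insert (he : e ∉ E) (x : MergeVec V) (s : Setoid V) :
    op x (connProb (insert e E)) s =
      (1 - X) * op x (connProb E) (s ⊔ pairSetoid e) + X * op x (connProb E) s := by
  rw [op_linear x (c₁ := 1 - X) (c₂ := X) (fun s' _ => connProb_insert he s'), op_shift]

theorem op_op_connProb_insert (he : e ∉ E) (x y : MergeVec V) (s : Setoid V) :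
    op x (op y (connProb (insert e E))) s =
      (1 - X) * op x (op y (connProb E)) (s ⊔ pairSetoid e) + X * op x (op y (connProb E)) s := by
  rw [op_linear x (c₁ := 1 - X) (c₂ := X) (fun s' _ => op_connProb_insert he y s'), op_shift]

variable [Nonempty V]

theorem mergeForm_insert_succ {ε : ℝ} {N : ℕ} (he : e ∉ E) (hs : ¬ s e.1 e.2)
    (x y : MergeVec V) : mergeForm ε (N + 1) (insert e E) s x y =
      ε * mergeForm ε N (insert e E) s x y + mergeForm ε N E (s ⊔ pairSetoid e) x y +
        mergeForm ε N E s x y := by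
  have h : odds ^ rank s * op x (op y (connProb (insert e E))) s =
      X * (odds ^ rank (s ⊔ pairSetoid e) * op x (op y (connProb E)) (s ⊔ pairSetoid e) +
        odds ^ rank s * op x (op y (connProb E)) s) := by
    rw [op_op_connProb_insert he]
    linear_combination op x (op y (connProb E)) (s ⊔ pairSetoid e) * odds_pow_rank hs
  simp only [mergeForm_apply]
  rw [h, mixCoeff_succ_X_mul, map_add]
  ring

theorem mergeForm_mergeVec {ε : ℝ} {N : ℕ} (he : e ∉ E) (hs : ¬ s e.1 e.2) (x : MergeVec V) :
    mergeForm ε N (insert e E) s x (mergeVec e) =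
      mixCoeff ε N (X * (odds ^ rank (s ⊔ pairSetoid e) *
        op x (connProb E) (s ⊔ pairSetoid e))) := by
  have h : op x (connProb (insert e E)) (s ⊔ pairSetoid e) =
      op x (connProb E) (s ⊔ pairSetoid e) :=
    op_congr x fun s' h => connProb_insert_of_rel he (h sup_pairSetoid_rel_self)
  rw [mergeForm_comm, mergeForm_apply, op_mergeVec, ← mul_assoc, odds_pow_rank hs, mul_assoc, h]

theorem mergeForm_deleteVec {ε : ℝ} {N : ℕ} (he : e ∉ E) (hs : ¬ s e.1 e.2) (x : MergeVec V) :
    mergeForm ε N (insert e E) s x ((0, 1, 0) - mergeVec e) =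
      mixCoeff ε N (X * (odds ^ rank s * op x (connProb E) s)) := by
  rw [map_sub, mergeForm_scalar, mergeForm_mergeVec he hs, ← map_sub, op_connProb_insert he]
  congr 1
  simp only [map_zero, map_one]
  linear_combination op x (connProb E) (s ⊔ pairSetoid e) * odds_pow_rank hs

theorem isLorentzianAt_mergeForm_insert {ε : ℝ} (hε : 0 < ε) (he : e ∉ E) (hs : ¬ s e.1 e.2)
    (hspan : s ⊔ E.sup pairSetoid = ⊤)
    (h₁ : ∀ N, IsLorentzianAt (mergeForm ε N E (s ⊔ pairSetoid e)) (baseVec V ε))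
    (h₂ : ∀ N, IsLorentzianAt (mergeForm ε N E s) (baseVec V ε)) (N : ℕ) :
    IsLorentzianAt (mergeForm ε N (insert e E) s) (baseVec V ε) := by
  have hr := rank_sup_pairSetoid hs
  have hspan₀ : s ⊔ (insert e E).sup pairSetoid = ⊤ := by
    rw [sup_insert, sup_left_comm, hspan, sup_top_eq]
  have hspan₁ : s ⊔ pairSetoid e ⊔ E.sup pairSetoid = ⊤ := by
    rw [sup_right_comm, hspan, top_sup_eq]
  induction N with
  | zero =>
    intro x
    simp [mergeForm_zero _ hs]
  | succ N ih =>
    rcases lt_or_ge N (rank s) with hN | hN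
    · have hT : mergeForm ε (N + 1) (insert e E) s = mergeForm ε N E (s ⊔ pairSetoid e) := by
        refine LinearMap.ext₂ fun x y => ?_
        rw [mergeForm_insert_succ he hs, mergeForm_eq_zero hN, mergeForm_eq_zero hN]
        simp
      rw [hT]
      exact h₁ N
    · have h₀₁ : 0 < mixCoeff ε (N + 1) (X ^ 2 * connSeries E (s ⊔ pairSetoid e)) :=
        mixCoeff_X_sq_mul_pos hε hspan₁ (by omega)
      refine isLorentzianAt_of_decomposition (T₀ := mergeForm ε N (insert e E) s)
        (T₁ := mergeForm ε N E (s ⊔ pairSetoid e)) (T₂ := mergeForm ε N E s)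
        (D₀ := (1, 0, 0)) (D₁ := mergeVec e) (D₂ := (0, 1, 0) - mergeVec e) hε
        (mergeForm_comm _ _ _ _) (fun x => mergeForm_insert_succ he hs x x) ?_ ?_ ?_ ?_
        ih (h₁ N) (h₂ N) ?_ ?_ ?_ ?_ ?_ ?_
      · rw [add_assoc, add_sub_cancel]
        simp [baseVec]
      · intro x
        rw [mergeForm_baseVec, mergeForm_scalar]
        simp
      · intro x
        rw [mergeForm_baseVec, mergeForm_mergeVec he hs]
      · intro x
        rw [mergeForm_baseVec, mergeForm_deleteVec he hs]
      · rw [mergeForm_baseVec_baseVec]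
        exact mixCoeff_X_sq_mul_pos hε hspan₀ (by omega)
      · rw [mergeForm_baseVec_baseVec]
        exact mixCoeff_X_sq_mul_pos hε hspan₁ (by omega)
      · rw [mergeForm_baseVec_baseVec]
        exact mixCoeff_X_sq_mul_pos hε hspan (by omega)
      · rw [mergeForm_mergeVec he hs, op_scalar]
        convert h₀₁ using 2
        simp only [connSeries, map_one, map_zero]
        ring
      · rw [mergeForm_deleteVec he hs, op_mergeVec]
        convert h₀₁ using 2
        rw [connSeries]
        linear_combination X * connProb E (s ⊔ pairSetoid e) * odds_pow_rank hs
      · rw [mergeForm_deleteVec he hs, op_scalar]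
        convert mixCoeff_X_sq_mul_nonneg hε (N + 1) E s using 2
        simp only [connSeries, map_one, map_zero]
        ring

end op
end InvPoly

namespace InvPoly

open PowerSeries Finset

variable {V : Type*}

section rank

variable [Finite V] [Nonempty V]

theorem rank_antitone {s s' : Setoid V} (h : s ≤ s') : rank s' ≤ rank s := by
  have h₁ := rank_add_one s
  have h₂ := rank_add_one s'
  have : Nat.card (Quotient s') ≤ Nat.card (Quotient s) := by
    refine Nat.card_le_card_of_surjective (Quotient.map' id fun x y hxy => h hxy) fun b => ?_
    induction b using Quotient.ind with | _ b
    exact ⟨Quotient.mk s b, rfl⟩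
  omega

theorem eq_of_le_of_rank_eq {s s' : Setoid V} (h : s ≤ s') (hr : rank s = rank s') : s = s' := by
  refine le_antisymm h fun x y hxy => ?_
  by_contra hs
  have h₁ := rank_sup_pairSetoid (P := (x, y)) hs
  have h₂ := rank_antitone (sup_le h (pairSetoid_le.2 hxy) : s ⊔ pairSetoid (x, y) ≤ s')
  omega

open scoped Classical in
/-- Indicator of the pairs that are not related. -/
noncomputable def sepInd (s : Setoid V) (P : V × V) : ℝ := if s P.1 P.2 then 0 else 1

theorem sup_eq_top_of_rank_eq_one {s : Setoid V} (hs : rank s = 1) {P : V × V}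
    (hP : ¬ s P.1 P.2) : s ⊔ pairSetoid P = ⊤ := by
  have := rank_sup_pairSetoid hP
  exact rank_eq_zero.1 (by omega)

open scoped Classical in
/-- In a relation with three classes, whether two pairs connect everything can be read off
from two of its coarsenings with two classes. -/
theorem indicator_sup_sup_eq_top {σ α β : Setoid V} (hα : σ ≤ α) (hβ : σ ≤ β)
    (rσ : rank σ = 2) (rα : rank α = 1) (rβ : rank β = 1) (hne : α ≠ β) (P Q : V × V) :
    (if σ ⊔ pairSetoid P ⊔ pairSetoid Q = ⊤ then 1 else 0 : ℝ) =
      sepInd α P * sepInd β Q + sepInd β P * sepInd α Q -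
        2 * (sepInd α P * sepInd β P) * (sepInd α Q * sepInd β Q) := by
  have not_top : ∀ {τ : Setoid V}, rank τ = 1 → ∀ {s : Setoid V}, s ≤ τ → s ≠ ⊤ := by
    intro τ hτ s hs h
    have := rank_antitone hs
    rw [rank_eq_zero.2 h] at this
    omega
  have sup_eq : ∀ {τ : Setoid V}, σ ≤ τ → rank τ = 1 → ∀ {R : V × V}, τ R.1 R.2 →
      ¬ σ R.1 R.2 → σ ⊔ pairSetoid R = τ := by
    intro τ hτ rτ R hR hσ
    have := rank_sup_pairSetoid hσ
    exact eq_of_le_of_rank_eq (sup_le hτ (pairSetoid_le.2 hR)) (by omega)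
  have inter : ∀ {x y : V}, α x y → β x y → σ x y := by
    intro x y h₁ h₂
    by_contra h
    exact hne ((sup_eq hα rα (R := (x, y)) h₁ h).symm.trans (sup_eq hβ rβ h₂ h))
  -- a pair related in `τ` but not in `σ`, and a pair separated by `τ`
  have mixed : ∀ {τ : Setoid V}, σ ≤ τ → rank τ = 1 → ∀ {R R' : V × V}, τ R.1 R.2 →
      ¬ σ R.1 R.2 → ¬ τ R'.1 R'.2 → σ ⊔ pairSetoid R ⊔ pairSetoid R' = ⊤ := by
    intro τ hτ rτ R R' h₁ h₂ h₃
    rw [sup_eq hτ rτ h₁ h₂]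
    exact sup_eq_top_of_rank_eq_one rτ h₃
  have two : ∀ {τ : Setoid V}, rank τ = 1 → ∀ {x y z : V}, ¬ τ x y → τ z x ∨ τ z y := by
    intro τ hτ x y z h
    have := Setoid.eq_top_iff.1 (sup_eq_top_of_rank_eq_one hτ (P := (x, y)) h) z x
    rw [sup_pairSetoid_rel] at this
    tauto
  have single : ∀ {R R' : V × V}, σ R.1 R.2 → σ ⊔ pairSetoid R ⊔ pairSetoid R' ≠ ⊤ := by
    intro R R' h h'
    have h₁ := rank_le_rank_sup_pairSetoid_add_one σ R'
    rw [sup_pairSetoid_eq h] at h'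
    rw [h', rank_eq_zero.2 rfl] at h₁
    omega
  have swap : ∀ R R' : V × V, σ ⊔ pairSetoid R ⊔ pairSetoid R' =
      σ ⊔ pairSetoid R' ⊔ pairSetoid R := fun R R' => sup_right_comm _ _ _
  have cross : ¬ α P.1 P.2 → ¬ β P.1 P.2 → ¬ α Q.1 Q.2 → ¬ β Q.1 Q.2 →
      σ ⊔ pairSetoid P ⊔ pairSetoid Q ≠ ⊤ := by
    intro h₁ h₂ h₃ h₄ htop
    have key : ∀ {p q p' q' : V}, ¬ α p q → ¬ β p q → ¬ α p' q' → ¬ β p' q' →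
        α p' p → σ ⊔ pairSetoid (p, q) ⊔ pairSetoid (p', q') ≠ ⊤ := by
      intro p q p' q' h₁ h₂ h₃ h₄ h₅ htop
      have sα := @α.symm'
      have tα := @α.trans'
      have sβ := @β.symm'
      have tβ := @β.trans'
      have e₁ : α q' q := (two rα h₁).resolve_left fun h => h₃ (tα h₅ (sα h))
      rcases two rβ h₂ (z := p') with h | h
      · have e₂ : β q' q := (two rβ h₂).resolve_left fun h' => h₄ (tβ h (sβ h'))
        have i₁ : σ p' p := inter h₅ h
        have i₂ : σ q' q := inter e₁ e₂
        have hQ : (σ ⊔ pairSetoid (p, q)) p' q' :=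
          sup_pairSetoid_rel.2 (Or.inr (Or.inl ⟨i₁, σ.symm' i₂⟩))
        rw [sup_pairSetoid_eq (P := (p', q')) hQ] at htop
        have := rank_le_rank_sup_pairSetoid_add_one σ (p, q)
        rw [htop, rank_eq_zero.2 rfl] at this
        omega
      · have hpp' : (σ ⊔ pairSetoid (p, q) ⊔ pairSetoid (p', q')) p p' :=
          Setoid.eq_top_iff.1 htop _ _
        have hpp' := sup_pairSetoid_rel.1 hpp'
        have rel : ∀ {x y : V}, (σ ⊔ pairSetoid (p, q)) x y →
          σ x y ∨ (σ x p ∧ σ q y) ∨ (σ x q ∧ σ p y) := sup_pairSetoid_rel.1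
        have hpp' := hpp'.imp rel (Or.imp (And.imp rel rel) (And.imp rel rel))
        have lα : ∀ {x y}, σ x y → α x y := fun h => hα h
        have lβ : ∀ {x y}, σ x y → β x y := fun h => hβ h
        have e₂ : β q' p := (two rβ h₂).resolve_right fun h' => h₄ (tβ h (sβ h'))
        have n₁ : ¬ σ p q := fun h => h₁ (lα h)
        have n₂ : ¬ σ p' q' := fun h => h₃ (lα h)
        have n₃ : ¬ σ p p' := fun h' => h₂ (tβ (lβ h') h)
        have n₄ : ¬ σ p q' := fun h => h₁ (tα (lα h) e₁)
        have n₅ : ¬ σ q p' := fun h => h₁ (sα (tα (lα h) h₅))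
        have n₆ : ¬ σ q q' := fun h => h₂ (sβ (tβ (lβ h) e₂))
        have sσ := @σ.symm'
        have m₁ := fun h => n₁ (sσ h)
        have m₂ := fun h => n₂ (sσ h)
        have m₃ := fun h => n₃ (sσ h)
        have m₄ := fun h => n₄ (sσ h)
        have m₅ := fun h => n₅ (sσ h)
        have m₆ := fun h => n₆ (sσ h)
        clear sα tα sβ tβ two inter sup_eq not_top single mixed swap sσ rel
        tauto
    have pair_swap : pairSetoid (Q.2, Q.1) = pairSetoid Q := by
      refine le_antisymm (pairSetoid_le.2 ?_) (pairSetoid_le.2 ?_)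
      · exact Setoid.symm' _ (pairSetoid_le.1 le_rfl)
      · exact Setoid.symm' _ ((pairSetoid_le (P := (Q.2, Q.1))).1 le_rfl)
    rcases two rα h₁ (z := Q.1) with h | h
    · exact key (q := P.2) (q' := Q.2) h₁ h₂ h₃ h₄ h htop
    · rcases two rα h₁ (z := Q.2) with h' | h'
      · refine key (q := P.2) (p' := Q.2) (q' := Q.1) h₁ h₂ (fun h => h₃ (α.symm' h))
          (fun h => h₄ (β.symm' h)) h' ?_
        rw [pair_swap]
        exact htop
      · exact h₃ (α.trans' h (α.symm' h'))
  unfold sepInd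
  by_cases pa : α P.1 P.2 <;> by_cases pb : β P.1 P.2 <;> by_cases qa : α Q.1 Q.2 <;>
    by_cases qb : β Q.1 Q.2 <;> simp only [pa, pb, qa, qb, if_true, if_false]
  · rw [if_neg (single (inter pa pb))]; norm_num
  · rw [if_neg (single (inter pa pb))]; norm_num
  · rw [if_neg (single (inter pa pb))]; norm_num
  · rw [if_neg (single (inter pa pb))]; norm_num
  · rw [swap, if_neg (single (inter qa qb))]; norm_num
  · rw [if_neg (not_top rα (sup_le (sup_le hα (pairSetoid_le.2 pa)) (pairSetoid_le.2 qa)))]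
    norm_num
  · rw [if_pos (mixed hα rα pa (fun h => pb (hβ h)) qa)]; norm_num
  · rw [if_pos (mixed hα rα pa (fun h => pb (hβ h)) qa)]; norm_num
  · rw [swap, if_neg (single (inter qa qb))]; norm_num
  · rw [if_pos (mixed hβ rβ pb (fun h => pa (hα h)) qb)]; norm_num
  · rw [if_neg (not_top rβ (sup_le (sup_le hβ (pairSetoid_le.2 pb)) (pairSetoid_le.2 qb)))]
    norm_num
  · rw [if_pos (mixed hβ rβ pb (fun h => pa (hα h)) qb)]; norm_num
  · rw [swap, if_neg (single (inter qa qb))]; norm_num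
  · rw [swap, if_pos (mixed hα rα qa (fun h => qb (hβ h)) pa)]; norm_num
  · rw [swap, if_pos (mixed hβ rβ qb (fun h => qa (hα h)) pb)]; norm_num
  · rw [if_neg (cross pa pb qa qb)]; norm_num

end rank
end InvPoly

namespace InvPoly

open PowerSeries Finset

variable {V : Type*}

section powerset

variable {α : Type*} {R : Type*} [CommRing R]

theorem sum_powerset_eq_of_card_le_two (E : Finset α) (g : Finset α → R)
    (hg : ∀ M ⊆ E, 3 ≤ #M → g M = 0) :
    ∑ M ∈ E.powerset, g M = g ∅ + ∑ e ∈ E, g {e} + ∑ M ∈ powersetCard 2 E, g M := by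
  have h₁ : ∑ j ∈ range (#E + 1), ∑ M ∈ powersetCard j E, g M =
      ∑ j ∈ range (#E + 3), ∑ M ∈ powersetCard j E, g M := by
    refine sum_subset (range_mono (by omega)) fun j _ hj => ?_
    rw [powersetCard_eq_empty.2 (by simpa using hj), sum_empty]
  have h₂ : ∑ j ∈ range 3, ∑ M ∈ powersetCard j E, g M =
      ∑ j ∈ range (#E + 3), ∑ M ∈ powersetCard j E, g M := by
    refine sum_subset (range_mono (by omega)) fun j _ hj => sum_eq_zero fun M hM => ?_
    rw [mem_powersetCard] at hM
    exact hg M hM.1 (by rw [hM.2]; simpa using hj)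
  rw [sum_powerset, h₁, ← h₂]
  simp [sum_range_succ, powersetCard_one]

theorem two_mul_sum_powersetCard_two [DecidableEq α] (E : Finset α) (y : α → R) :
    2 * ∑ M ∈ powersetCard 2 E, ∏ e ∈ M, y e = (∑ e ∈ E, y e) ^ 2 - ∑ e ∈ E, y e ^ 2 := by
  induction E using Finset.induction_on with
  | empty =>
    rw [powersetCard_eq_empty.2 (by simp)]
    simp
  | insert a E ha ih =>
    have hd : Disjoint (powersetCard 2 E) ((powersetCard 1 E).image (insert a)) := by
      rw [Finset.disjoint_left]
      intro M hM hM'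
      obtain ⟨M', _, rfl⟩ := mem_image.1 hM'
      exact ha ((mem_powersetCard.1 hM).1 (mem_insert_self _ _))
    have hi : Set.InjOn (insert a) (powersetCard 1 E : Set (Finset α)) := by
      intro M hM M' hM' h
      have h₁ : a ∉ M := fun h => ha ((mem_powersetCard.1 (mem_coe.1 hM)).1 h)
      have h₂ : a ∉ M' := fun h => ha ((mem_powersetCard.1 (mem_coe.1 hM')).1 h)
      rw [← erase_insert h₁, ← erase_insert h₂, h]
    rw [powersetCard_succ_insert ha, sum_union hd, sum_image hi, mul_add, ih, sum_insert ha,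
      sum_insert ha, powersetCard_one, sum_map]
    have : ∀ e ∈ E, ∏ i ∈ insert a {e}, y i = y a * y e := by
      intro e he
      rw [prod_insert (by rintro h; exact ha (mem_singleton.1 h ▸ he)), prod_singleton]
    simp only [Function.Embedding.coeFn_mk]
    rw [sum_congr rfl this, ← mul_sum]
    ring

end powerset

open scoped Classical in
/-- Indicator of the relations which connect everything together with `σ`. -/
noncomputable def connInd (σ s : Setoid V) : ℝ⟦X⟧ := if s ⊔ σ = ⊤ then 1 else 0

theorem connInd_eq_zero {σ s : Setoid V} (h : s ⊔ σ ≠ ⊤) : connInd σ s = 0 := if_neg h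

section op

variable [Fintype V]

theorem op_sum {ι : Type*} (I : Finset ι) (c : ι → ℝ⟦X⟧) (g : ι → Setoid V → ℝ⟦X⟧)
    (x : MergeVec V) (s : Setoid V) :
    op x (fun s' => ∑ i ∈ I, c i * g i s') s = ∑ i ∈ I, c i * op x (g i) s := by
  classical
  induction I using Finset.induction_on with
  | empty => simp [op]
  | insert i I hi ih =>
    rw [sum_insert hi, ← ih, ← one_mul (op x (fun s' => ∑ i ∈ I, c i * g i s') s)]
    exact op_linear x fun s' _ => by rw [sum_insert hi, one_mul]

/-- Sum of the coefficients of a vector against a weight. -/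
noncomputable def pairSum (x : MergeVec V) (φ : V × V → ℝ) : ℝ := ∑ P, x.2.2 P * φ P

theorem op_eigen (x : MergeVec V) {h : Setoid V → ℝ⟦X⟧} {φ : V × V → ℝ} {s : Setoid V}
    (hh : ∀ P, h (s ⊔ pairSetoid P) = C (φ P) * h s) :
    op x h s = (C x.1 * X + C x.2.1 + (1 - X) * C (pairSum x φ)) * h s := by
  simp only [op, hh, pairSum, map_sum, map_mul, mul_sum, add_mul, sum_mul]
  congr 1
  exact sum_congr rfl fun P _ => by ring

theorem pairSum_one_sub (x : MergeVec V) (φ : V × V → ℝ) :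
    pairSum x (fun P => 1 - φ P) = pairSum x 1 - pairSum x φ := by
  simp [pairSum, mul_sub, sum_sub_distrib]

/-- The value of `op x` on the constant function one. -/
noncomputable def opOne (x : MergeVec V) : ℝ⟦X⟧ :=
  C x.1 * X + C x.2.1 + (1 - X) * C (pairSum x 1)

theorem op_const (x : MergeVec V) {h : Setoid V → ℝ⟦X⟧} {c : ℝ⟦X⟧} {s : Setoid V}
    (hh : ∀ s', s ≤ s' → h s' = c) : op x h s = opOne x * c := by
  rw [op_eigen x (φ := 1), hh s le_rfl, opOne]
  intro P
  rw [hh _ le_sup_left, hh s le_rfl]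
  simp

variable [Nonempty V]

theorem connInd_eq_zero_of_rank {σ s : Setoid V} (h : 0 < rank (s ⊔ σ)) : connInd σ s = 0 :=
  connInd_eq_zero fun h' => h.ne' (rank_eq_zero.2 h')

variable {σ s : Setoid V}

theorem op_connInd_of_rank_zero (hσ : rank (s ⊔ σ) = 0) (x : MergeVec V) :
    op x (connInd σ) s = opOne x ∧ op x (op x (connInd σ)) s = opOne x ^ 2 := by
  have h : ∀ s', s ≤ s' → connInd σ s' = 1 := by
    intro s' hs
    refine if_pos (top_le_iff.1 ?_)
    rw [← rank_eq_zero.1 hσ]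
    exact sup_le_sup_right hs σ
  have h' : ∀ s', s ≤ s' → op x (connInd σ) s' = opOne x := by
    intro s' hs
    rw [op_const x fun s'' hs' => h s'' (hs.trans hs'), mul_one]
  exact ⟨h' s le_rfl, by rw [op_const x h', sq]⟩

theorem op_connInd_of_rank_one (hσ : rank (s ⊔ σ) = 1) (x : MergeVec V) :
    op x (connInd σ) s = (1 - X) * C (pairSum x (sepInd (s ⊔ σ))) ∧
    op x (op x (connInd σ)) s = 2 * opOne x * ((1 - X) * C (pairSum x (sepInd (s ⊔ σ)))) -
      ((1 - X) * C (pairSum x (sepInd (s ⊔ σ)))) ^ 2 := by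
  classical
  set τ := s ⊔ σ with hτ
  set u := (1 - X) * C (pairSum x (sepInd τ)) with hu
  let h : Setoid V → ℝ⟦X⟧ := fun s' => if s' ≤ τ then 1 else 0
  have hI : ∀ s', s ≤ s' → connInd σ s' = 1 * 1 + (-1) * h s' := by
    intro s' hs
    by_cases hle : s' ≤ τ
    · have : s' ⊔ σ = τ := le_antisymm (sup_le hle le_sup_right) (sup_le_sup_right hs σ)
      rw [connInd_eq_zero_of_rank (by rw [this, hσ]; exact one_pos)]
      simp [h, hle]
    · obtain ⟨x, y, hxy, hn⟩ : ∃ x y, s' x y ∧ ¬ τ x y := by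
        by_contra hcon
        push Not at hcon
        exact hle fun {x y} hxy => hcon x y hxy
      have htop : s' ⊔ σ = ⊤ := by
        rw [← top_le_iff, ← sup_eq_top_of_rank_eq_one hσ (P := (x, y)) hn]
        exact sup_le (sup_le_sup_right hs σ) ((pairSetoid_le.2 hxy).trans le_sup_left)
      simp [h, hle, connInd, htop]
  have hh : ∀ s', op x h s' = (opOne x - u) * h s' := by
    intro s'
    rw [op_eigen x (φ := fun P => 1 - sepInd τ P), pairSum_one_sub, opOne, map_sub, hu]
    · ring
    · intro P
      simp only [h, sup_le_iff, pairSetoid_le, sepInd]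
      by_cases h₁ : s' ≤ τ <;> by_cases h₂ : τ P.1 P.2 <;> simp [h₁, h₂]
  have hs : h s = 1 := if_pos le_sup_left
  have h₁ : ∀ s', s ≤ s' → op x (connInd σ) s' = opOne x * 1 + (-(opOne x - u)) * h s' := by
    intro s' hs'
    rw [op_linear x (g₁ := fun _ => 1) (g₂ := h) (fun s'' hs'' => hI s'' (hs'.trans hs'')), hh,
      op_const x (c := 1) fun _ _ => rfl]
    ring
  constructor
  · rw [h₁ s le_rfl, hs]; ring
  · rw [op_linear x (g₁ := fun _ => 1) (g₂ := h) h₁, hh, hs, op_const x (c := 1) fun _ _ => rfl]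
    ring

theorem op_connInd_of_two_le_rank (hσ : 2 ≤ rank (s ⊔ σ)) (x : MergeVec V) :
    op x (connInd σ) s = 0 ∧
    op x (op x (connInd σ)) s = (1 - X) ^ 2 * ∑ P, ∑ Q, C (x.2.2 P) * C (x.2.2 Q) *
      connInd σ (s ⊔ pairSetoid P ⊔ pairSetoid Q) := by
  have h₀ : connInd σ s = 0 := connInd_eq_zero_of_rank (by omega)
  have h₁ : ∀ P, connInd σ (s ⊔ pairSetoid P) = 0 := by
    intro P
    refine connInd_eq_zero_of_rank ?_
    have := rank_le_rank_sup_pairSetoid_add_one (s ⊔ σ) P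
    rw [sup_right_comm]
    omega
  have h : op x (connInd σ) s = 0 := by simp [op, h₀, h₁]
  refine ⟨h, ?_⟩
  rw [op, h, mul_zero, zero_add, mul_sum]
  refine sum_congr rfl fun P _ => ?_
  rw [op, h₁, mul_zero, zero_add, mul_sum, mul_sum, mul_sum]
  exact sum_congr rfl fun Q _ => by ring

theorem op_connInd_of_three_le_rank (hσ : 3 ≤ rank (s ⊔ σ)) (x : MergeVec V) :
    op x (op x (connInd σ)) s = 0 := by
  rw [(op_connInd_of_two_le_rank (by omega) x).2]
  have : ∀ P Q, connInd σ (s ⊔ pairSetoid P ⊔ pairSetoid Q) = 0 := by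
    intro P Q
    refine connInd_eq_zero_of_rank ?_
    have h₁ := rank_le_rank_sup_pairSetoid_add_one (s ⊔ σ) P
    have h₂ := rank_le_rank_sup_pairSetoid_add_one (s ⊔ σ ⊔ pairSetoid P) Q
    rw [sup_right_comm, sup_right_comm s]
    omega
  simp [this]

theorem op_connInd_of_rank_two (hσ : rank (s ⊔ σ) = 2) {α β : Setoid V} (hα : s ⊔ σ ≤ α)
    (hβ : s ⊔ σ ≤ β) (rα : rank α = 1) (rβ : rank β = 1) (hne : α ≠ β) (x : MergeVec V) :
    op x (op x (connInd σ)) s = (1 - X) ^ 2 *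
      C (2 * (pairSum x (sepInd α) * pairSum x (sepInd β)) -
        2 * pairSum x (fun P => sepInd α P * sepInd β P) ^ 2) := by
  classical
  rw [(op_connInd_of_two_le_rank (by omega) x).2]
  congr 1
  have h : ∀ P Q, connInd σ (s ⊔ pairSetoid P ⊔ pairSetoid Q) =
      C (sepInd α P * sepInd β Q + sepInd β P * sepInd α Q -
        2 * (sepInd α P * sepInd β P) * (sepInd α Q * sepInd β Q)) := by
    intro P Q
    rw [← indicator_sup_sup_eq_top hα hβ hσ rα rβ hne, connInd, sup_right_comm,
      sup_right_comm s]
    split_ifs <;> simp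
  simp only [h, ← map_mul, ← map_sum]
  congr 1
  have hprod : ∀ φ ψ : V × V → ℝ, pairSum x φ * pairSum x ψ =
      ∑ P, ∑ Q, x.2.2 P * x.2.2 Q * (φ P * ψ Q) := by
    intro φ ψ
    rw [pairSum, pairSum, sum_mul_sum]
    exact sum_congr rfl fun P _ => sum_congr rfl fun Q _ => by ring
  have e : ∀ P Q, x.2.2 P * x.2.2 Q * (sepInd α P * sepInd β Q + sepInd β P * sepInd α Q -
        2 * (sepInd α P * sepInd β P) * (sepInd α Q * sepInd β Q)) =
      x.2.2 P * x.2.2 Q * (sepInd α P * sepInd β Q) +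
      x.2.2 P * x.2.2 Q * (sepInd β P * sepInd α Q) -
      2 * (x.2.2 P * x.2.2 Q * ((sepInd α P * sepInd β P) * (sepInd α Q * sepInd β Q))) :=
    fun P Q => by ring
  simp only [e, sum_add_distrib, sum_sub_distrib, ← mul_sum]
  rw [← hprod, ← hprod, ← hprod (fun P => sepInd α P * sepInd β P)
    (fun P => sepInd α P * sepInd β P)]
  ring

end op
end InvPoly

namespace InvPoly

open PowerSeries Finset

variable {V : Type*} [DecidableEq V] {E : Finset (V × V)} {s : Setoid V}

theorem odds_pow_mul {m r : ℕ} (h : m ≤ r) :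
    odds ^ r * ((1 - X) ^ (r - m) * X ^ m) = X ^ r * odds ^ m := by
  obtain ⟨k, rfl⟩ := Nat.exists_eq_add_of_le h
  rw [Nat.add_sub_cancel_left, pow_add, pow_add]
  calc odds ^ m * odds ^ k * ((1 - X) ^ k * X ^ m)
      = odds ^ m * X ^ m * (odds * (1 - X)) ^ k := by rw [mul_pow]; ring
    _ = _ := by rw [odds_mul]; ring

theorem connProb_eq_sum_connInd (E : Finset (V × V)) (s : Setoid V) :
    connProb E s = ∑ M ∈ E.powerset,
      ((1 - X) ^ (#E - #M) * X ^ #M) * connInd ((E \ M).sup pairSetoid) s := by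
  classical
  unfold connProb
  refine sum_nbij' (fun A => E \ A) (fun M => E \ M) ?_ ?_ ?_ ?_ ?_
  · intro A _; simp
  · intro A _; simp
  · intro A hA; exact Finset.sdiff_sdiff_eq_self (mem_powerset.1 hA)
  · intro A hA; exact Finset.sdiff_sdiff_eq_self (mem_powerset.1 hA)
  · intro A hA
    have hA := mem_powerset.1 hA
    have := card_le_card hA
    rw [Finset.sdiff_sdiff_eq_self hA, card_sdiff_of_subset hA, connInd, Nat.sub_sub_self this]
    split_ifs <;> simp

theorem op_connProb_eq_sum [Fintype V] (x : MergeVec V) (E : Finset (V × V)) (s : Setoid V) :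
    op x (connProb E) s = ∑ M ∈ E.powerset,
      ((1 - X) ^ (#E - #M) * X ^ #M) * op x (connInd ((E \ M).sup pairSetoid)) s := by
  rw [← op_sum]
  exact op_congr x fun s' _ => connProb_eq_sum_connInd E s'

theorem op_op_connProb_eq_sum [Fintype V] (x y : MergeVec V) (E : Finset (V × V)) (s : Setoid V) :
    op y (op x (connProb E)) s = ∑ M ∈ E.powerset,
      ((1 - X) ^ (#E - #M) * X ^ #M) * op y (op x (connInd ((E \ M).sup pairSetoid))) s := by
  rw [← op_sum]
  exact op_congr y fun s' _ => op_connProb_eq_sum x E s'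

/-- `E` is a minimal set of pairs connecting everything together with `s`. -/
def IsMinimalSpanning (E : Finset (V × V)) (s : Setoid V) : Prop :=
  s ⊔ E.sup pairSetoid = ⊤ ∧ ∀ e ∈ E, s ⊔ (E.erase e).sup pairSetoid ≠ ⊤

/-- The relation left after removing the pairs in `M`. -/
def cut (E : Finset (V × V)) (s : Setoid V) (M : Finset (V × V)) : Setoid V :=
  s ⊔ (E \ M).sup pairSetoid

theorem cut_anti {M M' : Finset (V × V)} (h : M ⊆ M') : cut E s M' ≤ cut E s M :=
  sup_le_sup_left (sup_mono (sdiff_subset_sdiff Subset.rfl h)) s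

theorem IsMinimalSpanning.cut_ne (h : IsMinimalSpanning E s) {e f : V × V} (he : e ∈ E)
    (hne : e ≠ f) : cut E s {e} ≠ cut E s {f} := by
  intro heq
  refine h.2 e he (top_le_iff.1 ?_)
  have h₁ : pairSetoid e ≤ cut E s {f} :=
    (le_sup (f := pairSetoid) (by simp [he, hne])).trans le_sup_right
  rw [← heq, cut, sdiff_singleton_eq_erase] at h₁
  rw [← h.1]
  conv_lhs => rw [← insert_erase he, sup_insert]
  exact sup_le le_sup_left (sup_le h₁ le_sup_right)

variable [Nonempty V]

theorem IsMinimalSpanning.rank_sup_add_card [Finite V] (h : IsMinimalSpanning E s)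
    {A : Finset (V × V)} (hA : A ⊆ E) : rank (s ⊔ A.sup pairSetoid) + #A = rank s := by
  induction A using Finset.induction_on with
  | empty => simp
  | insert e A he ih =>
    have heE : e ∈ E := hA (mem_insert_self _ _)
    have hAE : A ⊆ E := (subset_insert _ _).trans hA
    have hn : ¬ (s ⊔ A.sup pairSetoid) e.1 e.2 := by
      intro hr
      refine h.2 e heE (top_le_iff.1 ?_)
      have hle : s ⊔ A.sup pairSetoid ≤ s ⊔ (E.erase e).sup pairSetoid :=
        sup_le_sup_left (sup_mono (subset_erase.2 ⟨hAE, he⟩)) s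
      rw [← h.1, ← insert_erase heE, sup_insert, sup_left_comm]
      rw [insert_erase heE]
      exact sup_le ((pairSetoid_le.2 hr).trans hle) le_rfl
    have := rank_sup_pairSetoid hn
    rw [sup_assoc, sup_comm (A.sup pairSetoid), ← sup_insert] at this
    rw [card_insert_of_notMem he]
    have := ih hAE
    omega

theorem IsMinimalSpanning.card_eq [Finite V] (h : IsMinimalSpanning E s) : #E = rank s := by
  have := h.rank_sup_add_card Subset.rfl
  rwa [h.1, rank_eq_zero.2 rfl, zero_add] at this

theorem IsMinimalSpanning.rank_cut [Finite V] (h : IsMinimalSpanning E s) {M : Finset (V × V)}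
    (hM : M ⊆ E) : rank (cut E s M) = #M := by
  have h₁ := h.rank_sup_add_card (sdiff_subset : E \ M ⊆ E)
  rw [card_sdiff_of_subset hM, h.card_eq] at h₁
  have h₂ := card_le_card hM
  rw [h.card_eq] at h₂
  rw [cut]
  omega

variable [Fintype V]

theorem IsMinimalSpanning.op_connProb (h : IsMinimalSpanning E s) (x : MergeVec V) :
    odds ^ rank s * op x (connProb E) s = X ^ rank s *
      (opOne x + X * C (∑ e ∈ E, pairSum x (sepInd (cut E s {e})))) := by
  have hr : ∀ M ⊆ E, rank (s ⊔ (E \ M).sup pairSetoid) = #M := fun M hM => h.rank_cut hM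
  have hsum : odds ^ rank s * op x (connProb E) s = X ^ rank s * ∑ M ∈ E.powerset,
      odds ^ #M * op x (connInd ((E \ M).sup pairSetoid)) s := by
    rw [op_connProb_eq_sum, mul_sum, mul_sum]
    refine sum_congr rfl fun M hM => ?_
    rw [← mul_assoc, h.card_eq, odds_pow_mul, mul_assoc]
    rw [← h.card_eq]
    exact card_le_card (mem_powerset.1 hM)
  rw [hsum, sum_powerset_eq_of_card_le_two]
  · congr 1
    have h₂ : ∑ M ∈ powersetCard 2 E,
        odds ^ #M * op x (connInd ((E \ M).sup pairSetoid)) s = 0 := by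
      refine sum_eq_zero fun M hM => ?_
      rw [mem_powersetCard] at hM
      rw [(op_connInd_of_two_le_rank (by rw [hr M hM.1, hM.2]) x).1, mul_zero]
    have h₁ : ∀ e ∈ E, odds ^ #{e} * op x (connInd ((E \ {e}).sup pairSetoid)) s =
        X * C (pairSum x (sepInd (cut E s {e}))) := by
      intro e he
      rw [(op_connInd_of_rank_one (by rw [hr _ (by simpa using he), card_singleton]) x).1,
        card_singleton, pow_one, ← mul_assoc, odds_mul, cut]
    rw [h₂, sum_congr rfl h₁, add_zero, ← mul_sum, map_sum, card_empty, pow_zero, one_mul,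
      (op_connInd_of_rank_zero (hr ∅ (by simp)) x).1]
  · intro M hM hc
    rw [(op_connInd_of_two_le_rank (by rw [hr M hM]; omega) x).1, mul_zero]

theorem IsMinimalSpanning.op_op_connProb (h : IsMinimalSpanning E s) (x : MergeVec V) :
    odds ^ rank s * op x (op x (connProb E)) s = X ^ rank s *
      ((opOne x + X * C (∑ e ∈ E, pairSum x (sepInd (cut E s {e})))) ^ 2 -
        X * C (∑ e ∈ E, pairSum x (sepInd (cut E s {e})) ^ 2) -
        2 * X ^ 2 * C (∑ M ∈ powersetCard 2 E,
          pairSum x (fun P => ∏ e ∈ M, sepInd (cut E s {e}) P) ^ 2)) := by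
  have hr : ∀ M ⊆ E, rank (s ⊔ (E \ M).sup pairSetoid) = #M := fun M hM => h.rank_cut hM
  have hsum : odds ^ rank s * op x (op x (connProb E)) s = X ^ rank s * ∑ M ∈ E.powerset,
      odds ^ #M * op x (op x (connInd ((E \ M).sup pairSetoid))) s := by
    rw [op_op_connProb_eq_sum, mul_sum, mul_sum]
    refine sum_congr rfl fun M hM => ?_
    rw [← mul_assoc, h.card_eq, odds_pow_mul, mul_assoc]
    rw [← h.card_eq]
    exact card_le_card (mem_powerset.1 hM)
  rw [hsum, sum_powerset_eq_of_card_le_two]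
  · congr 1
    set y : V × V → ℝ := fun e => pairSum x (sepInd (cut E s {e})) with hy
    have h₂ : ∀ M ∈ powersetCard 2 E,
        odds ^ #M * op x (op x (connInd ((E \ M).sup pairSetoid))) s = X ^ 2 *
          C (2 * ∏ e ∈ M, y e -
            2 * pairSum x (fun P => ∏ e ∈ M, sepInd (cut E s {e}) P) ^ 2) := by
      intro M hM
      rw [mem_powersetCard] at hM
      obtain ⟨e, f, hne, rfl⟩ := card_eq_two.1 hM.2
      have he : e ∈ E := hM.1 (by simp)
      have hf : f ∈ E := hM.1 (by simp)
      rw [op_connInd_of_rank_two (α := cut E s {e}) (β := cut E s {f}) (by rw [hr _ hM.1, hM.2])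
        (cut_anti (by simp)) (cut_anti (by simp)) (by rw [h.rank_cut (by simpa using he)]; rfl)
        (by rw [h.rank_cut (by simpa using hf)]; rfl) (h.cut_ne he hne) x, hM.2, ← mul_assoc,
        ← mul_pow, odds_mul, prod_pair hne]
      simp only [prod_pair hne, hy]
    have h₁ : ∀ e ∈ E, odds ^ #{e} * op x (op x (connInd ((E \ {e}).sup pairSetoid))) s =
        2 * opOne x * X * C (y e) - X * (1 - X) * C (y e ^ 2) := by
      intro e he
      rw [(op_connInd_of_rank_one (by rw [hr _ (by simpa using he), card_singleton]) x).2,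
        card_singleton, pow_one, hy, map_pow]
      simp only [cut]
      linear_combination (2 * opOne x * C (pairSum x (sepInd (s ⊔ (E \ {e}).sup pairSetoid))) -
        (1 - X) * C (pairSum x (sepInd (s ⊔ (E \ {e}).sup pairSetoid))) ^ 2) * odds_mul
    rw [sum_congr rfl h₂, sum_congr rfl h₁, card_empty, pow_zero, one_mul,
      (op_connInd_of_rank_zero (hr ∅ (by simp)) x).2, sum_sub_distrib, ← mul_sum, ← mul_sum,
      ← mul_sum, ← map_sum, ← map_sum, ← map_sum, sum_sub_distrib, ← mul_sum, ← mul_sum,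
      two_mul_sum_powersetCard_two]
    simp only [map_sub, map_mul, map_pow, map_ofNat]
    ring
  · intro M hM hc
    rw [op_connInd_of_three_le_rank (by rw [hr M hM]; omega) x, mul_zero]

theorem IsMinimalSpanning.isLorentzianAt_mergeForm (h : IsMinimalSpanning E s) {ε : ℝ}
    (hε : 0 < ε) (N : ℕ) : IsLorentzianAt (mergeForm ε N E s) (baseVec V ε) := by
  set r := rank s with hr
  set κ : ℕ → ℝ := fun i => mixCoeff ε N (X ^ (r + i)) with hκ
  have hκ_nonneg : ∀ i, 0 ≤ κ i := fun i => mixCoeff_nonneg hε.le fun k => by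
    rw [coeff_X_pow]; split_ifs <;> norm_num
  have hlc : κ 0 * κ 2 ≤ κ 1 ^ 2 := mixCoeff_X_pow_logConcave hε r
  have hC : ∀ (c : ℝ) i, mixCoeff ε N (C c * X ^ (r + i)) = c * κ i := fun c i => by
    rw [mixCoeff_C_mul]
  have hone : ∀ x : MergeVec V, ∀ Y, opOne x + X * C Y =
      C (x.2.1 + pairSum x 1) + X * C (x.1 - pairSum x 1 + Y) := by
    intro x Y
    simp only [opOne, map_add, map_sub]
    ring
  have hxw : ∀ x : MergeVec V, ∃ A B S Z : ℝ, 0 ≤ S ∧ 0 ≤ Z ∧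
      mergeForm ε N E s x x = κ 0 * B ^ 2 + κ 1 * (2 * A * B - S) + κ 2 * (A ^ 2 - 2 * Z) ∧
      mergeForm ε N E s x (baseVec V ε) = κ 0 * B + κ 1 * (A + ε * B) + κ 2 * (ε * A) := by
    intro x
    refine ⟨x.1 - pairSum x 1 + ∑ e ∈ E, pairSum x (sepInd (cut E s {e})),
      x.2.1 + pairSum x 1, ∑ e ∈ E, pairSum x (sepInd (cut E s {e})) ^ 2,
      ∑ M ∈ powersetCard 2 E, pairSum x (fun P => ∏ e ∈ M, sepInd (cut E s {e}) P) ^ 2,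
      sum_nonneg fun _ _ => sq_nonneg _, sum_nonneg fun _ _ => sq_nonneg _, ?_, ?_⟩
    · rw [mergeForm_apply, h.op_op_connProb, hone]
      generalize x.1 - pairSum x 1 + ∑ e ∈ E, pairSum x (sepInd (cut E s {e})) = A
      generalize x.2.1 + pairSum x 1 = B
      generalize ∑ e ∈ E, pairSum x (sepInd (cut E s {e})) ^ 2 = S
      generalize ∑ M ∈ powersetCard 2 E, pairSum x (fun P => ∏ e ∈ M, sepInd (cut E s {e}) P) ^ 2
        = Z
      have : X ^ r * ((C B + X * C A) ^ 2 - X * C S - 2 * X ^ 2 * C Z) =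
          C (B ^ 2) * X ^ (r + 0) + C (2 * A * B - S) * X ^ (r + 1) +
            C (A ^ 2 - 2 * Z) * X ^ (r + 2) := by
        simp only [map_sub, map_mul, map_pow, map_ofNat]
        ring
      rw [this, map_add, map_add, hC, hC, hC]
      ring
    · rw [baseVec, mergeForm_scalar, h.op_connProb, hone]
      generalize x.1 - pairSum x 1 + ∑ e ∈ E, pairSum x (sepInd (cut E s {e})) = A
      generalize x.2.1 + pairSum x 1 = B
      have : (C ε * X + C 1) * (X ^ r * (C B + X * C A)) =
          C B * X ^ (r + 0) + C (A + ε * B) * X ^ (r + 1) + C (ε * A) * X ^ (r + 2) := by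
        simp only [map_add, map_mul, map_one]
        ring
      rw [this, map_add, map_add, hC, hC, hC]
      ring
  intro x
  have hww : mergeForm ε N E s (baseVec V ε) (baseVec V ε) =
      κ 0 + 2 * ε * κ 1 + ε ^ 2 * κ 2 := by
    have hzero : ∀ φ, pairSum (baseVec V ε) φ = 0 := by simp [pairSum, baseVec]
    rw [show mergeForm ε N E s (baseVec V ε) (baseVec V ε) =
      mergeForm ε N E s (baseVec V ε) (ε, 1, 0) from rfl, mergeForm_scalar, h.op_connProb, hone]
    simp only [hzero, sum_const_zero, add_zero, sub_zero]
    simp only [baseVec, ← hr]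
    have : (C ε * X + C 1) * (X ^ r * (C 1 + X * C ε)) =
          C 1 * X ^ (r + 0) + C (2 * ε) * X ^ (r + 1) + C (ε ^ 2) * X ^ (r + 2) := by
        simp only [map_mul, map_one, map_ofNat, map_pow]
        ring
    rw [this, map_add, map_add, hC, hC, hC]
    ring
  obtain ⟨A, B, S, Z, hS, hZ, hxx, hxb⟩ := hxw x
  rw [hww, hxx, hxb]
  have hw : 0 ≤ κ 0 + 2 * ε * κ 1 + ε ^ 2 * κ 2 := by
    have := hκ_nonneg 0; have := hκ_nonneg 1; have := hκ_nonneg 2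
    positivity
  have h₁ : 0 ≤ (κ 1 * S + 2 * (κ 2 * Z)) * (κ 0 + 2 * ε * κ 1 + ε ^ 2 * κ 2) := by
    have := hκ_nonneg 1; have := hκ_nonneg 2
    exact mul_nonneg (by positivity) hw
  have h₂ : 0 ≤ (κ 1 ^ 2 - κ 0 * κ 2) * (B * ε - A) ^ 2 :=
    mul_nonneg (sub_nonneg.2 hlc) (sq_nonneg _)
  linarith

theorem isLorentzianAt_mergeForm {ε : ℝ} (hε : 0 < ε) (N : ℕ) (E : Finset (V × V)) (s : Setoid V)
    (hspan : s ⊔ E.sup pairSetoid = ⊤) :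
    IsLorentzianAt (mergeForm ε N E s) (baseVec V ε) := by
  induction hn : #E generalizing E s N with
  | zero =>
    refine IsMinimalSpanning.isLorentzianAt_mergeForm ⟨hspan, ?_⟩ hε N
    simp [card_eq_zero.1 hn]
  | succ n ih =>
    by_cases hmin : ∀ e ∈ E, s ⊔ (E.erase e).sup pairSetoid ≠ ⊤
    · exact IsMinimalSpanning.isLorentzianAt_mergeForm ⟨hspan, hmin⟩ hε N
    · push Not at hmin
      obtain ⟨e, he, hspan'⟩ := hmin
      have hc : #(E.erase e) = n := by rw [card_erase_of_mem he, hn, Nat.add_sub_cancel]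
      rw [← insert_erase he]
      by_cases hs : s e.1 e.2
      · rw [mergeForm_insert_of_rel (notMem_erase _ _) hs]
        exact ih N _ s hspan' hc
      · refine isLorentzianAt_mergeForm_insert hε (notMem_erase _ _) hs hspan' (fun N => ?_)
          (fun N => ih N _ s hspan' hc) N
        refine ih N _ _ ?_ hc
        rw [sup_right_comm, hspan', top_sup_eq]

theorem connSeries_logConcave (E : Finset (V × V)) (s : Setoid V)
    (hspan : s ⊔ E.sup pairSetoid = ⊤) (k : ℕ) :
    coeff k (connSeries E s) * coeff (k + 2) (connSeries E s) ≤
      coeff (k + 1) (connSeries E s) ^ 2 := by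
  set F := connSeries E s with hF
  let N := k + 2
  have key : ∀ ε : ℝ, 0 < ε → mixCoeff ε N (X ^ 2 * F) *
      mixCoeff ε N ((C ε * X + 1) ^ 2 * F) ≤ mixCoeff ε N (X * (C ε * X + 1) * F) ^ 2 := by
    intro ε hε
    have := isLorentzianAt_mergeForm hε N E s hspan (1, 0, 0)
    rw [mergeForm_comm ε N E s (1, 0, 0) (baseVec V ε)] at this
    rw [mergeForm_scalar, mergeForm_scalar] at this
    rw [show mergeForm ε N E s (baseVec V ε) (baseVec V ε) =
      mergeForm ε N E s (baseVec V ε) (ε, 1, 0) from rfl, mergeForm_scalar] at this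
    rw [op_scalar, op_baseVec] at this
    refine (le_of_eq ?_).trans (this.trans (le_of_eq ?_))
    · congr 2
      · rw [hF, connSeries]; simp only [map_one, map_zero]; ring
      · rw [hF, connSeries]; simp only [map_one]; ring
    · refine congrArg (fun z => mixCoeff ε N z ^ 2) ?_
      rw [hF, connSeries]; simp only [map_one, map_zero]; ring
  have expand : ∀ ε : ℝ, mixCoeff ε N ((C ε * X + 1) ^ 2 * F) =
      ε ^ 2 * mixCoeff ε N (X ^ 2 * F) + 2 * ε * mixCoeff ε N (X * F) + mixCoeff ε N F := by
    intro ε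
    rw [← mixCoeff_C_mul, ← mixCoeff_C_mul, ← map_add, ← map_add]
    congr 1
    simp only [map_mul, map_pow, map_ofNat]
    ring
  have expand' : ∀ ε : ℝ, mixCoeff ε N (X * (C ε * X + 1) * F) =
      ε * mixCoeff ε N (X ^ 2 * F) + mixCoeff ε N (X * F) := by
    intro ε
    rw [← mixCoeff_C_mul, ← map_add]
    congr 1
    ring
  simp only [expand, expand'] at key
  have c₀ := continuous_mixCoeff (N := N) F
  have c₁ := continuous_mixCoeff (N := N) (X * F)
  have c₂ := continuous_mixCoeff (N := N) (X ^ 2 * F)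
  have hlim : ∀ f : ℝ → ℝ, Continuous f →
      Filter.Tendsto f (nhdsWithin 0 (Set.Ioi 0)) (nhds (f 0)) :=
    fun f hf => hf.continuousAt.tendsto.mono_left nhdsWithin_le_nhds
  have := le_of_tendsto_of_tendsto (hlim _ (by fun_prop)) (hlim _ (by fun_prop))
    (Filter.eventually_of_mem self_mem_nhdsWithin key)
  simp only [mixCoeff_zero_left] at this
  rw [coeff_X_pow_mul, show N = k + 1 + 1 from rfl, coeff_succ_X_mul] at this
  simpa using this

end InvPoly

namespace InvPoly

open Finset

section reachable

variable {V : Type*} {G G' : SimpleGraph V}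

theorem reachable_of_closed (P : V → Prop)
    (hstep : ∀ u v, P u → G.Adj u v → P v ∧ G'.Reachable u v) {a b : V} (h : G.Reachable a b)
    (ha : P a) : P b ∧ G'.Reachable a b := by
  rw [SimpleGraph.reachable_iff_reflTransGen] at h
  induction h with
  | refl => exact ⟨ha, SimpleGraph.Reachable.refl _⟩
  | tail _ hbc ih =>
    have := hstep _ _ ih.1 hbc
    exact ⟨this.1, ih.2.trans this.2⟩

theorem reachable_to_of_step (P : V → Prop) {r : V}
    (hstep : ∀ u v, P u → G.Adj u v → G'.Reachable u r ∨ (P v ∧ G'.Adj u v)) {a : V}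
    (h : G.Reachable a r) (ha : P a) : G'.Reachable a r := by
  rw [SimpleGraph.reachable_iff_reflTransGen] at h
  induction h using Relation.ReflTransGen.head_induction_on with
  | refl => exact SimpleGraph.Reachable.refl _
  | head hac _ ih =>
    rcases hstep _ _ ha hac with h | h
    · exact h
    · exact h.2.reachable.trans (ih h.1)

end reachable

section graphs

variable {V : Type*}

/-- The edges of `G` with both ends in `S`, as a graph on the same vertex set. -/
def restrict (G : SimpleGraph V) (S : Set V) : SimpleGraph V where
  Adj u v := G.Adj u v ∧ u ∈ S ∧ v ∈ S
  symm := ⟨fun _ _ h => ⟨h.1.symm, h.2.2, h.2.1⟩⟩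
  loopless := ⟨fun _ h => h.1.ne rfl⟩

theorem restrict_adj {G : SimpleGraph V} {S : Set V} {u v : V} :
    (restrict G S).Adj u v ↔ G.Adj u v ∧ u ∈ S ∧ v ∈ S := Iff.rfl

/-- The graph joining `r` to the vertices in `N`. -/
def star (r : V) (N : Finset V) : SimpleGraph V :=
  SimpleGraph.fromRel fun u v => u = r ∧ v ∈ N

theorem star_adj {r : V} {N : Finset V} {u v : V} :
    (star r N).Adj u v ↔ u ≠ v ∧ (u = r ∧ v ∈ N ∨ v = r ∧ u ∈ N) :=
  SimpleGraph.fromRel_adj _ _ _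

/-- `G` is a connected graph on the vertex set `A`. -/
def ConnOn (A : Finset V) (G : SimpleGraph V) : Prop :=
  (∀ u v, G.Adj u v → u ∈ A ∧ v ∈ A) ∧ ∀ u ∈ A, ∀ v ∈ A, G.Reachable u v

variable [DecidableEq V]

/-- Data from which a connected graph on `A` can be glued together: connected graphs on a set of
vertices avoiding `r` and on its complement, and the neighbours of `r` in the former. -/
structure IsGluing (A : Finset V) (r : V) (S N : Finset V) (G₁ G₂ : SimpleGraph V) : Prop where
  mem : r ∈ A
  subset : S ⊆ A.erase r
  subset' : N ⊆ S
  nonempty : N.Nonempty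
  conn₁ : ConnOn S G₁
  conn₂ : ConnOn (A \ S) G₂

namespace IsGluing

variable {A S N : Finset V} {r : V} {G₁ G₂ : SimpleGraph V}

theorem notMem (h : IsGluing A r S N G₁ G₂) : r ∉ S := fun hr => by simpa using h.subset hr

theorem mem_sdiff (h : IsGluing A r S N G₁ G₂) : r ∈ A \ S := by simp [h.mem, h.notMem]

theorem adj_of_mem (h : IsGluing A r S N G₁ G₂) {u v : V} (hu : u ∈ S) :
    (G₁ ⊔ G₂ ⊔ star r N).Adj u v ↔ G₁.Adj u v ∨ (v = r ∧ u ∈ N) := by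
  have h₁ : ¬ G₂.Adj u v := fun h' => by simpa [hu] using (h.conn₂.1 _ _ h').1
  have h₂ : u ≠ r := fun h' => h.notMem (h' ▸ hu)
  simp only [SimpleGraph.sup_adj, star_adj, h₁, h₂, or_false, false_and, false_or, ne_eq]
  refine or_congr Iff.rfl ⟨fun h => h.2, fun h => ⟨?_, h⟩⟩
  rintro rfl
  exact h₂ h.1

theorem adj_of_notMem (h : IsGluing A r S N G₁ G₂) {u v : V} (hu : u ∉ S) :
    (G₁ ⊔ G₂ ⊔ star r N).Adj u v ↔ G₂.Adj u v ∨ (u = r ∧ v ∈ N) := by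
  have h₁ : ¬ G₁.Adj u v := fun h' => hu (h.conn₁.1 _ _ h').1
  have h₂ : u ∉ N := fun h' => hu (h.subset' h')
  simp only [SimpleGraph.sup_adj, star_adj, h₁, h₂, false_or, ne_eq, and_false, or_false]
  refine or_congr Iff.rfl ⟨fun h => h.2, fun h => ⟨?_, h⟩⟩
  rintro rfl
  exact h₂ h.2

theorem connOn (h : IsGluing A r S N G₁ G₂) : ConnOn A (G₁ ⊔ G₂ ⊔ star r N) := by
  have hSA : S ⊆ A := h.subset.trans (erase_subset _ _)
  constructor
  · intro u v huv
    rcases huv with (huv | huv) | huv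
    · exact ⟨hSA (h.conn₁.1 _ _ huv).1, hSA (h.conn₁.1 _ _ huv).2⟩
    · exact ⟨(Finset.mem_sdiff.1 (h.conn₂.1 _ _ huv).1).1,
        (Finset.mem_sdiff.1 (h.conn₂.1 _ _ huv).2).1⟩
    · rw [star_adj] at huv
      rcases huv.2 with ⟨rfl, hv⟩ | ⟨rfl, hv⟩
      · exact ⟨h.mem, hSA (h.subset' hv)⟩
      · exact ⟨hSA (h.subset' hv), h.mem⟩
  · have key : ∀ u ∈ A, (G₁ ⊔ G₂ ⊔ star r N).Reachable u r := by
      intro u hu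
      by_cases huS : u ∈ S
      · obtain ⟨c, hc⟩ := h.nonempty
        have h₁ : (G₁ ⊔ G₂ ⊔ star r N).Reachable u c :=
          (h.conn₁.2 u huS c (h.subset' hc)).mono (le_sup_left.trans le_sup_left)
        exact h₁.trans ((h.adj_of_mem (h.subset' hc)).2 (Or.inr ⟨rfl, hc⟩)).reachable
      · exact (h.conn₂.2 u (by simp [hu, huS]) r h.mem_sdiff).mono
          (le_sup_right.trans le_sup_left)
    exact fun u hu v hv => (key u hu).trans (key v hv).symm

theorem restrict_eq (h : IsGluing A r S N G₁ G₂) : restrict (G₁ ⊔ G₂ ⊔ star r N) S = G₁ := by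
  ext u v
  rw [restrict_adj]
  constructor
  · rintro ⟨h₁, hu, hv⟩
    refine ((h.adj_of_mem hu).1 h₁).resolve_right ?_
    rintro ⟨rfl, _⟩
    exact h.notMem hv
  · intro h₁
    have := h.conn₁.1 _ _ h₁
    exact ⟨(h.adj_of_mem this.1).2 (Or.inl h₁), this⟩

theorem restrict_sdiff_eq (h : IsGluing A r S N G₁ G₂) :
    restrict (G₁ ⊔ G₂ ⊔ star r N) (A \ S : Finset V) = G₂ := by
  ext u v
  rw [restrict_adj]
  constructor
  · rintro ⟨h₁, hu, hv⟩
    refine ((h.adj_of_notMem (Finset.mem_sdiff.1 hu).2).1 h₁).resolve_right ?_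
    rintro ⟨_, hN⟩
    exact (Finset.mem_sdiff.1 hv).2 (h.subset' hN)
  · intro h₁
    have := h.conn₂.1 _ _ h₁
    exact ⟨(h.adj_of_notMem (Finset.mem_sdiff.1 this.1).2).2 (Or.inl h₁), this⟩

theorem adj_root (h : IsGluing A r S N G₁ G₂) {u : V} (hu : u ∈ S) :
    (G₁ ⊔ G₂ ⊔ star r N).Adj r u ↔ u ∈ N := by
  rw [h.adj_of_notMem h.notMem]
  constructor
  · rintro (h₁ | h₁)
    · exact absurd hu (Finset.mem_sdiff.1 (h.conn₂.1 _ _ h₁).2).2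
    · exact h₁.2
  · exact fun h₁ => Or.inr ⟨rfl, h₁⟩

theorem reachable_iff (h : IsGluing A r S N G₁ G₂) {v₀ u : V} (hv₀ : v₀ ∈ S) :
    (restrict (G₁ ⊔ G₂ ⊔ star r N) (A.erase r : Finset V)).Reachable v₀ u ↔ u ∈ S := by
  constructor
  · intro hr
    refine (reachable_of_closed (G' := restrict (G₁ ⊔ G₂ ⊔ star r N) (A.erase r : Finset V))
      (fun w => w ∈ S) (fun u v hu huv => ⟨?_, huv.reachable⟩) hr hv₀).1
    rcases (h.adj_of_mem hu).1 huv.1 with h₁ | ⟨rfl, _⟩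
    · exact (h.conn₁.1 _ _ h₁).2
    · simpa using huv.2.2
  · intro hu
    refine (h.conn₁.2 v₀ hv₀ u hu).mono fun a b hab => ?_
    have := h.conn₁.1 _ _ hab
    exact ⟨Or.inl (Or.inl hab), h.subset this.1, h.subset this.2⟩

end IsGluing

section split

open scoped Classical in
/-- The vertices connected to `v₀` without passing through `r`. -/
noncomputable def side (A : Finset V) (r v₀ : V) (G : SimpleGraph V) : Finset V :=
  {u ∈ A | (restrict G (A.erase r : Finset V)).Reachable v₀ u}

open scoped Classical in
/-- The neighbours of `r` among the vertices connected to `v₀` without passing through `r`. -/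
noncomputable def gate (A : Finset V) (r v₀ : V) (G : SimpleGraph V) : Finset V :=
  {u ∈ side A r v₀ G | G.Adj r u}

variable {A : Finset V} {r v₀ : V} {G : SimpleGraph V}

theorem mem_side {u : V} : u ∈ side A r v₀ G ↔
    u ∈ A ∧ (restrict G (A.erase r : Finset V)).Reachable v₀ u := by
  simp [side]

theorem mem_gate {u : V} : u ∈ gate A r v₀ G ↔ u ∈ side A r v₀ G ∧ G.Adj r u := by
  simp [gate]

theorem mem_side_self (hv : v₀ ∈ A) : v₀ ∈ side A r v₀ G := by
  simp [side, hv]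

theorem side_subset (hv₀ : v₀ ∈ A.erase r) : side A r v₀ G ⊆ A.erase r := by
  intro u hu
  have hr := (mem_side.1 hu).2
  exact (reachable_of_closed (G := restrict G (A.erase r : Finset V))
    (G' := restrict G (A.erase r : Finset V)) (fun w => w ∈ A.erase r)
    (fun u v _ huv => ⟨huv.2.2, huv.reachable⟩) hr hv₀).1

theorem mem_side_of_adj (hv₀ : v₀ ∈ A.erase r) {u v : V} (hu : u ∈ side A r v₀ G)
    (huv : G.Adj u v) (hv : v ∈ A.erase r) : v ∈ side A r v₀ G := by
  refine mem_side.2 ⟨mem_of_mem_erase hv, (mem_side.1 hu).2.trans ?_⟩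
  exact SimpleGraph.Adj.reachable ⟨huv, side_subset hv₀ hu, hv⟩

theorem isGluing_split (hr : r ∈ A) (hv₀ : v₀ ∈ A.erase r) (hG : ConnOn A G) :
    IsGluing A r (side A r v₀ G) (gate A r v₀ G) (restrict G (side A r v₀ G))
      (restrict G (A \ side A r v₀ G : Finset V)) := by
  have hv₀A := mem_of_mem_erase hv₀
  have hrS : r ∉ side A r v₀ G := fun h => by simpa using side_subset hv₀ h
  refine ⟨hr, side_subset hv₀, fun _ h => (mem_gate.1 h).1, ?_, ⟨fun u v huv => huv.2, ?_⟩,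
    ⟨fun u v huv => huv.2, ?_⟩⟩
  · by_contra hne
    have hclosed := (reachable_of_closed (G' := G) (fun w => w ∈ side A r v₀ G)
      (fun u v hu huv => ⟨?_, huv.reachable⟩) (hG.2 v₀ hv₀A r hr) (mem_side_self hv₀A)).1
    · exact hrS hclosed
    · refine mem_side_of_adj hv₀ hu huv (mem_erase.2 ⟨?_, (hG.1 _ _ huv).2⟩)
      rintro rfl
      exact hne ⟨u, mem_gate.2 ⟨hu, huv.symm⟩⟩
  · have key : ∀ u ∈ side A r v₀ G, (restrict G (side A r v₀ G)).Reachable v₀ u := by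
      intro u hu
      refine (reachable_of_closed (fun w => w ∈ side A r v₀ G)
        (fun a b ha hab => ?_) (mem_side.1 hu).2 (mem_side_self hv₀A)).2
      have hb := mem_side_of_adj hv₀ ha hab.1 hab.2.2
      exact ⟨hb, SimpleGraph.Adj.reachable ⟨hab.1, ha, hb⟩⟩
    exact fun u hu v hv => (key u hu).symm.trans (key v hv)
  · have key : ∀ u ∈ A \ side A r v₀ G,
        (restrict G (A \ side A r v₀ G : Finset V)).Reachable u r := by
      intro u hu
      refine reachable_to_of_step (fun w => w ∈ A \ side A r v₀ G) (fun a b ha hab => ?_)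
        (hG.2 u (mem_sdiff.1 hu).1 r hr) hu
      by_cases har : a = r
      · exact Or.inl (har ▸ SimpleGraph.Reachable.refl _)
      · have hb : b ∈ A \ side A r v₀ G := by
          refine mem_sdiff.2 ⟨(hG.1 _ _ hab).2, fun hb => (mem_sdiff.1 ha).2 ?_⟩
          exact mem_side_of_adj hv₀ hb hab.symm (mem_erase.2 ⟨har, (hG.1 _ _ hab).1⟩)
        exact Or.inr ⟨hb, hab, ha, hb⟩
    exact fun u hu v hv => (key u hu).trans (key v hv).symm

theorem split_eq (hv₀ : v₀ ∈ A.erase r) (hG : ConnOn A G) :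
    restrict G (side A r v₀ G) ⊔ restrict G (A \ side A r v₀ G : Finset V) ⊔
      star r (gate A r v₀ G) = G := by
  ext u v
  simp only [SimpleGraph.sup_adj, restrict_adj, star_adj, mem_coe, mem_sdiff, mem_gate]
  constructor
  · rintro ((h | h) | ⟨_, ⟨rfl, h⟩ | ⟨rfl, h⟩⟩)
    · exact h.1
    · exact h.1
    · exact h.2
    · exact h.2.symm
  · intro h
    have hA := hG.1 _ _ h
    by_cases hu : u ∈ side A r v₀ G <;> by_cases hv : v ∈ side A r v₀ G
    · exact Or.inl (Or.inl ⟨h, hu, hv⟩)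
    · refine Or.inr ⟨h.ne, Or.inr ⟨?_, hu, ?_⟩⟩
      · by_contra hvr
        exact hv (mem_side_of_adj hv₀ hu h (mem_erase.2 ⟨hvr, hA.2⟩))
      · by_contra hvr
        refine hv (mem_side_of_adj hv₀ hu h (mem_erase.2 ⟨?_, hA.2⟩))
        rintro rfl
        exact hvr h.symm
    · refine Or.inr ⟨h.ne, Or.inl ⟨?_, hv, ?_⟩⟩
      · by_contra hvr
        exact hu (mem_side_of_adj hv₀ hv h.symm (mem_erase.2 ⟨hvr, hA.1⟩))
      · by_contra hvr
        refine hu (mem_side_of_adj hv₀ hv h.symm (mem_erase.2 ⟨?_, hA.1⟩))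
        rintro rfl
        exact hvr h
    · exact Or.inl (Or.inr ⟨h, ⟨hA.1, hu⟩, ⟨hA.2, hv⟩⟩)

variable [Fintype V]

open scoped Classical in
/-- The connected graphs on `A`. -/
noncomputable def connGraphs (A : Finset V) : Finset (SimpleGraph V) := {G | ConnOn A G}

theorem mem_connGraphs : G ∈ connGraphs A ↔ ConnOn A G := by simp [connGraphs]

theorem sum_connGraphs {M : Type*} [AddCommMonoid M] (hr : r ∈ A) (hv₀ : v₀ ∈ A.erase r)
    (f : SimpleGraph V → M) : ∑ G ∈ connGraphs A, f G =
      ∑ S ∈ (A.erase r).powerset with v₀ ∈ S, ∑ N ∈ S.powerset with N.Nonempty,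
        ∑ G₁ ∈ connGraphs S, ∑ G₂ ∈ connGraphs (A \ S), f (G₁ ⊔ G₂ ⊔ star r N) := by
  simp only [sum_sigma']
  refine sum_nbij' (fun G => ⟨side A r v₀ G, gate A r v₀ G, restrict G (side A r v₀ G),
    restrict G (A \ side A r v₀ G : Finset V)⟩)
    (fun x => x.2.2.1 ⊔ x.2.2.2 ⊔ star r x.2.1) ?_ ?_ ?_ ?_ ?_
  · intro G hG
    have h := isGluing_split hr hv₀ (mem_connGraphs.1 hG)
    simp only [mem_sigma, mem_filter, mem_powerset, mem_connGraphs]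
    exact ⟨⟨h.subset, mem_side_self (mem_of_mem_erase hv₀)⟩, ⟨h.subset', h.nonempty⟩, h.conn₁,
      h.conn₂⟩
  · rintro ⟨S, N, G₁, G₂⟩ hx
    simp only [mem_sigma, mem_filter, mem_powerset, mem_connGraphs] at hx ⊢
    exact (IsGluing.mk hr hx.1.1 hx.2.1.1 hx.2.1.2 hx.2.2.1 hx.2.2.2).connOn
  · intro G hG
    exact split_eq hv₀ (mem_connGraphs.1 hG)
  · rintro ⟨S, N, G₁, G₂⟩ hx
    simp only [mem_sigma, mem_filter, mem_powerset, mem_connGraphs] at hx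
    have h := IsGluing.mk hr hx.1.1 hx.2.1.1 hx.2.1.2 hx.2.2.1 hx.2.2.2
    have hside : side A r v₀ (G₁ ⊔ G₂ ⊔ star r N) = S := by
      ext u
      rw [mem_side, h.reachable_iff hx.1.2]
      exact ⟨fun h => h.2, fun hu => ⟨mem_of_mem_erase (h.subset hu), hu⟩⟩
    have hgate : gate A r v₀ (G₁ ⊔ G₂ ⊔ star r N) = N := by
      ext u
      rw [mem_gate, hside]
      exact ⟨fun h' => (h.adj_root h'.1).1 h'.2,
        fun hu => ⟨h.subset' hu, (h.adj_root (h.subset' hu)).2 hu⟩⟩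
    simp only [hside, hgate, h.restrict_eq, h.restrict_sdiff_eq]
  · intro G hG
    rw [split_eq hv₀ (mem_connGraphs.1 hG)]

end split
end graphs
end InvPoly

namespace InvPoly

open Finset

variable {V : Type*}

/-- The number of edges of a graph. -/
noncomputable def numEdges (G : SimpleGraph V) : ℕ := G.edgeSet.ncard

theorem numEdges_star [DecidableEq V] {r : V} {N : Finset V} (hr : r ∉ N) :
    numEdges (star r N) = #N := by
  have : (star r N).edgeSet = ((N.image fun v => s(r, v) : Finset (Sym2 V)) : Set (Sym2 V)) := by
    ext e
    induction e using Sym2.ind with | _ u v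
    rw [SimpleGraph.mem_edgeSet, star_adj, mem_coe, mem_image]
    constructor
    · rintro ⟨_, ⟨rfl, h⟩ | ⟨rfl, h⟩⟩
      · exact ⟨v, h, rfl⟩
      · exact ⟨u, h, Sym2.eq_swap⟩
    · rintro ⟨w, hw, h⟩
      rcases Sym2.eq_iff.1 h with ⟨rfl, rfl⟩ | ⟨rfl, rfl⟩
      · exact ⟨fun h => hr (h ▸ hw), Or.inl ⟨rfl, hw⟩⟩
      · exact ⟨fun h => hr (h ▸ hw), Or.inr ⟨rfl, hw⟩⟩
  rw [numEdges, this, Set.ncard_coe_finset, card_image_of_injective]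
  intro a b h
  exact Sym2.congr_right.1 h

theorem numEdges_sup [Finite V] {G₁ G₂ : SimpleGraph V}
    (h : ∀ u v, G₁.Adj u v → ¬ G₂.Adj u v) : numEdges (G₁ ⊔ G₂) = numEdges G₁ + numEdges G₂ := by
  rw [numEdges, SimpleGraph.edgeSet_sup, Set.ncard_union_eq]
  · rfl
  · rw [Set.disjoint_left]
    intro e h₁ h₂
    induction e using Sym2.ind with | _ u v
    exact h u v h₁ h₂

variable [DecidableEq V] {A S N : Finset V} {r : V} {G₁ G₂ : SimpleGraph V}

theorem IsGluing.numEdges_eq [Finite V] (h : IsGluing A r S N G₁ G₂) :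
    numEdges (G₁ ⊔ G₂ ⊔ star r N) = numEdges G₁ + numEdges G₂ + #N := by
  have hrN : r ∉ N := fun hr => h.notMem (h.subset' hr)
  rw [numEdges_sup, numEdges_sup, numEdges_star hrN]
  · intro u v h₁ h₂
    exact (Finset.mem_sdiff.1 (h.conn₂.1 _ _ h₂).1).2 (h.conn₁.1 _ _ h₁).1
  · intro u v h₁ h₂
    rw [star_adj] at h₂
    rcases h₁ with h₁ | h₁
    · have := h.conn₁.1 _ _ h₁
      rcases h₂.2 with ⟨rfl, _⟩ | ⟨rfl, _⟩
      · exact h.notMem this.1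
      · exact h.notMem this.2
    · have := h.conn₂.1 _ _ h₁
      rcases h₂.2 with ⟨rfl, h₃⟩ | ⟨rfl, h₃⟩
      · exact (Finset.mem_sdiff.1 this.2).2 (h.subset' h₃)
      · exact (Finset.mem_sdiff.1 this.1).2 (h.subset' h₃)

theorem IsGluing.card_add_card (h : IsGluing A r S N G₁ G₂) : #S + #(A \ S) = #A := by
  have := card_sdiff_add_card_eq_card (h.subset.trans (erase_subset _ _))
  omega

theorem IsGluing.card_pos (h : IsGluing A r S N G₁ G₂) :
    0 < #S ∧ 0 < #(A \ S) ∧ 0 < #N :=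
  ⟨Finset.card_pos.2 (h.nonempty.mono h.subset'), Finset.card_pos.2 ⟨r, h.mem_sdiff⟩,
    Finset.card_pos.2 h.nonempty⟩

theorem card_le_numEdges_add_one [Finite V] {G : SimpleGraph V} (hG : ConnOn A G) :
    #A ≤ numEdges G + 1 := by
  induction hn : #A using Nat.strong_induction_on generalizing A G with
  | _ n ih =>
    subst hn
    rcases A.eq_empty_or_nonempty with rfl | ⟨r, hr⟩
    · simp
    rcases (A.erase r).eq_empty_or_nonempty with he | ⟨v₀, hv₀⟩
    · have := card_erase_of_mem hr
      rw [he, card_empty] at this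
      omega
    have h := isGluing_split hr hv₀ hG
    have hc := h.card_add_card
    have hp := h.card_pos
    have h₁ := ih _ (by omega) h.conn₁ rfl
    have h₂ := ih _ (by omega) h.conn₂ rfl
    have h₃ := h.numEdges_eq
    rw [split_eq hv₀ hG] at h₃
    omega

theorem IsGluing.numEdges_add_one_eq_iff [Finite V] (h : IsGluing A r S N G₁ G₂) :
    numEdges (G₁ ⊔ G₂ ⊔ star r N) + 1 = #A ↔
      #N = 1 ∧ numEdges G₁ + 1 = #S ∧ numEdges G₂ + 1 = #(A \ S) := by
  have hc := h.card_add_card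
  have hp := h.card_pos
  have h₁ := card_le_numEdges_add_one h.conn₁
  have h₂ := card_le_numEdges_add_one h.conn₂
  have h₃ := h.numEdges_eq
  omega

/-- Removing `j` disconnects `i` from `r`. -/
def Separates (G : SimpleGraph V) (r i j : V) : Prop := ¬ (restrict G {j}ᶜ).Reachable i r

section separates

variable {c i j : V}

theorem IsGluing.separates_of_mem_of_mem (h : IsGluing A r S {c} G₁ G₂) (hi : i ∈ S) (hj : j ∈ S) :
    Separates (G₁ ⊔ G₂ ⊔ star r {c}) r i j ↔ j = c ∨ Separates G₁ c i j := by
  have hc : c ∈ S := h.subset' (mem_singleton_self c)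
  have hjr : r ≠ j := fun h' => h.notMem (h' ▸ hj)
  by_cases hjc : j = c
  · refine iff_of_true (fun hreach => ?_) (Or.inl hjc)
    subst hjc
    refine h.notMem (reachable_of_closed (G := restrict (G₁ ⊔ G₂ ⊔ star r {j}) {j}ᶜ)
      (G' := restrict (G₁ ⊔ G₂ ⊔ star r {j}) {j}ᶜ) (fun w => w ∈ S)
      (fun u v hu huv => ⟨?_, huv.reachable⟩) hreach hi).1
    rcases (h.adj_of_mem hu).1 huv.1 with h₁ | ⟨_, h₁⟩
    · exact (h.conn₁.1 _ _ h₁).2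
    · exact absurd (mem_singleton.1 h₁) huv.2.1
  · simp only [hjc, false_or]
    refine not_congr ⟨fun hreach => ?_, fun hreach => ?_⟩
    · have key : ∀ u v, u ∈ S → (restrict (G₁ ⊔ G₂ ⊔ star r {c}) {j}ᶜ).Adj u v →
          (restrict G₁ {j}ᶜ).Reachable u c ∨ v ∈ S ∧ (restrict G₁ {j}ᶜ).Adj u v := by
        intro u v hu huv
        rcases (h.adj_of_mem hu).1 huv.1 with h₁ | ⟨_, h₁⟩
        · exact Or.inr ⟨(h.conn₁.1 _ _ h₁).2, h₁, huv.2⟩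
        · exact Or.inl (mem_singleton.1 h₁ ▸ SimpleGraph.Reachable.refl _)
      rw [SimpleGraph.reachable_iff_reflTransGen] at hreach
      induction hreach using Relation.ReflTransGen.head_induction_on with
      | refl => exact absurd hi h.notMem
      | head hac _ ih =>
        rcases key _ _ hi hac with h' | h'
        · exact h'
        · exact h'.2.reachable.trans (ih h'.1)
    · have h₁ : (restrict (G₁ ⊔ G₂ ⊔ star r {c}) {j}ᶜ).Reachable i c :=
        hreach.mono (G := restrict G₁ {j}ᶜ) fun a b hab => ⟨Or.inl (Or.inl hab.1), hab.2⟩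
      refine h₁.trans (SimpleGraph.Adj.reachable ⟨?_, ?_, hjr⟩)
      · exact (h.adj_of_mem hc).2 (Or.inr ⟨rfl, mem_singleton_self c⟩)
      · exact fun h' => hjc h'.symm

theorem IsGluing.not_separates_of_mem_of_notMem (h : IsGluing A r S {c} G₁ G₂) (hi : i ∈ S)
    (hj : j ∉ S) (hjr : j ≠ r) : ¬ Separates (G₁ ⊔ G₂ ⊔ star r {c}) r i j := by
  have hc : c ∈ S := h.subset' (mem_singleton_self c)
  have hne : ∀ u ∈ S, u ≠ j := fun u hu h' => hj (h' ▸ hu)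
  refine not_not.2 ?_
  have h₁ : (restrict (G₁ ⊔ G₂ ⊔ star r {c}) {j}ᶜ).Reachable i c := by
    refine (h.conn₁.2 i hi c hc).mono fun a b hab => ⟨Or.inl (Or.inl hab), ?_⟩
    have := h.conn₁.1 _ _ hab
    exact ⟨hne _ this.1, hne _ this.2⟩
  refine h₁.trans (SimpleGraph.Adj.reachable ⟨?_, hne _ hc, hjr.symm⟩)
  exact (h.adj_of_mem hc).2 (Or.inr ⟨rfl, mem_singleton_self c⟩)

theorem IsGluing.not_separates_of_mem_sdiff_of_mem (h : IsGluing A r S {c} G₁ G₂)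
    (hi : i ∈ A \ S) (hj : j ∈ S) : ¬ Separates (G₁ ⊔ G₂ ⊔ star r {c}) r i j := by
  refine not_not.2 ((h.conn₂.2 i hi r h.mem_sdiff).mono fun a b hab =>
    ⟨Or.inl (Or.inr hab), ?_⟩)
  have := h.conn₂.1 _ _ hab
  exact ⟨fun h' => (Finset.mem_sdiff.1 this.1).2 (h' ▸ hj),
    fun h' => (Finset.mem_sdiff.1 this.2).2 (h' ▸ hj)⟩

theorem IsGluing.separates_of_notMem (h : IsGluing A r S {c} G₁ G₂) (hi : i ∈ A \ S) :
    Separates (G₁ ⊔ G₂ ⊔ star r {c}) r i j ↔ Separates G₂ r i j := by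
  refine not_congr ⟨fun hreach => ?_, fun hreach =>
    hreach.mono (G := restrict G₂ {j}ᶜ) fun a b hab => ⟨Or.inl (Or.inr hab.1), hab.2⟩⟩
  refine reachable_to_of_step (fun w => w ∈ A \ S) (fun u v hu huv => ?_) hreach hi
  rcases (h.adj_of_notMem (Finset.mem_sdiff.1 hu).2).1 huv.1 with h₁ | ⟨rfl, _⟩
  · exact Or.inr ⟨(h.conn₂.1 _ _ h₁).2, h₁, huv.2⟩
  · exact Or.inl (SimpleGraph.Reachable.refl _)

end separates

section inversions

variable {V : Type*} [LinearOrder V] {A S N : Finset V} {r : V} {G₁ G₂ : SimpleGraph V}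

open scoped Classical in
/-- The pairs `i < j` in `A` such that `j` lies between `i` and `r`. -/
noncomputable def invSet (A : Finset V) (r : V) (G : SimpleGraph V) : Finset (V × V) :=
  {p ∈ A ×ˢ A | p.1 < p.2 ∧ p.2 ≠ r ∧ Separates G r p.1 p.2}

theorem mem_invSet {G : SimpleGraph V} {p : V × V} : p ∈ invSet A r G ↔
    (p.1 ∈ A ∧ p.2 ∈ A) ∧ p.1 < p.2 ∧ p.2 ≠ r ∧ Separates G r p.1 p.2 := by
  simp [invSet]

theorem IsGluing.card_invSet {c : V} (h : IsGluing A r S {c} G₁ G₂) :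
    #(invSet A r (G₁ ⊔ G₂ ⊔ star r {c})) =
      #(invSet S c G₁) + #{i ∈ S | i < c} + #(invSet (A \ S) r G₂) := by
  have hc : c ∈ S := h.subset' (mem_singleton_self c)
  have hSA : S ⊆ A := h.subset.trans (erase_subset _ _)
  have hSr : ∀ u ∈ S, u ≠ r := fun u hu h' => h.notMem (h' ▸ hu)
  have hU : invSet A r (G₁ ⊔ G₂ ⊔ star r {c}) =
      (invSet S c G₁ ∪ {i ∈ S | i < c}.map (Function.Embedding.sectL V c)) ∪
        invSet (A \ S) r G₂ := by
    ext ⟨i, j⟩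
    simp only [mem_union, mem_invSet, mem_map, mem_filter, Function.Embedding.sectL_apply,
      Prod.mk.injEq]
    constructor
    · rintro ⟨⟨hi, hj⟩, hij, hjr, hsep⟩
      by_cases hiS : i ∈ S <;> by_cases hjS : j ∈ S
      · rw [h.separates_of_mem_of_mem hiS hjS] at hsep
        by_cases hjc : j = c
        · exact Or.inl (Or.inr ⟨i, ⟨hiS, hjc ▸ hij⟩, rfl, hjc.symm⟩)
        · exact Or.inl (Or.inl ⟨⟨hiS, hjS⟩, hij, hjc, hsep.resolve_left hjc⟩)
      · exact absurd hsep (h.not_separates_of_mem_of_notMem hiS hjS hjr)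
      · exact absurd hsep (h.not_separates_of_mem_sdiff_of_mem (by simp [hi, hiS]) hjS)
      · rw [h.separates_of_notMem (by simp [hi, hiS])] at hsep
        exact Or.inr ⟨⟨by simp [hi, hiS], by simp [hj, hjS]⟩, hij, hjr, hsep⟩
    · rintro ((⟨⟨hi, hj⟩, hij, hjc, hsep⟩ | ⟨a, ⟨ha, hac⟩, rfl, rfl⟩) | ⟨⟨hi, hj⟩, hij, hjr, hsep⟩)
      · exact ⟨⟨hSA hi, hSA hj⟩, hij, hSr j hj,
          (h.separates_of_mem_of_mem hi hj).2 (Or.inr hsep)⟩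
      · exact ⟨⟨hSA ha, hSA hc⟩, hac, hSr c hc,
          (h.separates_of_mem_of_mem ha hc).2 (Or.inl rfl)⟩
      · exact ⟨⟨(Finset.mem_sdiff.1 hi).1, (Finset.mem_sdiff.1 hj).1⟩, hij, hjr,
          (h.separates_of_notMem hi).2 hsep⟩
  rw [hU, card_union_of_disjoint, card_union_of_disjoint, card_map]
  · rw [Finset.disjoint_left]
    rintro p hp hp'
    obtain ⟨a, _, rfl⟩ := mem_map.1 hp'
    exact (mem_invSet.1 hp).2.2.1 rfl
  · rw [Finset.disjoint_left]
    rintro p hp hp'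
    have h' := (Finset.mem_sdiff.1 (mem_invSet.1 hp').1.1).2
    rcases mem_union.1 hp with hp | hp
    · exact h' (mem_invSet.1 hp).1.1
    · obtain ⟨a, ha, rfl⟩ := mem_map.1 hp
      exact h' (mem_filter.1 ha).1

theorem mul_sum_pow_card_filter_lt {R : Type*} [CommRing R] (q : R) (S : Finset V) :
    q * ∑ c ∈ S, (1 + q) ^ #{i ∈ S | i < c} = (1 + q) ^ #S - 1 := by
  induction S using Finset.induction_on_max with
  | empty => simp
  | insert a S ha ih =>
    have haS : a ∉ S := fun h => lt_irrefl a (ha a h)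
    have h₁ : ∀ c ∈ S, (1 + q) ^ #{i ∈ insert a S | i < c} = (1 + q) ^ #{i ∈ S | i < c} := by
      intro c hc
      rw [filter_insert, if_neg (ha c hc).not_gt]
    have h₂ : {i ∈ insert a S | i < a} = S := by
      rw [filter_insert, if_neg (lt_irrefl a), filter_true_of_mem ha]
    rw [sum_insert haS, h₂, sum_congr rfl h₁, mul_add, ih, card_insert_of_notMem haS, pow_succ]
    ring

theorem sum_nonempty_powerset_pow_card {R : Type*} [CommRing R] (q : R) (S : Finset V) :
    ∑ N ∈ S.powerset with N.Nonempty, q ^ #N = (1 + q) ^ #S - 1 := by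
  have h := Finset.sum_pow_mul_eq_add_pow q 1 S
  simp only [one_pow, mul_one] at h
  rw [add_comm 1 q, ← h, ← sum_filter_add_sum_filter_not S.powerset (fun N : Finset V => N.Nonempty)]
  have : {N ∈ S.powerset | ¬ N.Nonempty} = {∅} := by
    ext N
    simp only [mem_filter, mem_powerset, not_nonempty_iff_eq_empty, mem_singleton]
    exact ⟨fun h => h.2, fun h => ⟨h ▸ empty_subset _, h⟩⟩
  rw [this, sum_singleton, card_empty, pow_zero, add_sub_cancel_right]

variable [Fintype V]

theorem connGraphs_singleton (r : V) : connGraphs {r} = {(⊥ : SimpleGraph V)} := by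
  ext G
  rw [mem_connGraphs, mem_singleton]
  constructor
  · intro h
    ext u v
    simp only [SimpleGraph.bot_adj, iff_false]
    intro huv
    have := h.1 _ _ huv
    rw [mem_singleton, mem_singleton] at this
    exact huv.ne (this.1.trans this.2.symm)
  · rintro rfl
    refine ⟨fun u v h => h.elim, fun u hu v hv => ?_⟩
    rw [mem_singleton.1 hu, mem_singleton.1 hv]

/-- The generating function of connected graphs by number of edges is, up to a change of
variables, the generating function of trees by number of inversions. -/
theorem sum_pow_numEdges {R : Type*} [CommRing R] (q : R) (hr : r ∈ A) :
    ∑ G ∈ connGraphs A, q ^ numEdges G = q ^ (#A - 1) *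
      ∑ T ∈ connGraphs A with numEdges T + 1 = #A, (1 + q) ^ #(invSet A r T) := by
  induction hn : #A using Nat.strong_induction_on generalizing A r with
  | _ n ih =>
    subst hn
    rcases (A.erase r).eq_empty_or_nonempty with he | ⟨v₀, hv₀⟩
    · obtain rfl : A = {r} := by
        rw [← insert_erase hr, he, insert_empty_eq]
      have hinv : invSet {r} r (⊥ : SimpleGraph V) = ∅ := by
        ext p
        simp only [mem_invSet, notMem_empty, iff_false, mem_singleton]
        exact fun h => h.2.2.1 h.1.2
      rw [connGraphs_singleton, sum_filter, sum_singleton, sum_singleton, hinv]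
      simp [numEdges]
    · rw [sum_filter, sum_connGraphs hr hv₀, sum_connGraphs hr hv₀, mul_sum]
      refine sum_congr rfl fun S hS => ?_
      rw [mem_filter, mem_powerset] at hS
      have hg : ∀ N ∈ {N ∈ S.powerset | N.Nonempty}, ∀ G₁ ∈ connGraphs S,
          ∀ G₂ ∈ connGraphs (A \ S), IsGluing A r S N G₁ G₂ := by
        intro N hN G₁ h₁ G₂ h₂
        rw [mem_filter, mem_powerset] at hN
        exact ⟨hr, hS.1, hN.1, hN.2, mem_connGraphs.1 h₁, mem_connGraphs.1 h₂⟩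
      have hSA : S ⊆ A := hS.1.trans (erase_subset _ _)
      have hrB : r ∈ A \ S := mem_sdiff.2 ⟨hr, fun h => by simpa using hS.1 h⟩
      have hcard := card_sdiff_add_card_eq_card hSA
      have hposS : 0 < #S := card_pos.2 ⟨v₀, hS.2⟩
      have hposB : 0 < #(A \ S) := card_pos.2 ⟨r, hrB⟩
      have ihB := ih _ (by omega) hrB rfl
      have ihS : ∀ c ∈ S, ∑ G ∈ connGraphs S, q ^ numEdges G = q ^ (#S - 1) *
          ∑ T ∈ connGraphs S with numEdges T + 1 = #S, (1 + q) ^ #(invSet S c T) :=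
        fun c hc => ih _ (by omega) hc rfl
      have hL : ∑ N ∈ S.powerset with N.Nonempty, ∑ G₁ ∈ connGraphs S,
          ∑ G₂ ∈ connGraphs (A \ S), q ^ numEdges (G₁ ⊔ G₂ ⊔ star r N) =
          (∑ N ∈ S.powerset with N.Nonempty, q ^ #N) * ((∑ G ∈ connGraphs S, q ^ numEdges G) *
            ∑ G ∈ connGraphs (A \ S), q ^ numEdges G) := by
        rw [sum_mul]
        refine sum_congr rfl fun N hN => ?_
        rw [sum_mul_sum, mul_sum]
        refine sum_congr rfl fun G₁ h₁ => ?_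
        rw [mul_sum]
        refine sum_congr rfl fun G₂ h₂ => ?_
        rw [(hg N hN G₁ h₁ G₂ h₂).numEdges_eq, pow_add, pow_add]
        ring
      have hR : ∑ N ∈ S.powerset with N.Nonempty, ∑ G₁ ∈ connGraphs S,
          ∑ G₂ ∈ connGraphs (A \ S), (if numEdges (G₁ ⊔ G₂ ⊔ star r N) + 1 = #A then
            (1 + q) ^ #(invSet A r (G₁ ⊔ G₂ ⊔ star r N)) else 0) =
          ∑ c ∈ S, (1 + q) ^ #{i ∈ S | i < c} *
            ((∑ T ∈ connGraphs S with numEdges T + 1 = #S, (1 + q) ^ #(invSet S c T)) *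
            ∑ T ∈ connGraphs (A \ S) with numEdges T + 1 = #(A \ S),
              (1 + q) ^ #(invSet (A \ S) r T)) := by
        have hsub : S.map ⟨fun c => ({c} : Finset V), singleton_injective⟩ ⊆
            {N ∈ S.powerset | N.Nonempty} := by
          intro N hN
          obtain ⟨c, hc, rfl⟩ := mem_map.1 hN
          simpa using hc
        rw [← sum_subset hsub, sum_map]
        · refine sum_congr rfl fun c hc => ?_
          rw [sum_filter, sum_filter, sum_mul_sum, mul_sum]
          refine sum_congr rfl fun G₁ h₁ => ?_
          rw [mul_sum]
          refine sum_congr rfl fun G₂ h₂ => ?_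
          have h := hg {c} (by simpa using hc) G₁ h₁ G₂ h₂
          simp only [Function.Embedding.coeFn_mk]
          simp only [h.numEdges_add_one_eq_iff, card_singleton, true_and]
          by_cases e₁ : numEdges G₁ + 1 = #S <;> by_cases e₂ : numEdges G₂ + 1 = #(A \ S)
          · rw [if_pos ⟨e₁, e₂⟩, if_pos e₁, if_pos e₂, h.card_invSet, pow_add, pow_add]
            ring
          · simp [e₁, e₂]
          · simp [e₁, e₂]
          · simp [e₁, e₂]
        · intro N hN hN'
          refine sum_eq_zero fun G₁ h₁ => sum_eq_zero fun G₂ h₂ => if_neg ?_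
          rw [(hg N hN G₁ h₁ G₂ h₂).numEdges_add_one_eq_iff]
          rintro ⟨h, _⟩
          obtain ⟨c, rfl⟩ := card_eq_one.1 h
          rw [mem_filter, mem_powerset, singleton_subset_iff] at hN
          exact hN' (mem_map.2 ⟨c, hN.1, rfl⟩)
      rw [hL, hR, sum_nonempty_powerset_pow_card, ← mul_sum_pow_card_filter_lt]
      generalize ∑ G ∈ connGraphs S, q ^ numEdges G = C₁ at ihS
      generalize ∑ G ∈ connGraphs (A \ S), q ^ numEdges G = C₂ at ihB
      rw [mul_assoc, sum_mul, mul_sum, mul_sum]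
      refine sum_congr rfl fun c hc => ?_
      rw [ihB, ihS c hc, show #A - 1 = 1 + (#S - 1) + (#(A \ S) - 1) by omega, pow_add, pow_add]
      ring

end inversions
end InvPoly

namespace InvPoly

open Finset

section orderedPairs

variable (V : Type*) [LinearOrder V] [Fintype V]

/-- The pairs `(u, v)` with `u < v`. -/
def ltPairs : Finset (V × V) := {p | p.1 < p.2}

variable {V}

/-- The graph whose edges are the given pairs. -/
def graphOfPairs (A : Finset (V × V)) : SimpleGraph V := SimpleGraph.fromRel fun u v => (u, v) ∈ A

open scoped Classical in
/-- The edges of a graph, with the smaller endpoint listed first. -/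
noncomputable def pairsOfGraph (G : SimpleGraph V) : Finset (V × V) :=
  {p ∈ ltPairs V | G.Adj p.1 p.2}

theorem mem_ltPairs {p : V × V} : p ∈ ltPairs V ↔ p.1 < p.2 := by simp [ltPairs]

theorem mem_pairsOfGraph {G : SimpleGraph V} {p : V × V} :
    p ∈ pairsOfGraph G ↔ p.1 < p.2 ∧ G.Adj p.1 p.2 := by
  simp [pairsOfGraph, mem_ltPairs]

theorem pairsOfGraph_subset (G : SimpleGraph V) : pairsOfGraph G ⊆ ltPairs V := by
  simp [pairsOfGraph]

theorem graphOfPairs_pairsOfGraph (G : SimpleGraph V) : graphOfPairs (pairsOfGraph G) = G := by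
  ext u v
  rw [graphOfPairs, SimpleGraph.fromRel_adj, mem_pairsOfGraph, mem_pairsOfGraph]
  constructor
  · rintro ⟨_, h | h⟩
    exacts [h.2, h.2.symm]
  · intro h
    rcases lt_or_gt_of_ne h.ne with h' | h'
    exacts [⟨h.ne, Or.inl ⟨h', h⟩⟩, ⟨h.ne, Or.inr ⟨h', h.symm⟩⟩]

theorem pairsOfGraph_graphOfPairs {A : Finset (V × V)} (hA : A ⊆ ltPairs V) :
    pairsOfGraph (graphOfPairs A) = A := by
  ext ⟨u, v⟩
  rw [mem_pairsOfGraph, graphOfPairs, SimpleGraph.fromRel_adj]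
  constructor
  · rintro ⟨h, _, h' | h'⟩
    · exact h'
    · exact absurd (mem_ltPairs.1 (hA h')) h.asymm
  · intro h
    have := mem_ltPairs.1 (hA h)
    exact ⟨this, this.ne, Or.inl h⟩

theorem card_pairsOfGraph (G : SimpleGraph V) : #(pairsOfGraph G) = numEdges G := by
  have : G.edgeSet = ((pairsOfGraph G).image fun p => s(p.1, p.2) : Finset (Sym2 V)) := by
    ext e
    induction e using Sym2.ind with | _ u v
    rw [SimpleGraph.mem_edgeSet, mem_coe, mem_image]
    constructor
    · intro h
      rcases lt_or_gt_of_ne h.ne with h' | h'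
      · exact ⟨(u, v), mem_pairsOfGraph.2 ⟨h', h⟩, rfl⟩
      · exact ⟨(v, u), mem_pairsOfGraph.2 ⟨h', h.symm⟩, Sym2.eq_swap⟩
    · rintro ⟨p, hp, h⟩
      rw [← SimpleGraph.mem_edgeSet, ← h]
      exact (mem_pairsOfGraph.1 hp).2
  rw [numEdges, this, Set.ncard_coe_finset, card_image_of_injOn]
  rintro ⟨a, b⟩ hp ⟨c, d⟩ hq h
  have h₁ := (mem_pairsOfGraph.1 hp).1
  have h₂ := (mem_pairsOfGraph.1 hq).1
  rcases Sym2.eq_iff.1 h with ⟨h, h'⟩ | ⟨h, h'⟩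
  · exact Prod.ext h h'
  · dsimp only at *
    subst h h'
    exact absurd h₁ h₂.asymm

theorem sup_pairSetoid_eq_top_iff (G : SimpleGraph V) :
    (⊥ : Setoid V) ⊔ (pairsOfGraph G).sup pairSetoid = ⊤ ↔ ConnOn univ G := by
  rw [bot_sup_eq]
  constructor
  · intro h
    refine ⟨fun _ _ _ => ⟨mem_univ _, mem_univ _⟩, fun u _ v _ => ?_⟩
    have hle : (pairsOfGraph G).sup pairSetoid ≤ G.reachableSetoid :=
      Finset.sup_le fun p hp => pairSetoid_le.2 (mem_pairsOfGraph.1 hp).2.reachable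
    rw [h] at hle
    exact hle (x := u) (y := v) trivial
  · intro h
    have hadj : ∀ p ∈ pairsOfGraph G, (pairsOfGraph G).sup pairSetoid p.1 p.2 :=
      fun p hp => pairSetoid_le.1 (Finset.le_sup (f := pairSetoid) hp)
    refine eq_top_iff.2 fun u v _ => ?_
    obtain ⟨w⟩ := h.2 u (mem_univ _) v (mem_univ _)
    induction w with
    | nil => exact Setoid.refl' _ _
    | cons h' _ ih =>
      refine Setoid.trans' _ ?_ (ih trivial)
      rcases lt_or_gt_of_ne h'.ne with hlt | hlt
      · exact hadj (_, _) (mem_pairsOfGraph.2 ⟨hlt, h'⟩)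
      · exact Setoid.symm' _ (hadj (_, _) (mem_pairsOfGraph.2 ⟨hlt, h'.symm⟩))

theorem sup_ltPairs : (⊥ : Setoid V) ⊔ (ltPairs V).sup pairSetoid = ⊤ := by
  have : pairsOfGraph (⊤ : SimpleGraph V) = ltPairs V := by
    ext p
    rw [mem_pairsOfGraph, mem_ltPairs]
    exact ⟨And.left, fun h => ⟨h, h.ne⟩⟩
  rw [← this, sup_pairSetoid_eq_top_iff]
  refine ⟨fun _ _ _ => ⟨mem_univ _, mem_univ _⟩, fun u _ v _ => ?_⟩
  by_cases h : u = v
  · exact h ▸ .refl _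
  · exact SimpleGraph.Adj.reachable h

theorem connProb_ltPairs : connProb (ltPairs V) ⊥ = ∑ G ∈ connGraphs (univ : Finset V),
    (1 - PowerSeries.X) ^ numEdges G * PowerSeries.X ^ (#(ltPairs V) - numEdges G) := by
  classical
  rw [connProb, ← sum_filter]
  refine sum_bij' (fun A _ => graphOfPairs A) (fun G _ => pairsOfGraph G) ?_ ?_ ?_ ?_ ?_
  · intro A hA
    rw [mem_filter, mem_powerset] at hA
    rw [mem_connGraphs, ← sup_pairSetoid_eq_top_iff, pairsOfGraph_graphOfPairs hA.1, ← hA.2]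
  · intro G hG
    rw [mem_filter, mem_powerset]
    exact ⟨pairsOfGraph_subset G, (sup_pairSetoid_eq_top_iff G).2 (mem_connGraphs.1 hG)⟩
  · intro A hA
    exact pairsOfGraph_graphOfPairs (mem_powerset.1 (mem_filter.1 hA).1)
  · intro G _
    exact graphOfPairs_pairsOfGraph G
  · intro A hA
    rw [← card_pairsOfGraph, pairsOfGraph_graphOfPairs (mem_powerset.1 (mem_filter.1 hA).1)]

theorem rank_bot {V : Type*} [Fintype V] : rank (⊥ : Setoid V) = Fintype.card V - 1 := by
  rw [rank, Nat.card_congr (Setoid.quotientBotEquiv (α := V)), Nat.card_eq_fintype_card]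

theorem card_invSet_le (r : V) (G : SimpleGraph V) : #(invSet univ r G) ≤ #(ltPairs V) :=
  card_le_card fun _ hp => mem_ltPairs.2 (mem_invSet.1 hp).2.1

/-- The trees on the vertex set `V`. -/
noncomputable def treeGraphs (V : Type*) [LinearOrder V] [Fintype V] : Finset (SimpleGraph V) :=
  {T ∈ connGraphs univ | numEdges T + 1 = Fintype.card V}

theorem mem_treeGraphs {T : SimpleGraph V} [Nonempty V] : T ∈ treeGraphs V ↔ T.IsTree := by
  rw [treeGraphs, mem_filter, mem_connGraphs, SimpleGraph.isTree_iff_connected_and_card,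
    Nat.card_eq_fintype_card (α := V), numEdges, ← Nat.card_coe_set_eq]
  refine and_congr_left fun _ => ?_
  rw [SimpleGraph.connected_iff]
  exact ⟨fun h => ⟨fun u v => h.2 u (mem_univ _) v (mem_univ _), inferInstance⟩,
    fun h => ⟨fun _ _ _ => ⟨mem_univ _, mem_univ _⟩, fun u _ v _ => h.1 u v⟩⟩

theorem connSeries_ltPairs (r : V) : connSeries (ltPairs V) ⊥ =
    ∑ T ∈ treeGraphs V, PowerSeries.X ^ (#(ltPairs V) - #(invSet univ r T)) := by
  have hle : ∀ G : SimpleGraph V, numEdges G ≤ #(ltPairs V) := fun G =>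
    card_pairsOfGraph G ▸ card_le_card (pairsOfGraph_subset G)
  let φ := algebraMap (PowerSeries ℝ) (FractionRing (PowerSeries ℝ))
  have hφ : Function.Injective φ := IsFractionRing.injective _ _
  have hx : φ PowerSeries.X ≠ 0 := (map_ne_zero_iff φ hφ).2 PowerSeries.X_ne_zero
  have hodds : φ odds * (1 - φ PowerSeries.X) = φ PowerSeries.X := by
    rw [← map_one φ, ← map_sub, ← map_mul, odds_mul]
  apply hφ
  rw [connSeries, connProb_ltPairs, rank_bot]
  simp only [map_mul, map_pow, map_sum, map_sub, map_one]
  set x := φ PowerSeries.X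
  set m := #(ltPairs V)
  have h₁ : ∀ G : SimpleGraph V, (1 - x) ^ numEdges G * x ^ (m - numEdges G) =
      x ^ m * ((1 - x) / x) ^ numEdges G := by
    intro G
    rw [← Nat.sub_add_cancel (hle G), pow_add, div_pow, Nat.add_sub_cancel]
    field_simp
  have h₂ : ∀ T : SimpleGraph V, x ^ m * (1 + (1 - x) / x) ^ #(invSet univ r T) =
      x ^ (m - #(invSet univ r T)) := by
    intro T
    have := pow_sub₀ x hx (card_invSet_le r T)
    rw [this, show 1 + (1 - x) / x = x⁻¹ by field_simp; ring, inv_pow]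
  rw [sum_congr rfl fun G _ => h₁ G, ← mul_sum, sum_pow_numEdges _ (mem_univ r), card_univ,
    ← sum_congr rfl fun T _ => h₂ T, ← mul_sum, treeGraphs]
  have h₃ : φ odds ^ (Fintype.card V - 1) * ((1 - x) / x) ^ (Fintype.card V - 1) = 1 := by
    rw [← mul_pow, mul_div_assoc', hodds, div_self hx, one_pow]
  linear_combination (x ^ m * ∑ T ∈ connGraphs univ with numEdges T + 1 = Fintype.card V,
    (1 + (1 - x) / x) ^ #(invSet univ r T)) * h₃

end orderedPairs

theorem separates_iff {V : Type*} {G : SimpleGraph V} {r i j : V} (hi : i ≠ j) :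
    Separates G r i j ↔ ∀ w : G.Walk i r, w.IsPath → j ∈ w.support := by
  classical
  have hle : restrict G {j}ᶜ ≤ G := fun _ _ h => (restrict_adj.1 h).1
  rw [Separates]
  constructor
  · intro h w _
    by_contra hj
    apply h
    clear h
    induction w with
    | nil => exact .refl _
    | @cons u v _ h' p ih =>
      rw [SimpleGraph.Walk.support_cons, List.mem_cons, not_or] at hj
      have hv : v ≠ j := fun h => hj.2 (h ▸ p.start_mem_support)
      refine (SimpleGraph.Adj.reachable ?_).trans (ih hv (by simp_all) hj.2)
      exact restrict_adj.2 ⟨h', hi, hv⟩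
  · rintro h ⟨w⟩
    have key : ∀ {a b : V} (w : (restrict G {j}ᶜ).Walk a b), a ≠ j → j ∉ w.support := by
      intro a b w
      induction w with
      | nil => simp [eq_comm]
      | cons h' p ih =>
        intro ha
        rw [SimpleGraph.Walk.support_cons, List.mem_cons, not_or]
        exact ⟨ha.symm, ih (restrict_adj.1 h').2.2⟩
    have := h (w.mapLe hle).bypass (SimpleGraph.Walk.bypass_isPath _)
    have := SimpleGraph.Walk.support_bypass_subset_support _ this
    rw [SimpleGraph.Walk.support_mapLe_eq_support] at this
    exact key w hi this

theorem treeInv_eq {n : ℕ} (T : SimpleGraph (Fin (n + 1))) :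
    treeInv T = #(invSet univ 0 T) := by
  rw [treeInv, ← Nat.card_eq_finsetCard]
  refine Nat.card_congr (Equiv.subtypeEquivRight fun p => ?_)
  rw [mem_invSet]
  constructor
  · rintro ⟨_, hlt, h⟩
    exact ⟨⟨mem_univ _, mem_univ _⟩, hlt, (Fin.zero_le _ |>.trans_lt hlt).ne',
      (separates_iff hlt.ne).2 h⟩
  · rintro ⟨_, hlt, _, h⟩
    refine ⟨Fin.pos_iff_ne_zero.2 fun h₀ => ?_, hlt, (separates_iff hlt.ne).1 h⟩
    rw [h₀] at h
    exact h (.refl _)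

theorem coeff_invPoly {n j : ℕ} : ((invPoly n).coeff j : ℝ) =
    ∑ T ∈ treeGraphs (Fin (n + 1)), if j = #(invSet univ 0 T) then 1 else 0 := by
  classical
  rw [invPoly, finsum_eq_sum_of_fintype,
    ← Finset.sum_subtype (treeGraphs (Fin (n + 1))) (fun _ => mem_treeGraphs)
      (fun T => (Polynomial.X : Polynomial ℤ) ^ treeInv T), Polynomial.finsetSum_coeff]
  push_cast
  refine sum_congr rfl fun T _ => ?_
  rw [Polynomial.coeff_X_pow, treeInv_eq]
  push_cast
  rfl

theorem coeff_invPoly_eq {n j : ℕ} (hj : j ≤ #(ltPairs (Fin (n + 1)))) :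
    ((invPoly n).coeff j : ℝ) = PowerSeries.coeff (#(ltPairs (Fin (n + 1))) - j)
      (connSeries (ltPairs (Fin (n + 1))) ⊥) := by
  rw [coeff_invPoly, connSeries_ltPairs 0, map_sum]
  refine sum_congr rfl fun T _ => ?_
  have := card_invSet_le 0 T
  rw [PowerSeries.coeff_X_pow]
  exact if_congr (by omega) rfl rfl

theorem coeff_invPoly_eq_zero {n j : ℕ} (hj : #(ltPairs (Fin (n + 1))) < j) :
    (invPoly n).coeff j = 0 := by
  rw [← Int.cast_eq_zero (α := ℝ), coeff_invPoly]
  refine sum_eq_zero fun T _ => if_neg ?_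
  have := card_invSet_le 0 T
  omega

end InvPoly

/-- The inversion enumerator `I_{n+1}(y)` of labeled trees has log-concave coefficients. -/
theorem invPoly_logConcave (n : ℕ) : PolyLogConcave (invPoly n) := by
  intro i
  rcases le_or_gt (i + 2) (Finset.card (InvPoly.ltPairs (Fin (n + 1)))) with h | h
  · rw [← Int.cast_le (R := ℝ)]
    push_cast
    rw [InvPoly.coeff_invPoly_eq h, InvPoly.coeff_invPoly_eq (j := i) (by omega),
      InvPoly.coeff_invPoly_eq (j := i + 1) (by omega)]
    obtain ⟨k, hk⟩ := Nat.exists_eq_add_of_le h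
    have := InvPoly.connSeries_logConcave _ _ (InvPoly.sup_ltPairs (V := Fin (n + 1))) k
    rw [hk, show i + 2 + k - i = k + 2 by omega, show i + 2 + k - (i + 2) = k by omega,
      show i + 2 + k - (i + 1) = k + 1 by omega, mul_comm]
    exact this
  · rw [InvPoly.coeff_invPoly_eq_zero h, mul_zero]
    exact sq_nonneg _
end

section
/- The polynomial P_n(x) = Σ_{π ∈ PF_n} x^{sum(π)} has log-concave coefficients for all n ≥ 1 (Bóna's conjecture). -/
/-- A parking function of length `n`: a sequence of positive integers whose
nondecreasing rearrangement `b` satisfies `b i ≤ i` (1-indexed). -/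
def IsParkingFunction {n : ℕ} (a : Fin n → ℕ) : Prop :=
  (∀ i, 1 ≤ a i) ∧
    ∃ σ : Equiv.Perm (Fin n), Monotone (a ∘ σ) ∧ ∀ i : Fin n, a (σ i) ≤ (i : ℕ) + 1

/-- The parking function sum enumerator. -/
noncomputable def pfPoly (n : ℕ) : Polynomial ℤ :=
  ∑ᶠ a : {a : Fin n → ℕ // IsParkingFunction a}, (Polynomial.X : Polynomial ℤ) ^ (∑ i, a.1 i)

/-- A bilinear form that is nonpositive on a hyperplane. -/
def Lorentzian {U : Type*} [AddCommGroup U] [Module ℝ U] (P : LinearMap.BilinForm ℝ U) : Prop :=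
  ∃ l : U →ₗ[ℝ] ℝ, ∀ u, l u = 0 → P u u ≤ 0

section Lorentzian

variable {U : Type*} [AddCommGroup U] [Module ℝ U]

/-- The reverse Cauchy–Schwarz inequality. -/
theorem Lorentzian.mul_le_sq {P : LinearMap.BilinForm ℝ U} (hP : Lorentzian P)
    (hs : ∀ u v, P u v = P v u) {w : U} (hw : 0 < P w w) (u : U) :
    P u u * P w w ≤ P u w ^ 2 := by
  obtain ⟨l, hl⟩ := hP
  have hlw : l w ≠ 0 := fun h => absurd (hl w h) (not_le.2 hw)
  set t := l u / l w with ht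
  have hz : l (u - t • w) = 0 := by
    simp only [map_sub, map_smul, smul_eq_mul, ht]
    field_simp
    ring
  have h := hl _ hz
  simp only [map_sub, map_smul, LinearMap.sub_apply, LinearMap.smul_apply, smul_eq_mul,
    hs w u] at h
  nlinarith [sq_nonneg (P u w - t * P w w), mul_le_mul_of_nonneg_right h hw.le]

/-- Lorentzian forms `P₁`, `P₂` whose Gram data are linked by `P₁ κ = P₂ a` have a Lorentzian
sum. -/
theorem Lorentzian.add {P₁ P₂ : LinearMap.BilinForm ℝ U} (h₁ : Lorentzian P₁)
    (h₂ : Lorentzian P₂) (hs₁ : ∀ u v, P₁ u v = P₁ v u) (hs₂ : ∀ u v, P₂ u v = P₂ v u)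
    {κ a b : U} (hκ : ∀ v, P₁ κ v = P₂ a v) (haκ : P₂ a κ = P₂ a b - P₂ a a)
    (ha : 0 < P₂ a a) (hab : 0 ≤ P₂ a b) : Lorentzian (P₁ + P₂) := by
  have hcs := fun v => h₂.mul_le_sq hs₂ ha v
  obtain ⟨l, hl⟩ := h₁
  set τ := P₂ a a with hτ
  set s := Real.sqrt (P₂ a b / τ) with hs
  have hs0 : 0 ≤ s := Real.sqrt_nonneg _
  have hss : s ^ 2 * τ = P₂ a b := by
    rw [hs, Real.sq_sqrt (by positivity)]
    field_simp
  set c := 1 / (τ * (s + 1)) with hc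
  have hcτ : c * (τ * (s + 1)) = 1 := by
    rw [hc]
    have : s + 1 ≠ 0 := by positivity
    field_simp
  have hK : P₁ κ κ = τ * (s ^ 2 - 1) := by
    rw [hκ, haκ]
    linarith
  have hcK : (2 * c + c ^ 2 * P₁ κ κ) * τ = 1 := by
    rw [hK]
    linear_combination (c * τ * (s - 1) + 1) * hcτ
  refine ⟨l + (c * l κ) • P₁ κ, fun v hv => ?_⟩
  have hz : l (v + (c * P₁ κ v) • κ) = 0 := by
    simp only [LinearMap.add_apply, LinearMap.smul_apply, smul_eq_mul] at hv
    simp only [map_add, map_smul, smul_eq_mul]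
    linarith
  have h := hl _ hz
  simp only [map_add, map_smul, LinearMap.add_apply, LinearMap.smul_apply, smul_eq_mul,
    hs₁ v κ] at h ⊢
  have h' := hcs v
  rw [hs₂ v a, ← hκ v] at h'
  have : (P₁ v v * τ + P₁ κ v ^ 2 * ((2 * c + c ^ 2 * P₁ κ κ) * τ)) ≤ 0 := by
    nlinarith [mul_le_mul_of_nonneg_right h ha.le]
  rw [hcK] at this
  by_contra hcon
  nlinarith [mul_pos (not_le.1 hcon) ha]

end Lorentzian

section DeletionContraction

open Classical

variable {α E : Type*} [SemilatticeSup α] (f : E → α) (c : α → ℕ)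

/-- Deletion–contraction evaluation: the list of elements is processed one at a time from the
flat `x`; loops shift the weight `ψ`, and a final flat of corank `k` has weight `θ ^ k`. -/
noncomputable def tutte (θ : ℝ) : α → List E → (ℤ → ℝ) → ℝ
  | x, [], ψ => θ ^ c x * ψ 0
  | x, g :: S, ψ =>
    if f g ≤ x then tutte θ x S (fun k => ψ (k + 1))
    else tutte θ x S ψ + tutte θ (x ⊔ f g) S ψ

variable {f c}

theorem sup_eq_sup_of_le (hc : ∀ x e, ¬ f e ≤ x → c x = c (x ⊔ f e) + 1) {x : α} {e g : E}
    (he : ¬ f e ≤ x) (hg : ¬ f g ≤ x) (h : f e ≤ x ⊔ f g) : f g ≤ x ⊔ f e := by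
  by_contra hcon
  have h₁ := hc x e he
  have h₂ := hc x g hg
  have h₃ := hc _ g hcon
  have h₄ : x ⊔ f e ⊔ f g = x ⊔ f g := by
    rw [sup_right_comm, sup_eq_left.2 h]
  rw [h₄] at h₃
  omega

theorem sup_eq_sup_iff (hc : ∀ x e, ¬ f e ≤ x → c x = c (x ⊔ f e) + 1) {x : α} {e g : E}
    (he : ¬ f e ≤ x) (hg : ¬ f g ≤ x) : x ⊔ f e = x ⊔ f g ↔ f e ≤ x ⊔ f g := by
  refine ⟨fun h => h ▸ le_sup_right, fun h => le_antisymm (sup_le le_sup_left h) ?_⟩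
  exact sup_le le_sup_left (sup_eq_sup_of_le hc he hg h)

theorem tutte_perm (hc : ∀ x e, ¬ f e ≤ x → c x = c (x ⊔ f e) + 1) (θ : ℝ) {S S' : List E}
    (h : S.Perm S') (x : α) (ψ : ℤ → ℝ) : tutte f c θ x S ψ = tutte f c θ x S' ψ := by
  induction h generalizing x ψ with
  | nil => rfl
  | cons g _ ih => simp only [tutte, ih]
  | trans _ _ ih₁ ih₂ => exact (ih₁ x ψ).trans (ih₂ x ψ)
  | swap g h S =>
    simp only [tutte]
    by_cases hg : f g ≤ x <;> by_cases hh : f h ≤ x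
    · simp [hg, hh]
    · simp [hg, hh, hg.trans (le_sup_left : x ≤ x ⊔ f h)]
    · simp [hg, hh, hh.trans (le_sup_left : x ≤ x ⊔ f g)]
    · by_cases hgh : f g ≤ x ⊔ f h
      · simp [hg, hh, hgh, (sup_eq_sup_iff hc hg hh).2 hgh]
      · have hhg : ¬ f h ≤ x ⊔ f g := fun h' => hgh (sup_eq_sup_of_le hc hh hg h')
        simp only [hg, hh, hgh, hhg, if_false, sup_right_comm x (f h)]
        ring

theorem tutte_of_forall_le (θ : ℝ) (S : List E) (x : α) (ψ : ℤ → ℝ) (h : ∀ e, f e ≤ x) :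
    tutte f c θ x S ψ = θ ^ c x * ψ S.length := by
  induction S generalizing ψ with
  | nil => rfl
  | cons g S ih => simp [tutte, h, ih]

theorem tutte_zero_eq_zero {y : α} (hy : ∀ z ≤ y, c z ≠ 0) {S : List E} (hS : ∀ e ∈ S, f e ≤ y)
    {x : α} (hx : x ≤ y) (ψ : ℤ → ℝ) : tutte f c 0 x S ψ = 0 := by
  induction S generalizing x ψ with
  | nil => simp [tutte, hy x hx]
  | cons g S ih =>
    have hS' : ∀ e ∈ S, f e ≤ y := fun e he => hS e (List.mem_cons_of_mem _ he)
    simp only [tutte, ih hS' hx, ih hS' (sup_le hx (hS g List.mem_cons_self))]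
    simp

theorem tutte_pos {θ : ℝ} (hθ : 0 < θ) (S : List E) (x : α) {ψ : ℤ → ℝ} (hψ : ∀ k, 0 < ψ k) :
    0 < tutte f c θ x S ψ := by
  induction S generalizing x ψ with
  | nil => exact mul_pos (pow_pos hθ _) (hψ 0)
  | cons g S ih =>
    simp only [tutte]
    split_ifs
    · exact ih _ fun k => hψ (k + 1)
    · exact add_pos (ih _ hψ) (ih _ hψ)

theorem continuous_tutte (S : List E) (x : α) (ψ : ℤ → ℝ) :
    Continuous fun θ => tutte f c θ x S ψ := by
  induction S generalizing x ψ with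
  | nil =>
    simp only [tutte]
    fun_prop
  | cons g S ih =>
    simp only [tutte]
    split_ifs
    · exact ih _ _
    · exact (ih _ _).add (ih _ _)

variable (f c) [Fintype E]

/-- The coordinates of the elements whose join with `x` is `y`. -/
noncomputable def classForm (x y : α) : ℝ × ℝ × (E → ℝ) →ₗ[ℝ] ℝ :=
  ∑ e, (if ¬ f e ≤ x ∧ x ⊔ f e = y then (1 : ℝ) else 0) •
    (LinearMap.proj e ∘ₗ LinearMap.snd ℝ ℝ _ ∘ₗ LinearMap.snd ℝ ℝ _)

/-- The linear form extending the first coordinate in the base case of `tutteForm`. -/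
noncomputable def fstForm (θ : ℝ) (x : α) : ℝ × ℝ × (E → ℝ) →ₗ[ℝ] ℝ :=
  LinearMap.fst ℝ ℝ _ + ∑ e, (if f e ≤ x then (-1 : ℝ) else θ⁻¹) •
    (LinearMap.proj e ∘ₗ LinearMap.snd ℝ ℝ _ ∘ₗ LinearMap.snd ℝ ℝ _)

/-- The linear form extending the second coordinate in the base case of `tutteForm`. -/
noncomputable def sndForm (x : α) : ℝ × ℝ × (E → ℝ) →ₗ[ℝ] ℝ :=
  LinearMap.fst ℝ ℝ _ ∘ₗ LinearMap.snd ℝ ℝ _ + ∑ e, (if f e ≤ x then (1 : ℝ) else 0) •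
    (LinearMap.proj e ∘ₗ LinearMap.snd ℝ ℝ _ ∘ₗ LinearMap.snd ℝ ℝ _)

/-- A bilinear form refining `tutte`: its value on the first basis vector is `tutte`, and the
other coordinates record shifts of `ψ` and contractions of single elements. -/
noncomputable def tutteForm (θ : ℝ) :
    α → List E → (ℤ → ℝ) → LinearMap.BilinForm ℝ (ℝ × ℝ × (E → ℝ))
  | x, [], ψ =>
    θ ^ c x • (ψ 0 • (fstForm f θ x).smulRight (fstForm f θ x) +
      ψ 1 • ((fstForm f θ x).smulRight (sndForm f x) +
        (sndForm f x).smulRight (fstForm f θ x)) +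
      ψ 2 • (sndForm f x).smulRight (sndForm f x)) -
    (θ ^ c x * (θ⁻¹ ^ 2 * ψ 0 - θ⁻¹ * ψ 1 + θ⁻¹ * ψ 0)) •
      ∑ y ∈ Finset.univ.image (fun e => x ⊔ f e),
        (classForm f x y).smulRight (classForm f x y)
  | x, g :: S, ψ =>
    if f g ≤ x then tutteForm θ x S (fun k => ψ (k + 1))
    else tutteForm θ x S ψ + tutteForm θ (x ⊔ f g) S ψ

/-- The first basis vector. -/
def vecFst : ℝ × ℝ × (E → ℝ) := (1, 0, 0)

/-- The second basis vector. -/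
def vecSnd : ℝ × ℝ × (E → ℝ) := (0, 1, 0)

/-- The basis vector of the element `e`. -/
noncomputable def vecElt (e : E) : ℝ × ℝ × (E → ℝ) := (0, 0, Pi.single e 1)

variable {f c}

theorem tutteForm_comm (θ : ℝ) (S : List E) (x : α) (ψ : ℤ → ℝ) (u v) :
    tutteForm f c θ x S ψ u v = tutteForm f c θ x S ψ v u := by
  induction S generalizing x ψ with
  | nil =>
    simp only [tutteForm, LinearMap.sub_apply, LinearMap.smul_apply, LinearMap.add_apply,
      LinearMap.smulRight_apply, LinearMap.sum_apply, smul_eq_mul]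
    congr 1
    · ring
    · simp_rw [mul_comm]
  | cons g S ih =>
    simp only [tutteForm]
    split_ifs
    · exact ih _ _
    · simp only [LinearMap.add_apply, ih]

theorem fstForm_apply (θ : ℝ) (x : α) (v) :
    fstForm f θ x v = v.1 + ∑ e, (if f e ≤ x then (-1 : ℝ) else θ⁻¹) * v.2.2 e := by
  simp only [fstForm, LinearMap.add_apply, LinearMap.sum_apply, LinearMap.smul_apply, smul_eq_mul]
  rfl

theorem sndForm_apply (x : α) (v) :
    sndForm f x v = v.2.1 + ∑ e, (if f e ≤ x then (1 : ℝ) else 0) * v.2.2 e := by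
  simp only [sndForm, LinearMap.add_apply, LinearMap.sum_apply, LinearMap.smul_apply, smul_eq_mul]
  rfl

theorem classForm_apply (x y : α) (v) :
    classForm f x y v = ∑ e, (if ¬ f e ≤ x ∧ x ⊔ f e = y then (1 : ℝ) else 0) * v.2.2 e := by
  simp only [classForm, LinearMap.sum_apply, LinearMap.smul_apply, smul_eq_mul]
  rfl

@[simp] theorem fstForm_vecFst (θ : ℝ) (x : α) : fstForm f θ x (vecFst) = 1 := by
  simp [fstForm_apply, vecFst]

@[simp] theorem fstForm_vecSnd (θ : ℝ) (x : α) : fstForm f θ x (vecSnd) = 0 := by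
  simp [fstForm_apply, vecSnd]

@[simp] theorem fstForm_vecElt (θ : ℝ) (x : α) (e : E) :
    fstForm f θ x (vecElt e) = if f e ≤ x then -1 else θ⁻¹ := by
  simp [fstForm_apply, vecElt, Pi.single_apply]

@[simp] theorem sndForm_vecFst (x : α) : sndForm f x (vecFst) = 0 := by
  simp [sndForm_apply, vecFst]

@[simp] theorem sndForm_vecSnd (x : α) : sndForm f x (vecSnd) = 1 := by
  simp [sndForm_apply, vecSnd]

@[simp] theorem sndForm_vecElt (x : α) (e : E) :
    sndForm f x (vecElt e) = if f e ≤ x then 1 else 0 := by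
  simp [sndForm_apply, vecElt, Pi.single_apply]

@[simp] theorem classForm_vecFst (x y : α) : classForm f x y (vecFst) = 0 := by
  simp [classForm_apply, vecFst]

@[simp] theorem classForm_vecSnd (x y : α) : classForm f x y (vecSnd) = 0 := by
  simp [classForm_apply, vecSnd]

@[simp] theorem classForm_vecElt (x y : α) (e : E) :
    classForm f x y (vecElt e) = if ¬ f e ≤ x ∧ x ⊔ f e = y then 1 else 0 := by
  simp [classForm_apply, vecElt, Pi.single_apply]

theorem tutteForm_vecFst (θ : ℝ) (S : List E) (x : α) (ψ : ℤ → ℝ) :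
    tutteForm f c θ x S ψ vecFst vecFst = tutte f c θ x S ψ := by
  induction S generalizing x ψ with
  | nil => simp [tutteForm, tutte]
  | cons g S ih =>
    simp only [tutteForm, tutte]
    split_ifs
    · exact ih _ _
    · simp only [LinearMap.add_apply, ih]

theorem tutteForm_vecSnd (θ : ℝ) (S : List E) (x : α) (ψ : ℤ → ℝ) (v) :
    tutteForm f c θ x S ψ vecSnd v = tutteForm f c θ x S (fun k => ψ (k + 1)) vecFst v := by
  induction S generalizing x ψ with
  | nil => simp [tutteForm, one_add_one_eq_two]
  | cons g S ih =>
    simp only [tutteForm]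
    split_ifs
    · exact ih _ _
    · simp only [LinearMap.add_apply, ih]

theorem tutteForm_vecElt_of_le (θ : ℝ) (S : List E) {x : α} (ψ : ℤ → ℝ) {g : E} (hg : f g ≤ x)
    (v) : tutteForm f c θ x S ψ (vecElt g) v =
      tutteForm f c θ x S ψ vecSnd v - tutteForm f c θ x S ψ vecFst v := by
  induction S generalizing x ψ with
  | nil =>
    simp [tutteForm, hg]
    ring
  | cons h S ih =>
    simp only [tutteForm]
    split_ifs
    · exact ih _ hg
    · simp only [LinearMap.add_apply, ih _ hg, ih _ (hg.trans (le_sup_left : x ≤ x ⊔ f h))]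
      ring

theorem fstForm_sup (hc : ∀ x e, ¬ f e ≤ x → c x = c (x ⊔ f e) + 1) (θ : ℝ) {x : α} {g : E}
    (hg : ¬ f g ≤ x) (v) :
    fstForm f θ (x ⊔ f g) v = fstForm f θ x v - (1 + θ⁻¹) * classForm f x (x ⊔ f g) v := by
  simp only [fstForm_apply, classForm_apply, Finset.mul_sum, add_sub_assoc,
    ← Finset.sum_sub_distrib]
  congr 1
  refine Finset.sum_congr rfl fun e _ => ?_
  by_cases he : f e ≤ x
  · simp [he, he.trans (le_sup_left : x ≤ x ⊔ f g)]
  · by_cases heg : f e ≤ x ⊔ f g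
    · simp [he, heg, sup_eq_sup_iff hc he hg]
      ring
    · simp [he, heg, sup_eq_sup_iff hc he hg]

theorem sndForm_sup (hc : ∀ x e, ¬ f e ≤ x → c x = c (x ⊔ f e) + 1) {x : α} {g : E}
    (hg : ¬ f g ≤ x) (v) :
    sndForm f (x ⊔ f g) v = sndForm f x v + classForm f x (x ⊔ f g) v := by
  simp only [sndForm_apply, classForm_apply, add_assoc, ← Finset.sum_add_distrib]
  congr 1
  refine Finset.sum_congr rfl fun e _ => ?_
  by_cases he : f e ≤ x
  · simp [he, he.trans (le_sup_left : x ≤ x ⊔ f g)]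
  · simp [he, sup_eq_sup_iff hc he hg]

theorem tutteForm_vecElt_of_not_le (hc : ∀ x e, ¬ f e ≤ x → c x = c (x ⊔ f e) + 1) {θ : ℝ}
    (hθ : θ ≠ 0) (S : List E) {x : α} (ψ : ℤ → ℝ) {g : E} (hg : ¬ f g ≤ x) (v) :
    tutteForm f c θ x S ψ (vecElt g) v = tutteForm f c θ (x ⊔ f g) S ψ vecFst v := by
  induction S generalizing x ψ with
  | nil =>
    have hsum : ∑ y ∈ Finset.univ.image (fun e => x ⊔ f e),
        classForm f x y (vecElt g) * classForm f x y v = classForm f x (x ⊔ f g) v := by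
      rw [Finset.sum_eq_single_of_mem (x ⊔ f g) (Finset.mem_image.2 ⟨g, by simp⟩)]
      · simp [hg]
      · intro y _ hy
        simp [hy.symm]
    simp only [tutteForm, LinearMap.sub_apply, LinearMap.smul_apply, LinearMap.add_apply,
      LinearMap.smulRight_apply, LinearMap.sum_apply, smul_eq_mul, hsum]
    simp only [fstForm_vecElt, hg, sndForm_vecElt, fstForm_vecFst, sndForm_vecFst,
      classForm_vecFst, if_false, fstForm_sup hc θ hg, sndForm_sup hc hg, hc x g hg, pow_succ,
      zero_mul, mul_zero, Finset.sum_const_zero]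
    field_simp
    ring
  | cons h S ih =>
    simp only [tutteForm]
    by_cases hh : f h ≤ x
    · rw [if_pos hh, if_pos (hh.trans le_sup_left), ih _ hg]
    · rw [if_neg hh, LinearMap.add_apply, LinearMap.add_apply, ih _ hg]
      by_cases hhg : f h ≤ x ⊔ f g
      · have hxx := (sup_eq_sup_iff hc hh hg).2 hhg
        rw [if_pos hhg, hxx, tutteForm_vecElt_of_le _ _ _ le_sup_right, tutteForm_vecSnd]
        ring
      · have hgh : ¬ f g ≤ x ⊔ f h := fun h' => hhg (sup_eq_sup_of_le hc hg hh h')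
        rw [if_neg hhg, ih _ hgh, sup_right_comm, LinearMap.add_apply, LinearMap.add_apply]

theorem lorentzian_tutteForm_nil {θ : ℝ} (hθ : 0 < θ) (x : α) {ψ : ℤ → ℝ} (hψ : ∀ k, 0 < ψ k)
    (hlc : ∀ k, ψ k * ψ (k + 2) ≤ ψ (k + 1) ^ 2) (h : θ * ψ 1 ≤ ψ 0) :
    Lorentzian (tutteForm f c θ x ([] : List E) ψ) := by
  refine ⟨ψ 0 • fstForm f θ x + ψ 1 • sndForm f x, fun u hu => ?_⟩
  simp only [LinearMap.add_apply, LinearMap.smul_apply, smul_eq_mul] at hu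
  simp only [tutteForm, LinearMap.sub_apply, LinearMap.smul_apply, LinearMap.add_apply,
    LinearMap.smulRight_apply, LinearMap.sum_apply, smul_eq_mul]
  have h₁ : 0 ≤ θ⁻¹ ^ 2 * ψ 0 - θ⁻¹ * ψ 1 + θ⁻¹ * ψ 0 := by
    have : θ⁻¹ ^ 2 * ψ 0 - θ⁻¹ * ψ 1 = θ⁻¹ ^ 2 * (ψ 0 - θ * ψ 1) := by
      field_simp
    rw [this]
    have := hψ 0
    have := sub_nonneg.2 h
    positivity
  have h₂ : 0 ≤ ∑ y ∈ Finset.univ.image (fun e => x ⊔ f e),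
      classForm f x y u * classForm f x y u :=
    Finset.sum_nonneg fun _ _ => mul_self_nonneg _
  set A := fstForm f θ x u
  set B := sndForm f x u
  have h₃ : ψ 0 * (A * A) + ψ 1 * (A * B + B * A) + ψ 2 * (B * B) ≤ 0 := by
    by_contra hcon
    have hlc0 := hlc 0
    norm_num at hlc0
    have h₄ := mul_pos (hψ 0) (not_le.1 hcon)
    have hA : ψ 0 * A = - (ψ 1 * B) := by linarith
    have : ψ 0 * (ψ 0 * (A * A) + ψ 1 * (A * B + B * A) + ψ 2 * (B * B)) =
        (ψ 0 * ψ 2 - ψ 1 ^ 2) * (B * B) := by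
      linear_combination (ψ 0 * A + ψ 1 * B) * hA
    rw [this] at h₄
    nlinarith [mul_self_nonneg B]
  have hp : 0 < θ ^ c x := pow_pos hθ _
  have := mul_nonneg (mul_nonneg hp.le h₁) h₂
  have := mul_nonneg hp.le (neg_nonneg.2 h₃)
  linarith

theorem lorentzian_tutteForm (hc : ∀ x e, ¬ f e ≤ x → c x = c (x ⊔ f e) + 1) {θ : ℝ}
    (hθ : 0 < θ) (S : List E) (x : α) {ψ : ℤ → ℝ} (hψ : ∀ k, 0 < ψ k)
    (hlc : ∀ k, ψ k * ψ (k + 2) ≤ ψ (k + 1) ^ 2) (h : θ * ψ 1 ≤ ψ 0) :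
    Lorentzian (tutteForm f c θ x S ψ) := by
  induction S generalizing x ψ with
  | nil => exact lorentzian_tutteForm_nil hθ x hψ hlc h
  | cons g S ih =>
    simp only [tutteForm]
    split_ifs with hg
    · refine ih x (fun k => hψ (k + 1)) (fun k => ?_) ?_
      · have := hlc (k + 1)
        rwa [add_right_comm] at this
      · have hlc0 := hlc 0
        norm_num at hlc0 ⊢
        by_contra hcon
        nlinarith [mul_pos (hψ 0) (sub_pos.2 (not_le.1 hcon)), hψ 1, hψ 0]
    · refine (ih x hψ hlc h).add (ih _ hψ hlc h) (tutteForm_comm _ _ _ _) (tutteForm_comm _ _ _ _)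
        (κ := vecElt g) (a := vecFst) (b := vecSnd) ?_ ?_ ?_ ?_
      · exact tutteForm_vecElt_of_not_le hc hθ.ne' S ψ hg
      · rw [tutteForm_comm _ _ _ _ vecFst (vecElt g), tutteForm_comm _ _ _ _ vecFst vecSnd,
          tutteForm_vecElt_of_le _ _ _ le_sup_right]
      · rw [tutteForm_vecFst]
        exact tutte_pos hθ _ _ hψ
      · rw [tutteForm_comm, tutteForm_vecSnd, tutteForm_vecFst]
        exact (tutte_pos hθ _ _ fun k => hψ (k + 1)).le

theorem tutte_mul_le_sq_of_pos (hc : ∀ x e, ¬ f e ≤ x → c x = c (x ⊔ f e) + 1) {θ : ℝ}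
    (hθ : 0 < θ) (S : List E) (x : α) {ψ : ℤ → ℝ} (hψ : ∀ k, 0 < ψ k)
    (hlc : ∀ k, ψ k * ψ (k + 2) ≤ ψ (k + 1) ^ 2) (h : θ * ψ 1 ≤ ψ 0) :
    tutte f c θ x S ψ * tutte f c θ x S (fun k => ψ (k + 2)) ≤
      tutte f c θ x S (fun k => ψ (k + 1)) ^ 2 := by
  have hpos : 0 < tutteForm f c θ x S ψ vecFst vecFst := by
    rw [tutteForm_vecFst]
    exact tutte_pos hθ S x hψ
  have key := (lorentzian_tutteForm hc hθ S x hψ hlc h).mul_le_sq (tutteForm_comm _ _ _ _) hpos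
    vecSnd
  rw [tutteForm_vecSnd, tutteForm_vecSnd, tutteForm_comm _ _ _ _ vecFst vecSnd, tutteForm_vecSnd,
    tutteForm_vecFst, tutteForm_vecFst, tutteForm_vecFst, mul_comm] at key
  simpa only [add_assoc, one_add_one_eq_two] using key

theorem tutte_zero_mul_le_sq (hc : ∀ x e, ¬ f e ≤ x → c x = c (x ⊔ f e) + 1) (S : List E) (x : α)
    {ψ : ℤ → ℝ} (hψ : ∀ k, 0 < ψ k) (hlc : ∀ k, ψ k * ψ (k + 2) ≤ ψ (k + 1) ^ 2) :
    tutte f c 0 x S ψ * tutte f c 0 x S (fun k => ψ (k + 2)) ≤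
      tutte f c 0 x S (fun k => ψ (k + 1)) ^ 2 := by
  have hev : ∀ᶠ θ : ℝ in nhdsWithin 0 (Set.Ioi 0),
      tutte f c θ x S ψ * tutte f c θ x S (fun k => ψ (k + 2)) ≤
        tutte f c θ x S (fun k => ψ (k + 1)) ^ 2 := by
    filter_upwards [Ioc_mem_nhdsGT (div_pos (hψ 0) (hψ 1))] with θ hθ
    exact tutte_mul_le_sq_of_pos hc hθ.1 S x hψ hlc ((le_div_iff₀ (hψ 1)).1 hθ.2)
  refine le_of_tendsto_of_tendsto (Filter.Tendsto.mono_left ?_ nhdsWithin_le_nhds)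
    (Filter.Tendsto.mono_left ?_ nhdsWithin_le_nhds) hev
  · exact ((continuous_tutte S x _).mul (continuous_tutte S x _)).tendsto 0
  · exact ((continuous_tutte S x _).pow 2).tendsto 0

end DeletionContraction

section Superstable

variable {n : ℕ}

/-- The vector of an edge; `(v, v)` stands for the edge joining `v` to the root. -/
def edgeVec (e : Fin n × Fin n) : Fin n → ℚ :=
  if e.1 = e.2 then Pi.single e.1 1 else Pi.single e.1 1 - Pi.single e.2 1

/-- The flat of the graphic matroid spanned by an edge. -/
def edgeFlat (e : Fin n × Fin n) : Submodule ℚ (Fin n → ℚ) :=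
  Submodule.span ℚ {edgeVec e}

/-- The flat obtained by merging the vertices of `R` with the root. -/
def rootFlat (R : Finset (Fin n)) : Submodule ℚ (Fin n → ℚ) :=
  R.sup fun v => Submodule.span ℚ {Pi.single v 1}

/-- The corank of a flat. -/
noncomputable def corank (x : Submodule ℚ (Fin n → ℚ)) : ℕ :=
  n - Module.finrank ℚ x

/-- The edge `e` joins `v` to the root or to a vertex in `R`. -/
def Joins (R : Finset (Fin n)) (e : Fin n × Fin n) (v : Fin n) : Prop :=
  e.1 = v ∧ (e.2 = v ∨ e.2 ∈ R) ∨ e.2 = v ∧ e.1 ∈ R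

theorem edgeFlat_le_iff {e : Fin n × Fin n} {x : Submodule ℚ (Fin n → ℚ)} :
    edgeFlat e ≤ x ↔ edgeVec e ∈ x :=
  Submodule.span_singleton_le_iff_mem _ _

theorem corank_eq_succ (x : Submodule ℚ (Fin n → ℚ)) (e : Fin n × Fin n)
    (he : ¬ edgeFlat e ≤ x) : corank x = corank (x ⊔ edgeFlat e) + 1 := by
  have h := Submodule.finrank_sup_span_singleton (mt edgeFlat_le_iff.2 he)
  have h' := Submodule.finrank_le (x ⊔ edgeFlat e)
  rw [Module.finrank_fin_fun] at h'
  unfold corank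
  unfold edgeFlat at *
  omega

theorem corank_ne_zero {x : Submodule ℚ (Fin n → ℚ)} (hx : x ≠ ⊤) : corank x ≠ 0 := by
  have h := Submodule.finrank_lt hx
  rw [Module.finrank_fin_fun] at h
  unfold corank
  omega

theorem single_mem_rootFlat {R : Finset (Fin n)} {v : Fin n} (hv : v ∈ R) :
    (Pi.single v 1 : Fin n → ℚ) ∈ rootFlat R :=
  Finset.le_sup (f := fun v => Submodule.span ℚ {(Pi.single v 1 : Fin n → ℚ)}) hv
    (Submodule.mem_span_singleton_self _)

theorem rootFlat_le_iff {R : Finset (Fin n)} {x : Submodule ℚ (Fin n → ℚ)} :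
    rootFlat R ≤ x ↔ ∀ v ∈ R, (Pi.single v 1 : Fin n → ℚ) ∈ x := by
  simp [rootFlat]

theorem apply_eq_zero_of_mem_rootFlat {R : Finset (Fin n)} {v : Fin n} (hv : v ∉ R)
    {w : Fin n → ℚ} (hw : w ∈ rootFlat R) : w v = 0 := by
  have : rootFlat R ≤ LinearMap.ker (LinearMap.proj v : (Fin n → ℚ) →ₗ[ℚ] ℚ) := by
    rw [rootFlat_le_iff]
    intro u hu
    have : v ≠ u := fun h => hv (h ▸ hu)
    simp [this]
  simpa using this hw

theorem rootFlat_univ : rootFlat (Finset.univ : Finset (Fin n)) = ⊤ := by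
  rw [eq_top_iff]
  intro w _
  rw [pi_eq_sum_univ' w]
  exact Submodule.sum_mem _ fun v _ => Submodule.smul_mem _ _ (by
    convert single_mem_rootFlat (Finset.mem_univ v) using 1)

theorem corank_top : corank (⊤ : Submodule ℚ (Fin n → ℚ)) = 0 := by
  simp [corank]

theorem Joins.edgeVec_eq {R : Finset (Fin n)} {e : Fin n × Fin n} {v : Fin n} (h : Joins R e v)
    (hv : v ∉ R) : ∃ w ∈ rootFlat R, edgeVec e = Pi.single v 1 + w ∨
      edgeVec e = w - Pi.single v 1 := by
  obtain ⟨a, b⟩ := e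
  simp only [Joins] at h
  rcases h with ⟨rfl, rfl | h⟩ | ⟨rfl, h⟩
  · exact ⟨0, Submodule.zero_mem _, Or.inl (by simp [edgeVec])⟩
  · refine ⟨-Pi.single b 1, Submodule.neg_mem _ (single_mem_rootFlat h), Or.inl ?_⟩
    have : a ≠ b := fun h' => hv (h' ▸ h)
    simp [edgeVec, this, sub_eq_add_neg]
  · refine ⟨Pi.single a 1, single_mem_rootFlat h, Or.inr ?_⟩
    have : a ≠ b := fun h' => hv (h' ▸ h)
    simp [edgeVec, this]

theorem Joins.not_edgeFlat_le {R : Finset (Fin n)} {e : Fin n × Fin n} {v : Fin n}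
    (h : Joins R e v) (hv : v ∉ R) : ¬ edgeFlat e ≤ rootFlat R := by
  rw [edgeFlat_le_iff]
  intro he
  have h₁ := apply_eq_zero_of_mem_rootFlat hv he
  obtain ⟨w, hw, h₂ | h₂⟩ := h.edgeVec_eq hv <;>
  simp [h₂, apply_eq_zero_of_mem_rootFlat hv hw] at h₁

theorem Joins.rootFlat_sup {R : Finset (Fin n)} {e : Fin n × Fin n} {v : Fin n}
    (h : Joins R e v) (hv : v ∉ R) : rootFlat R ⊔ edgeFlat e = rootFlat (insert v R) := by
  obtain ⟨w, hw, h₂⟩ := h.edgeVec_eq hv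
  have hle : rootFlat R ≤ rootFlat (insert v R) := Finset.sup_mono (Finset.subset_insert v R)
  have hv' := single_mem_rootFlat (Finset.mem_insert_self v R)
  apply le_antisymm
  · rw [sup_le_iff, edgeFlat_le_iff]
    refine ⟨hle, ?_⟩
    rcases h₂ with h₂ | h₂ <;> rw [h₂]
    · exact Submodule.add_mem _ hv' (hle hw)
    · exact Submodule.sub_mem _ (hle hw) hv'
  · rw [rootFlat_le_iff]
    intro u hu
    rcases Finset.mem_insert.1 hu with rfl | hu
    · have he : edgeVec e ∈ rootFlat R ⊔ edgeFlat e := edgeFlat_le_iff.1 le_sup_right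
      have hw' : w ∈ rootFlat R ⊔ edgeFlat e := le_sup_left (a := rootFlat R) hw
      rcases h₂ with h₂ | h₂
      · simpa [h₂] using Submodule.sub_mem _ he hw'
      · simpa [h₂] using Submodule.sub_mem _ hw' he
    · exact le_sup_left (a := rootFlat R) (single_mem_rootFlat hu)

theorem tutte_zero_rootFlat_eq_zero {R : Finset (Fin n)} (hR : R ≠ Finset.univ)
    {S : List (Fin n × Fin n)} (hS : ∀ e ∈ S, ∀ v ∉ R, ¬ Joins R e v) (ψ : ℤ → ℝ) :
    tutte edgeFlat corank 0 (rootFlat R) S ψ = 0 := by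
  obtain ⟨v, hv⟩ : ∃ v, v ∉ R := by
    by_contra! h
    exact hR (Finset.eq_univ_of_forall h)
  let l : (Fin n → ℚ) →ₗ[ℚ] ℚ := ∑ v ∈ Rᶜ, LinearMap.proj v
  have hl : ∀ v, l (Pi.single v 1) = if v ∈ R then 0 else 1 := by
    intro v
    simp [l, Pi.single_apply, Finset.sum_ite_eq']
  refine tutte_zero_eq_zero (y := LinearMap.ker l) ?_ ?_ ?_ ψ
  · intro z hz
    refine corank_ne_zero ?_
    rintro rfl
    have : l (Pi.single v 1) = 0 := hz Submodule.mem_top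
    simp [hl, hv] at this
  · rintro ⟨a, b⟩ he
    have h := hS _ he
    rw [edgeFlat_le_iff, LinearMap.mem_ker]
    simp only [Joins] at h
    have ha := h a
    have hb := h b
    by_cases hab : a = b
    · subst hab
      by_cases haR : a ∈ R
      · simp [edgeVec, hl, haR]
      · exact absurd (Or.inl ⟨rfl, Or.inl rfl⟩) (ha haR)
    · by_cases haR : a ∈ R <;> by_cases hbR : b ∈ R
      · simp [edgeVec, hab, hl, haR, hbR]
      · exact absurd (Or.inr ⟨rfl, haR⟩) (hb hbR)
      · exact absurd (Or.inl ⟨rfl, Or.inr hbR⟩) (ha haR)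
      · simp [edgeVec, hab, hl, haR, hbR]
  · rw [rootFlat_le_iff]
    intro u hu
    simp [hl, hu]

/-- The number of edges in `S` joining `v` to the root or to a vertex outside `A`. -/
def outDegree (S : Finset (Fin n × Fin n)) (v : Fin n) (A : Finset (Fin n)) : ℕ :=
  (S.filter fun e => e.1 = v ∧ (e.2 = v ∨ e.2 ∉ A) ∨ e.2 = v ∧ e.1 ∉ A).card

/-- The superstable configurations of the graph with edges `S` whose vertices in `R` are merged
with the root. -/
def superstable (R : Finset (Fin n)) (S : Finset (Fin n × Fin n)) : Set (Fin n → ℕ) :=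
  {a | (∀ v ∈ R, a v = 0) ∧
    ∀ A : Finset (Fin n), A.Nonempty → Disjoint A R → ∃ v ∈ A, a v < outDegree S v A}

theorem finite_superstable (R : Finset (Fin n)) (S : Finset (Fin n × Fin n)) :
    (superstable R S).Finite := by
  refine (Set.finite_Icc 0 fun _ => S.card).subset fun a ha => ⟨fun _ => Nat.zero_le _, fun v => ?_⟩
  by_cases hv : v ∈ R
  · simp [ha.1 v hv]
  · obtain ⟨u, hu, h⟩ := ha.2 {v} (Finset.singleton_nonempty v) (by simpa using hv)
    rw [Finset.mem_singleton] at hu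
    subst hu
    exact h.le.trans (Finset.card_filter_le _ _)

theorem outDegree_insert {R : Finset (Fin n)} {e : Fin n × Fin n} {v : Fin n} (h : Joins R e v)
    {S : Finset (Fin n × Fin n)} (he : e ∉ S) {A : Finset (Fin n)} (hA : Disjoint A R)
    {u : Fin n} (hu : u ∈ A) :
    outDegree (insert e S) u A = outDegree S u A + if u = v then 1 else 0 := by
  have hR : ∀ w ∈ R, w ∉ A := fun w hw hw' => Finset.disjoint_left.1 hA hw' hw
  have hiff : (e.1 = u ∧ (e.2 = u ∨ e.2 ∉ A) ∨ e.2 = u ∧ e.1 ∉ A) ↔ u = v := by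
    obtain ⟨a, b⟩ := e
    simp only [Joins] at h ⊢
    grind
  unfold outDegree
  rw [Finset.filter_insert]
  split_ifs with h₁ h₂ h₂
  · rw [Finset.card_insert_of_notMem (by simp [he])]
  · exact absurd (hiff.1 h₁) h₂
  · exact absurd (hiff.2 h₂) h₁
  · rfl

theorem add_single_mem_superstable_iff {R : Finset (Fin n)} {e : Fin n × Fin n} {v : Fin n}
    (hv : v ∉ R) (h : Joins R e v) {S : Finset (Fin n × Fin n)} (he : e ∉ S) (a : Fin n → ℕ) :
    a + Pi.single v 1 ∈ superstable R (insert e S) ↔ a ∈ superstable R S := by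
  refine and_congr (forall₂_congr fun u hu => ?_) (forall₃_congr fun A _ hA =>
    exists_congr fun u => and_congr_right fun hu => ?_)
  · have : u ≠ v := fun h => hv (h ▸ hu)
    simp [this]
  · rw [outDegree_insert h he hA hu]
    by_cases huv : u = v
    · subst huv
      simp
    · simp [huv]

theorem mem_superstable_insert_iff {R : Finset (Fin n)} {e : Fin n × Fin n} {v : Fin n}
    (h : Joins R e v) {S : Finset (Fin n × Fin n)} (he : e ∉ S) {a : Fin n → ℕ} (ha : a v = 0) :
    a ∈ superstable R (insert e S) ↔ a ∈ superstable (insert v R) S := by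
  constructor
  · refine fun hs => ⟨fun u hu => ?_, fun A hA hAR => ?_⟩
    · rcases Finset.mem_insert.1 hu with rfl | hu
      exacts [ha, hs.1 u hu]
    · rw [Finset.disjoint_insert_right] at hAR
      obtain ⟨u, hu, h'⟩ := hs.2 A hA hAR.2
      have huv : u ≠ v := fun h => hAR.1 (h ▸ hu)
      rw [outDegree_insert h he hAR.2 hu, if_neg huv] at h'
      exact ⟨u, hu, h'⟩
  · refine fun hs => ⟨fun u hu => hs.1 u (Finset.mem_insert_of_mem hu), fun A hA hAR => ?_⟩
    by_cases hvA : v ∈ A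
    · refine ⟨v, hvA, ?_⟩
      rw [outDegree_insert h he hAR hvA, ha, if_pos rfl]
      exact Nat.succ_pos _
    · obtain ⟨u, hu, h'⟩ := hs.2 A hA (Finset.disjoint_insert_right.2 ⟨hvA, hAR⟩)
      refine ⟨u, hu, h'.trans_le ?_⟩
      rw [outDegree_insert h he hAR hu]
      exact Nat.le_add_right _ _

theorem superstable_insert {R : Finset (Fin n)} {e : Fin n × Fin n} {v : Fin n}
    (hv : v ∉ R) (h : Joins R e v) {S : Finset (Fin n × Fin n)} (he : e ∉ S) :
    superstable R (insert e S) =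
      (fun a => a + Pi.single v 1) '' superstable R S ∪ superstable (insert v R) S := by
  ext a
  constructor
  · intro ha
    by_cases hav : a v = 0
    · exact Or.inr ((mem_superstable_insert_iff h he hav).1 ha)
    · have hsub : a - Pi.single v 1 + Pi.single v 1 = a := by
        refine tsub_add_cancel_of_le fun u => ?_
        by_cases huv : u = v
        · subst huv
          simpa using Nat.one_le_iff_ne_zero.2 hav
        · simp [huv]
      refine Or.inl ⟨a - Pi.single v 1, ?_, hsub⟩
      rwa [← add_single_mem_superstable_iff hv h he, hsub]
  · rintro (⟨b, hb, rfl⟩ | ha)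
    · exact (add_single_mem_superstable_iff hv h he b).2 hb
    · exact (mem_superstable_insert_iff h he (ha.1 v (Finset.mem_insert_self v R))).2 ha

theorem finsum_superstable_insert {R : Finset (Fin n)} {e : Fin n × Fin n} {v : Fin n}
    (hv : v ∉ R) (h : Joins R e v) {S : Finset (Fin n × Fin n)} (he : e ∉ S) (φ : ℕ → ℝ) :
    ∑ᶠ a ∈ superstable R (insert e S), φ (∑ i, a i) =
      ∑ᶠ a ∈ superstable R S, φ (∑ i, a i + 1) +
        ∑ᶠ a ∈ superstable (insert v R) S, φ (∑ i, a i) := by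
  rw [superstable_insert hv h he, finsum_mem_union ?_ ((finite_superstable R S).image _)
    (finite_superstable _ S), finsum_mem_image fun a _ b _ hab => add_right_cancel hab]
  · simp [Finset.sum_add_distrib]
  · rw [Set.disjoint_left]
    rintro _ ⟨a, _, rfl⟩ ha
    simpa using ha.1 v (Finset.mem_insert_self v R)

/-- The deletion–contraction evaluation at `θ = 0` enumerates superstable configurations. -/
theorem tutte_zero_eq_finsum (S : Finset (Fin n × Fin n)) (R : Finset (Fin n)) (ψ : ℤ → ℝ) :
    tutte edgeFlat corank 0 (rootFlat R) S.toList ψ =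
      ∑ᶠ a ∈ superstable R S, ψ (S.card - n + R.card - (∑ i, a i : ℕ)) := by
  induction S using Finset.strongInduction generalizing R with
  | H S ih =>
    by_cases hJ : ∃ e ∈ S, ∃ v ∉ R, Joins R e v
    · obtain ⟨e, heS, v, hv, h⟩ := hJ
      have he : e ∉ S.erase e := Finset.notMem_erase e S
      have hsub := Finset.erase_ssubset heS
      obtain ⟨S', hS', hSS⟩ : ∃ S', S.erase e = S' ∧ S = insert e S' :=
        ⟨_, rfl, (Finset.insert_erase heS).symm⟩
      rw [hS'] at he hsub
      subst hSS
      rw [finsum_superstable_insert hv h he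
          (fun k => ψ ((insert e S').card - n + R.card - (k : ℕ))),
        tutte_perm corank_eq_succ 0 (Finset.toList_insert he), tutte,
        if_neg (h.not_edgeFlat_le hv), h.rootFlat_sup hv, ih _ hsub, ih _ hsub,
        Finset.card_insert_of_notMem he, Finset.card_insert_of_notMem hv]
      congr 1 <;> refine finsum_mem_congr rfl fun a _ => congrArg ψ ?_ <;> push_cast <;> ring
    · push Not at hJ
      by_cases hR : R = Finset.univ
      · subst hR
        have hs : superstable Finset.univ S = {0} := by
          ext a
          refine ⟨fun ha => funext fun v => ha.1 v (Finset.mem_univ v), ?_⟩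
          rintro rfl
          refine ⟨fun _ _ => rfl, fun A hA hA' => ?_⟩
          exact absurd (disjoint_top.1 hA') hA.ne_empty
        rw [hs, finsum_mem_singleton, rootFlat_univ, tutte_of_forall_le _ _ _ _ fun _ => le_top]
        simp [corank_top]
      · have hs : superstable R S = ∅ := by
          rw [Set.eq_empty_iff_forall_notMem]
          intro a ha
          obtain ⟨v, hv, h⟩ := ha.2 Rᶜ (by
            rwa [Finset.nonempty_iff_ne_empty, ne_eq, Finset.compl_eq_empty_iff])
            disjoint_compl_left
          have h' := Nat.zero_lt_of_lt h
          rw [outDegree, Finset.card_pos] at h'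
          obtain ⟨e, he⟩ := h'
          rw [Finset.mem_filter] at he
          refine hJ e he.1 v (Finset.mem_compl.1 hv) ?_
          simpa [Joins] using he.2
        rw [hs, finsum_mem_empty]
        exact tutte_zero_rootFlat_eq_zero hR (by simpa using hJ) ψ

end Superstable

section Parking

variable {n : ℕ}

/-- The edges of the complete graph on the root and `n` further vertices. -/
def completeEdges (n : ℕ) : Finset (Fin n × Fin n) :=
  Finset.univ.filter fun e => e.1 ≤ e.2

theorem outDegree_complete {v : Fin n} {A : Finset (Fin n)} (hv : v ∈ A) :
    outDegree (completeEdges n) v A + A.card = n + 1 := by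
  have himg : ((completeEdges n).filter
      fun e => e.1 = v ∧ (e.2 = v ∨ e.2 ∉ A) ∨ e.2 = v ∧ e.1 ∉ A) =
      (insert v Aᶜ).image fun w => (min v w, max v w) := by
    ext ⟨a, b⟩
    simp only [completeEdges, Finset.mem_filter, Finset.mem_univ, true_and, Finset.mem_image,
      Finset.mem_insert, Finset.mem_compl, Prod.mk.injEq]
    constructor
    · rintro ⟨hab, ⟨rfl, rfl | h⟩ | ⟨rfl, h⟩⟩
      · exact ⟨_, Or.inl rfl, by simp⟩
      · exact ⟨b, Or.inr h, by simp [hab]⟩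
      · exact ⟨a, Or.inr h, by simp [hab]⟩
    · rintro ⟨w, hw, rfl, rfl⟩
      rcases le_total v w with h | h <;> simp [h] <;> tauto
  have hinj : Set.InjOn (fun w => (min v w, max v w)) ((insert v Aᶜ : Finset (Fin n)) : Set _) := by
    intro w _ w' _ h
    simp only [Prod.mk.injEq] at h
    grind
  rw [outDegree, himg, Finset.card_image_of_injOn hinj,
    Finset.card_insert_of_notMem (by simpa using hv), Finset.card_compl, Fintype.card_fin]
  have := Finset.card_le_univ A
  rw [Fintype.card_fin] at this
  omega

theorem mem_superstable_complete_iff (a : Fin n → ℕ) :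
    a ∈ superstable ∅ (completeEdges n) ↔ IsParkingFunction (a + 1) := by
  constructor
  · intro ha
    refine ⟨fun i => Nat.le_add_left 1 (a i), Tuple.sort a, fun i j hij =>
      Nat.succ_le_succ (Tuple.monotone_sort a hij), fun i => ?_⟩
    obtain ⟨v, hv, h⟩ := ha.2 ((Finset.Ici i).map (Tuple.sort a).toEmbedding)
      (Finset.Nonempty.map ⟨i, by simp⟩) (Finset.disjoint_empty_right _)
    have hcard := outDegree_complete hv
    rw [Finset.card_map, Fin.card_Ici] at hcard
    obtain ⟨j, hj, rfl⟩ := Finset.mem_map.1 hv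
    have hmono : a (Tuple.sort a i) ≤ a (Tuple.sort a j) :=
      Tuple.monotone_sort a (Finset.mem_Ici.1 hj)
    simp only [Equiv.coe_toEmbedding] at h hcard
    simp only [Pi.add_apply, Pi.one_apply]
    omega
  · rintro ⟨-, σ, -, hσ⟩
    refine ⟨by simp, fun A hA _ => ?_⟩
    obtain ⟨i, hi, hmin⟩ := Finset.exists_min_image (A.map σ.symm.toEmbedding) id (hA.map)
    have hiA : σ i ∈ A := by
      obtain ⟨v, hv, rfl⟩ := Finset.mem_map.1 hi
      simpa using hv
    refine ⟨σ i, hiA, ?_⟩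
    have hcard := outDegree_complete hiA
    have hle : A.card ≤ n - i := by
      rw [← Fin.card_Ici, ← Finset.card_map σ.symm.toEmbedding]
      exact Finset.card_le_card fun j hj => Finset.mem_Ici.2 (hmin j hj)
    have := hσ i
    simp only [Pi.add_apply, Pi.one_apply] at this
    omega

theorem setOf_isParkingFunction : {a : Fin n → ℕ | IsParkingFunction a} = (fun a => a + 1) ''
    superstable ∅ (completeEdges n) := by
  ext a
  constructor
  · intro ha
    have h : a - 1 + 1 = a := tsub_add_cancel_of_le ha.1
    exact ⟨a - 1, (mem_superstable_complete_iff _).2 (h.symm ▸ ha), h⟩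
  · rintro ⟨b, hb, rfl⟩
    exact (mem_superstable_complete_iff b).1 hb

theorem finite_isParkingFunction (n : ℕ) : {a : Fin n → ℕ | IsParkingFunction a}.Finite := by
  rw [setOf_isParkingFunction]
  exact (finite_superstable _ _).image _

theorem tutte_zero_complete (ψ : ℤ → ℝ) :
    tutte edgeFlat corank 0 (rootFlat ∅) (completeEdges n).toList ψ =
      ∑ a ∈ (finite_isParkingFunction n).toFinset,
        ψ ((completeEdges n).card - (∑ i, a i : ℕ)) := by
  rw [← finsum_mem_eq_finite_toFinset_sum _ (finite_isParkingFunction n), tutte_zero_eq_finsum,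
    setOf_isParkingFunction, finsum_mem_image fun a _ b _ hab => add_right_cancel hab]
  refine finsum_mem_congr rfl fun a _ => congrArg ψ ?_
  simp [Finset.sum_add_distrib]
  ring

theorem coeff_pfPoly (k : ℕ) : (pfPoly n).coeff k =
    ∑ a ∈ (finite_isParkingFunction n).toFinset, if ∑ i, a i = k then 1 else 0 := by
  have : pfPoly n = ∑ a ∈ (finite_isParkingFunction n).toFinset,
      (Polynomial.X : Polynomial ℤ) ^ ∑ i, a i := by
    rw [← finsum_mem_eq_finite_toFinset_sum _ (finite_isParkingFunction n)]
    exact finsum_subtype_eq_finsum_cond IsParkingFunction (f := fun a =>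
      (Polynomial.X : Polynomial ℤ) ^ ∑ i, a i)
  simp [this, Polynomial.coeff_X_pow, eq_comm]

/-- Sums of a Gaussian weight over parking functions degenerate to a coefficient of `pfPoly`. -/
theorem tendsto_sum_pow_natAbs (C : ℤ) (i k : ℕ) :
    Filter.Tendsto (fun ε : ℝ => ∑ a ∈ (finite_isParkingFunction n).toFinset,
      ε ^ (C - (∑ j, a j : ℕ) + k - (C - i)).natAbs ^ 2) (nhdsWithin 0 (Set.Ioi 0))
      (nhds ((pfPoly n).coeff (i + k) : ℝ)) := by
  refine Filter.Tendsto.mono_left ?_ nhdsWithin_le_nhds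
  have hcont : Continuous fun ε : ℝ => ∑ a ∈ (finite_isParkingFunction n).toFinset,
      ε ^ (C - (∑ j, a j : ℕ) + k - (C - i)).natAbs ^ 2 := by fun_prop
  convert hcont.tendsto 0 using 2
  rw [coeff_pfPoly, Int.cast_sum]
  refine Finset.sum_congr rfl fun a _ => ?_
  rw [zero_pow_eq, Int.cast_ite, Int.cast_one, Int.cast_zero]
  refine if_congr ?_ rfl rfl
  rw [sq_eq_zero_iff, Int.natAbs_eq_zero]
  omega

theorem pow_natAbs_sq_mul_le {ε : ℝ} (h₀ : 0 ≤ ε) (h₁ : ε ≤ 1) (j k : ℤ) :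
    ε ^ (k - j).natAbs ^ 2 * ε ^ (k + 2 - j).natAbs ^ 2 ≤ (ε ^ (k + 1 - j).natAbs ^ 2) ^ 2 := by
  rw [← pow_add, ← pow_mul]
  refine pow_le_pow_of_le_one h₀ h₁ ?_
  zify
  simp only [sq_abs]
  nlinarith

end Parking

/-- Bóna's conjecture: `P_n(x) = Σ_{π ∈ PF_n} x^(sum π)` has log-concave coefficients for
all `n ≥ 1`. -/
theorem pfPoly_logConcave (n : ℕ) (hn : 1 ≤ n) : PolyLogConcave (pfPoly n) := by
  intro i
  set C : ℤ := ((completeEdges n).card : ℤ) with hC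
  have h := fun k => tendsto_sum_pow_natAbs (n := n) C i k
  have key := le_of_tendsto_of_tendsto ((h 0).mul (h 2)) ((h 1).pow 2) (by
    filter_upwards [Ioc_mem_nhdsGT one_pos] with ε hε
    have := tutte_zero_mul_le_sq corank_eq_succ
      (completeEdges n).toList (rootFlat ∅)
      (fun k => pow_pos hε.1 _) (fun k => pow_natAbs_sq_mul_le hε.1.le hε.2 (C - i) k)
    simpa only [tutte_zero_complete, ← hC, Nat.cast_zero, add_zero, Nat.cast_one,
      Nat.cast_ofNat] using this)
  exact_mod_cast key
end
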